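/- For every 1 ≤ p ≤ ∞ and every flat weight ω for φ, there is no sequence Λ ⊂ ℂ that is simultaneously sampling and interpolating for the space F^p_{φ,ω}. -/

import Mathlib

open MeasureTheory Metric Filter Set
open scoped ENNReal NNReal Real Topology Classical

noncomputable section

/-- The Laplacian of a function on `ℂ ≅ ℝ²`, computed via the second Fréchet derivative. -/
def lap (v : ℂ → ℝ) (z : ℂ) : ℝ :=
  iteratedFDeriv ℝ 2 v z ![1, 1] + iteratedFDeriv ℝ 2 v z ![Complex.I, Complex.I]

/-- `μ` is a doubling measure on `ℂ` with doubling constant `C`. -/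
def IsDoubling (μ : Measure ℂ) (C : ℝ≥0) : Prop :=
  ∀ z : ℂ, ∀ r : ℝ, 0 < r → μ (ball z (2 * r)) ≤ C * μ (ball z r)

/-- `φ` is a (continuous) subharmonic function whose distributional Laplacian is the
doubling measure `μ` (not identically zero).  The distributional identity is expressed
by testing against smooth compactly supported functions. -/
structure HasDoublingLaplacian (φ : ℂ → ℝ) (μ : Measure ℂ) : Prop where
  continuous : Continuous φ
  lap_eq : ∀ v : ℂ → ℝ, ContDiff ℝ (⊤ : ℕ∞) v → HasCompactSupport v →
    ∫ z, φ z * lap v z = ∫ z, v z ∂μ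
  doubling : ∃ C : ℝ≥0, 0 < C ∧ IsDoubling μ C
  ne_zero : μ ≠ 0

/-- `ρ` assigns to every `z` the positive radius such that the disk `D(z, ρ z)` has
`μ`-mass `1`. -/
def IsRadius (μ : Measure ℂ) (ρ : ℂ → ℝ) : Prop :=
  ∀ z : ℂ, 0 < ρ z ∧ μ (ball z (ρ z)) = 1

/-- The distance induced by the metric `ρ(z)⁻² dz⊗d\bar z`: infimum of lengths of
`C¹` curves joining the two points. -/
def pathDist (ρ : ℂ → ℝ) (z ζ : ℂ) : ℝ :=
  sInf { L : ℝ | ∃ γ : ℝ → ℂ, γ 0 = z ∧ γ 1 = ζ ∧ ContDiff ℝ 1 γ ∧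
    L = ∫ t in (0:ℝ)..1, ‖deriv γ t‖ / ρ (γ t) }

/-- The `pathDist` from a point to a set. -/
def pathDistSet (ρ : ℂ → ℝ) (z : ℂ) (Λ : Set ℂ) : ℝ :=
  ⨅ l : Λ, pathDist ρ z l.1

/-- A flat weight for `φ`: a positive measurable function whose logarithm has slow
growth with respect to the induced distance. -/
def IsFlatWeight (ρ : ℂ → ℝ) (ω : ℂ → ℝ) : Prop :=
  (∀ z, 0 < ω z) ∧ Measurable ω ∧
  ∃ C : ℝ, 0 < C ∧ ∀ z ζ : ℂ,
    |Real.log (ω z) - Real.log (ω ζ)| ≤ C * (1 + max (Real.log (pathDist ρ z ζ)) 0)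

/-- The norm of the space `F^p_{φ,ω}` (with `p = ∞` giving the weighted sup norm). -/
def Fnorm (p : ℝ≥0∞) (φ ω ρ : ℂ → ℝ) (f : ℂ → ℂ) : ℝ≥0∞ :=
  if p = ∞ then ⨆ z : ℂ, ENNReal.ofReal (ω z * ‖f z‖ * Real.exp (-φ z))
  else (∫⁻ z, ENNReal.ofReal
      (‖f z‖ ^ p.toReal * Real.exp (-(p.toReal * φ z)) * ω z ^ p.toReal / ρ z ^ 2)) ^
      (1 / p.toReal)

/-- Membership in `F^p_{φ,ω}`: entire with finite norm. -/
def MemF (p : ℝ≥0∞) (φ ω ρ : ℂ → ℝ) (f : ℂ → ℂ) : Prop :=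
  Differentiable ℂ f ∧ Fnorm p φ ω ρ f < ∞

/-- The norm of the sequence space `ℓ^p_{φ,ω}(Λ)`. -/
def lnorm (p : ℝ≥0∞) (φ ω : ℂ → ℝ) (Λ : Set ℂ) (v : ℂ → ℂ) : ℝ≥0∞ :=
  if p = ∞ then ⨆ l : Λ, ENNReal.ofReal (ω l.1 * ‖v l.1‖ * Real.exp (-φ l.1))
  else (∑' l : Λ, ENNReal.ofReal
      (ω l.1 ^ p.toReal * ‖v l.1‖ ^ p.toReal * Real.exp (-(p.toReal * φ l.1)))) ^
      (1 / p.toReal)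

/-- `Λ` is a sampling sequence for `F^p_{φ,ω}`. -/
def IsSampling (p : ℝ≥0∞) (φ ω ρ : ℂ → ℝ) (Λ : Set ℂ) : Prop :=
  if p = ∞ then
    ∃ C : ℝ≥0, 0 < C ∧ ∀ f : ℂ → ℂ, MemF ∞ φ ω ρ f →
      Fnorm ∞ φ ω ρ f ≤ C * lnorm ∞ φ ω Λ f
  else
    ∃ C : ℝ≥0, 0 < C ∧ ∀ f : ℂ → ℂ, MemF p φ ω ρ f →
      (C : ℝ≥0∞)⁻¹ * lnorm p φ ω Λ f ≤ Fnorm p φ ω ρ f ∧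
      Fnorm p φ ω ρ f ≤ C * lnorm p φ ω Λ f

/-- `Λ` is an interpolating sequence for `F^p_{φ,ω}`. -/
def IsInterpolating (p : ℝ≥0∞) (φ ω ρ : ℂ → ℝ) (Λ : Set ℂ) : Prop :=
  ∀ v : ℂ → ℂ, lnorm p φ ω Λ v < ∞ →
    ∃ f : ℂ → ℂ, MemF p φ ω ρ f ∧ ∀ l ∈ Λ, f l = v l

/-- `Λ` is `ρ`-separated. -/
def RhoSeparated (ρ : ℂ → ℝ) (Λ : Set ℂ) : Prop :=
  ∃ δ : ℝ, 0 < δ ∧ ∀ l ∈ Λ, ∀ l' ∈ Λ, l ≠ l' → δ * max (ρ l) (ρ l') ≤ dist l l'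

/-- `Λ` is a finite union of `ρ`-separated sequences. -/
def FiniteUnionSeparated (ρ : ℂ → ℝ) (Λ : Set ℂ) : Prop :=
  ∃ n : ℕ, ∃ Λs : Fin n → Set ℂ, Λ = ⋃ i, Λs i ∧ ∀ i, RhoSeparated ρ (Λs i)

/-- Upper uniform density of `Λ` with respect to the doubling measure `μ`. -/
def upperUnifDensity (μ : Measure ℂ) (ρ : ℂ → ℝ) (Λ : Set ℂ) : ℝ≥0∞ :=
  limsup (fun r : ℝ =>
    ⨆ z : ℂ, Measure.count (Λ ∩ closedBall z (r * ρ z)) / μ (ball z (r * ρ z))) atTop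

/-- Lower uniform density of `Λ` with respect to the doubling measure `μ`. -/
def lowerUnifDensity (μ : Measure ℂ) (ρ : ℂ → ℝ) (Λ : Set ℂ) : ℝ≥0∞ :=
  liminf (fun r : ℝ =>
    ⨅ z : ℂ, Measure.count (Λ ∩ closedBall z (r * ρ z)) / μ (ball z (r * ρ z))) atTop

/-- The Cauchy–Riemann operator `∂̄` on `ℂ`-valued functions. -/
def dbar (v : ℂ → ℂ) (z : ℂ) : ℂ :=
  (fderiv ℝ v z 1 + Complex.I • fderiv ℝ v z Complex.I) / 2

/-- `∂̄ u = f` in the sense of distributions. -/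
def IsDistribDbarOf (u f : ℂ → ℂ) : Prop :=
  ∀ v : ℂ → ℂ, ContDiff ℝ (⊤ : ℕ∞) v → HasCompactSupport v →
    ∫ z, f z * v z = - ∫ z, u z * dbar v z

/-- Closed axis-parallel rectangle with centre `a` and half-sides `s, t`. -/
def axisRect (a : ℂ) (s t : ℝ) : Set ℂ :=
  {w : ℂ | |w.re - a.re| ≤ s ∧ |w.im - a.im| ≤ t}



/-! ### Wirtinger calculus -/

abbrev Sm {F : Type*} [NormedAddCommGroup F] [NormedSpace ℝ F] (f : ℂ → F) : Prop :=
  ContDiff ℝ (⊤ : ℕ∞) f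

/-- The operator `∂`. -/
def dz (v : ℂ → ℂ) (z : ℂ) : ℂ :=
  (fderiv ℝ v z 1 - Complex.I • fderiv ℝ v z Complex.I) / 2

lemma Sm.pd {F : Type*} [NormedAddCommGroup F] [NormedSpace ℝ F] {f : ℂ → F} (hf : Sm f) (e : ℂ) :
    Sm (fun z => fderiv ℝ f z e) :=
  (hf.fderiv_right (m := (⊤ : ℕ∞)) (by simp)).clm_apply contDiff_const

lemma Sm.diff {F : Type*} [NormedAddCommGroup F] [NormedSpace ℝ F] {f : ℂ → F} (hf : Sm f) :
    Differentiable ℝ f := hf.differentiable (by simp)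

lemma Sm.dz {f : ℂ → ℂ} (hf : Sm f) : Sm (dz f) := by
  have h1 := hf.pd 1
  have h2 := hf.pd Complex.I
  unfold _root_.dz
  exact (h1.sub (h2.const_smul Complex.I)).div_const 2

lemma Sm.dbar {f : ℂ → ℂ} (hf : Sm f) : Sm (dbar f) := by
  have h1 := hf.pd 1
  have h2 := hf.pd Complex.I
  unfold _root_.dbar
  exact (h1.add (h2.const_smul Complex.I)).div_const 2

lemma Sm.conj {f : ℂ → ℂ} (hf : Sm f) : Sm (fun z => (starRingEnd ℂ) (f z)) :=
  Complex.conjCLE.contDiff.comp hf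

lemma Sm.ofReal {f : ℂ → ℝ} (hf : Sm f) : Sm (fun z => (f z : ℂ)) :=
  Complex.ofRealCLM.contDiff.comp hf

lemma dz_mul {f g : ℂ → ℂ} {z : ℂ} (hf : DifferentiableAt ℝ f z) (hg : DifferentiableAt ℝ g z) :
    dz (fun w => f w * g w) z = dz f z * g z + f z * dz g z := by
  unfold dz
  rw [fderiv_fun_mul hf hg]
  simp only [add_apply, smul_apply, smul_eq_mul]
  ring

lemma dbar_mul {f g : ℂ → ℂ} {z : ℂ} (hf : DifferentiableAt ℝ f z) (hg : DifferentiableAt ℝ g z) :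
    dbar (fun w => f w * g w) z = dbar f z * g z + f z * dbar g z := by
  unfold dbar
  rw [fderiv_fun_mul hf hg]
  simp only [add_apply, smul_apply, smul_eq_mul]
  ring

lemma dz_add {f g : ℂ → ℂ} {z : ℂ} (hf : DifferentiableAt ℝ f z) (hg : DifferentiableAt ℝ g z) :
    dz (fun w => f w + g w) z = dz f z + dz g z := by
  unfold dz
  rw [fderiv_fun_add hf hg]
  simp only [add_apply, smul_eq_mul]
  ring

lemma fderiv_conj_apply {f : ℂ → ℂ} {z : ℂ} (hf : DifferentiableAt ℝ f z) (e : ℂ) :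
    fderiv ℝ (fun w => (starRingEnd ℂ) (f w)) z e = (starRingEnd ℂ) (fderiv ℝ f z e) := by
  have := (Complex.conjCLE.toContinuousLinearMap.hasFDerivAt (x := f z)).comp z hf.hasFDerivAt
  have h2 : HasFDerivAt (fun w => (starRingEnd ℂ) (f w)) _ z := this
  rw [h2.fderiv]
  simp

lemma dz_conj {f : ℂ → ℂ} {z : ℂ} (hf : DifferentiableAt ℝ f z) :
    dz (fun w => (starRingEnd ℂ) (f w)) z = (starRingEnd ℂ) (dbar f z) := by
  unfold dz dbar
  simp only [fderiv_conj_apply hf, smul_eq_mul, map_div₀, map_add, map_mul, Complex.conj_I]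
  rw [show (starRingEnd ℂ) (2 : ℂ) = 2 from Complex.conj_ofNat 2]
  ring

lemma dbar_conj {f : ℂ → ℂ} {z : ℂ} (hf : DifferentiableAt ℝ f z) :
    dbar (fun w => (starRingEnd ℂ) (f w)) z = (starRingEnd ℂ) (dz f z) := by
  unfold dz dbar
  simp only [fderiv_conj_apply hf, smul_eq_mul, map_div₀, map_sub, map_mul, Complex.conj_I]
  rw [show (starRingEnd ℂ) (2 : ℂ) = 2 from Complex.conj_ofNat 2]
  ring

lemma dbar_ofReal {f : ℂ → ℝ} {z : ℂ} (hf : DifferentiableAt ℝ f z) :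
    dbar (fun w => (f w : ℂ)) z = (starRingEnd ℂ) (dz (fun w => (f w : ℂ)) z) := by
  have h : DifferentiableAt ℝ (fun w => (f w : ℂ)) z :=
    (Complex.ofRealCLM.hasFDerivAt.comp z hf.hasFDerivAt).differentiableAt
  rw [← dbar_conj h]
  simp

lemma fderiv_pd {F : Type*} [NormedAddCommGroup F] [NormedSpace ℝ F] {f : ℂ → F} (hf : Sm f)
    (z e e' : ℂ) :
    fderiv ℝ (fun w => fderiv ℝ f w e) z e' = fderiv ℝ (fderiv ℝ f) z e' e := by
  have h : DifferentiableAt ℝ (fderiv ℝ f) z :=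
    ((hf.fderiv_right (m := (⊤ : ℕ∞)) (by simp)).differentiable (by simp)) z
  rw [fderiv_clm_apply h (differentiableAt_const e)]
  simp

lemma pd_comm {F : Type*} [NormedAddCommGroup F] [NormedSpace ℝ F] {f : ℂ → F} (hf : Sm f)
    (z e e' : ℂ) :
    fderiv ℝ (fun w => fderiv ℝ f w e) z e' = fderiv ℝ (fun w => fderiv ℝ f w e') z e := by
  rw [fderiv_pd hf, fderiv_pd hf]
  have : IsSymmSndFDerivAt ℝ f z := hf.contDiffAt.isSymmSndFDerivAt (by
    simp only [minSmoothness_of_isRCLikeNormedField]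
    exact WithTop.coe_le_coe.2 (le_top : (2 : ℕ∞) ≤ ⊤))
  exact this e' e

lemma lap_eq_pd {v : ℂ → ℝ} (hv : Sm v) (z : ℂ) :
    lap v z = fderiv ℝ (fun w => fderiv ℝ v w 1) z 1
      + fderiv ℝ (fun w => fderiv ℝ v w Complex.I) z Complex.I := by
  unfold lap
  rw [iteratedFDeriv_two_apply, iteratedFDeriv_two_apply, fderiv_pd hv, fderiv_pd hv]
  simp

lemma fderiv_dz {f : ℂ → ℂ} (hf : Sm f) (z e : ℂ) :
    fderiv ℝ (dz f) z e = (fderiv ℝ (fun w => fderiv ℝ f w 1) z e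
      - Complex.I * fderiv ℝ (fun w => fderiv ℝ f w Complex.I) z e) / 2 := by
  have h1 := ((hf.pd 1).diff z).hasFDerivAt
  have h2 := ((hf.pd Complex.I).diff z).hasFDerivAt
  have h3 : HasFDerivAt (dz f) _ z := (h1.sub (h2.const_smul Complex.I)).mul_const (2 : ℂ)⁻¹
  rw [h3.fderiv]
  simp; ring

lemma fderiv_dbar {f : ℂ → ℂ} (hf : Sm f) (z e : ℂ) :
    fderiv ℝ (dbar f) z e = (fderiv ℝ (fun w => fderiv ℝ f w 1) z e
      + Complex.I * fderiv ℝ (fun w => fderiv ℝ f w Complex.I) z e) / 2 := by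
  have h1 := ((hf.pd 1).diff z).hasFDerivAt
  have h2 := ((hf.pd Complex.I).diff z).hasFDerivAt
  have h3 : HasFDerivAt (dbar f) _ z := (h1.add (h2.const_smul Complex.I)).mul_const (2 : ℂ)⁻¹
  rw [h3.fderiv]
  simp; ring

lemma dz_dbar_comm {f : ℂ → ℂ} (hf : Sm f) (z : ℂ) : dbar (dz f) z = dz (dbar f) z := by
  have h := pd_comm hf z 1 Complex.I
  unfold dz dbar
  have e1 := fderiv_dz hf z 1
  have e2 := fderiv_dz hf z Complex.I
  have e3 := fderiv_dbar hf z 1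
  have e4 := fderiv_dbar hf z Complex.I
  unfold dz at e1 e2
  unfold dbar at e3 e4
  rw [e1, e2, e3, e4, h]
  simp only [smul_eq_mul]; ring

lemma fderiv_ofReal_apply {f : ℂ → ℝ} {z : ℂ} (hf : DifferentiableAt ℝ f z) (e : ℂ) :
    fderiv ℝ (fun w => (f w : ℂ)) z e = (fderiv ℝ f z e : ℂ) := by
  have h2 : HasFDerivAt (fun w => (f w : ℂ)) _ z :=
    (Complex.ofRealCLM.hasFDerivAt (x := f z)).comp z hf.hasFDerivAt
  rw [h2.fderiv]
  simp

lemma dz_dbar_ofReal {v : ℂ → ℝ} (hv : Sm v) (z : ℂ) :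
    dz (dbar (fun w => (v w : ℂ))) z = ((lap v z / 4 : ℝ) : ℂ) := by
  have e : ∀ e' e'' : ℂ, fderiv ℝ (fun w => fderiv ℝ (fun w => (v w : ℂ)) w e') z e''
      = (fderiv ℝ (fun w => fderiv ℝ v w e') z e'' : ℂ) := by
    intro e' e''
    have : (fun w => fderiv ℝ (fun w => (v w : ℂ)) w e') = fun w => (fderiv ℝ v w e' : ℂ) := by
      funext w; exact fderiv_ofReal_apply (hv.diff w) e'
    rw [this, fderiv_ofReal_apply ((hv.pd e').diff z)]
  rw [lap_eq_pd hv]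
  unfold dz
  rw [fderiv_dbar hv.ofReal, fderiv_dbar hv.ofReal, e, e, e, e, pd_comm hv z 1 Complex.I]
  push_cast
  simp only [smul_eq_mul]
  ring_nf
  rw [Complex.I_sq]; ring

lemma integral_pd_zero {f : ℂ → ℂ} (hf : Sm f) (hc : HasCompactSupport f) (e : ℂ) :
    ∫ z, fderiv ℝ f z e = 0 := by
  have h := integral_mul_fderiv_eq_neg_fderiv_mul_of_integrable (μ := (volume : Measure ℂ))
    (f := fun _ : ℂ => (1 : ℂ)) (g := f) (v := e) (by simp)
    (by
      simp only [one_mul]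
      exact (hf.pd e).continuous.integrable_of_hasCompactSupport (hc.fderiv_apply ℝ e))
    (by
      simp only [one_mul]
      exact hf.continuous.integrable_of_hasCompactSupport hc)
    (by intros; fun_prop) (fun x _ => hf.diff x)
  simpa using h

lemma integrable_pd {f : ℂ → ℂ} (hf : Sm f) (hc : HasCompactSupport f) (e : ℂ) :
    Integrable (fun z => fderiv ℝ f z e) :=
  (hf.pd e).continuous.integrable_of_hasCompactSupport (hc.fderiv_apply ℝ e)

lemma integral_dz_zero {f : ℂ → ℂ} (hf : Sm f) (hc : HasCompactSupport f) :
    ∫ z, dz f z = 0 := by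
  unfold dz
  rw [integral_div, integral_sub (integrable_pd hf hc 1), integral_smul,
    integral_pd_zero hf hc, integral_pd_zero hf hc]
  · simp
  · exact (integrable_pd hf hc Complex.I).smul Complex.I

lemma integral_dbar_zero {f : ℂ → ℂ} (hf : Sm f) (hc : HasCompactSupport f) :
    ∫ z, dbar f z = 0 := by
  unfold dbar
  rw [integral_div, integral_add (integrable_pd hf hc 1), integral_smul,
    integral_pd_zero hf hc, integral_pd_zero hf hc]
  · simp
  · exact (integrable_pd hf hc Complex.I).smul Complex.I

lemma hasCompactSupport_dbar {f : ℂ → ℂ} (hc : HasCompactSupport f) :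
    HasCompactSupport (dbar f) := by
  have h : HasCompactSupport (fun z => fderiv ℝ f z) := hc.fderiv ℝ
  refine h.mono ?_
  intro z hz
  contrapose! hz
  simp only [Function.mem_support, not_not] at hz ⊢
  simp [dbar, hz]

lemma dz_exp {v : ℂ → ℝ} {z : ℂ} (hv : DifferentiableAt ℝ v z) :
    dz (fun w => (Real.exp (v w) : ℂ)) z = dz (fun w => (v w : ℂ)) z * (Real.exp (v z) : ℂ) := by
  unfold dz
  rw [fderiv_ofReal_apply hv.exp, fderiv_ofReal_apply hv.exp, fderiv_ofReal_apply hv,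
    fderiv_ofReal_apply hv, fderiv_exp hv]
  simp only [smul_apply, smul_eq_mul]
  push_cast; ring

/-! ### radial functions -/

lemma Sm_radial {h : ℝ → ℝ} (hh : ContDiff ℝ (⊤ : ℕ∞) h) : Sm (fun z : ℂ => h (‖z‖ ^ 2)) :=
  hh.comp (contDiff_norm_sq ℝ)

lemma fderiv_radial {h : ℝ → ℝ} {z : ℂ} (hh : DifferentiableAt ℝ h (‖z‖ ^ 2)) (e : ℂ) :
    fderiv ℝ (fun z : ℂ => h (‖z‖ ^ 2)) z e
      = deriv h (‖z‖ ^ 2) * (2 * (z.re * e.re + z.im * e.im)) := by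
  have h1 : HasFDerivAt (fun z : ℂ => ‖z‖ ^ 2) (2 • (innerSL ℝ z)) z :=
    (hasStrictFDerivAt_norm_sq z).hasFDerivAt
  have h2 := hh.hasDerivAt.comp_hasFDerivAt z h1
  have h3 : HasFDerivAt (fun z : ℂ => h (‖z‖ ^ 2)) _ z := h2
  rw [h3.fderiv]
  simp only [smul_apply, innerSL_apply_apply, Complex.inner, smul_eq_mul, nsmul_eq_mul]
  simp
  left; ring

lemma dz_radial {h : ℝ → ℝ} {z : ℂ} (hh : DifferentiableAt ℝ h (‖z‖ ^ 2)) :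
    dz (fun z : ℂ => (h (‖z‖ ^ 2) : ℂ)) z = ((deriv h (‖z‖ ^ 2) : ℝ) : ℂ) * (starRingEnd ℂ) z := by
  have hd : DifferentiableAt ℝ (fun z : ℂ => h (‖z‖ ^ 2)) z :=
    hh.comp z (contDiff_norm_sq ℝ (n := 1)).contDiffAt.differentiableAt_one
  unfold dz
  rw [fderiv_ofReal_apply hd, fderiv_ofReal_apply hd, fderiv_radial hh, fderiv_radial hh]
  apply Complex.ext <;> simp <;> ring

lemma dbar_radial {h : ℝ → ℝ} {z : ℂ} (hh : DifferentiableAt ℝ h (‖z‖ ^ 2)) :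
    dbar (fun z : ℂ => (h (‖z‖ ^ 2) : ℂ)) z = ((deriv h (‖z‖ ^ 2) : ℝ) : ℂ) * z := by
  have hd : DifferentiableAt ℝ (fun z : ℂ => h (‖z‖ ^ 2)) z :=
    hh.comp z (contDiff_norm_sq ℝ (n := 1)).contDiffAt.differentiableAt_one
  rw [dbar_ofReal hd, dz_radial hh]
  simp

lemma lap_radial {h : ℝ → ℝ} (hh : ContDiff ℝ (⊤ : ℕ∞) h) (z : ℂ) :
    lap (fun z : ℂ => h (‖z‖ ^ 2)) z
      = 4 * (deriv h (‖z‖ ^ 2) + ‖z‖ ^ 2 * deriv (deriv h) (‖z‖ ^ 2)) := by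
  have hd : Differentiable ℝ h := hh.differentiable (by simp)
  have hh' : ContDiff ℝ (⊤ : ℕ∞) (deriv h) := by
    have := (contDiff_infty_iff_deriv (𝕜 := ℝ) (f := h)).1 hh
    exact this.2
  have hd' : Differentiable ℝ (deriv h) := hh'.differentiable (by simp)
  rw [lap_eq_pd (Sm_radial hh)]
  have e : ∀ e : ℂ, (fun w : ℂ => fderiv ℝ (fun z : ℂ => h (‖z‖ ^ 2)) w e)
      = fun w : ℂ => deriv h (‖w‖ ^ 2) * (2 * (w.re * e.re + w.im * e.im)) := by
    intro e; funext w; exact fderiv_radial (hd _) e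
  rw [e, e]
  have hr : Differentiable ℝ (fun w : ℂ => deriv h (‖w‖ ^ 2)) :=
    (Sm_radial hh').diff
  have k : ∀ e : ℂ, HasFDerivAt (fun w : ℂ => 2 * (w.re * e.re + w.im * e.im))
      ((2 : ℝ) • (e.re • Complex.reCLM + e.im • Complex.imCLM)) z := by
    intro e
    have h1 := Complex.reCLM.hasFDerivAt (x := z)
    have h2 := Complex.imCLM.hasFDerivAt (x := z)
    have := ((h1.mul_const e.re).add (h2.mul_const e.im)).const_mul 2
    exact this
  rw [fderiv_fun_mul (hr z) (k 1).differentiableAt, (k 1).fderiv,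
    fderiv_fun_mul (hr z) (k Complex.I).differentiableAt, (k Complex.I).fderiv]
  simp only [add_apply, smul_apply, smul_eq_mul,
    fderiv_radial (hd' _)]
  have hn : ‖z‖ ^ 2 = z.re * z.re + z.im * z.im := by
    rw [← Complex.normSq_eq_norm_sq, Complex.normSq_apply]
  simp
  rw [hn]; ring


/-! ### The model function -/

def aa (x : ℝ) : ℝ := Real.smoothTransition (2 * x - 1)

lemma aa_smooth : ContDiff ℝ (⊤ : ℕ∞) aa :=
  Real.smoothTransition.contDiff.comp ((contDiff_const.mul contDiff_id).sub contDiff_const)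

lemma aa_zero {x : ℝ} (hx : x ≤ 1 / 2) : aa x = 0 :=
  Real.smoothTransition.zero_of_nonpos (by linarith)

lemma aa_one {x : ℝ} (hx : 1 ≤ x) : aa x = 1 :=
  Real.smoothTransition.one_of_one_le (by linarith)

lemma aa_nonneg (x : ℝ) : 0 ≤ aa x := Real.smoothTransition.nonneg _
lemma aa_le_one (x : ℝ) : aa x ≤ 1 := Real.smoothTransition.le_one _

lemma aa_mono : Monotone aa := fun x y h => Real.smoothTransition.monotone (by linarith)

def bb (x : ℝ) : ℝ := aa x / x

lemma bb_smooth : ContDiff ℝ (⊤ : ℕ∞) bb := by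
  rw [contDiff_iff_contDiffAt]
  intro x
  by_cases hx : x < 1 / 2
  · have : bb =ᶠ[𝓝 x] fun _ => 0 := by
      filter_upwards [Iio_mem_nhds hx] with y hy
      simp [bb, aa_zero (le_of_lt hy)]
    exact contDiffAt_const.congr_of_eventuallyEq this
  · exact aa_smooth.contDiffAt.div contDiffAt_id (by simp; linarith)

lemma bb_mul (x : ℝ) : bb x * x = aa x := by
  unfold bb
  by_cases hx : x = 0
  · subst hx; simp [aa_zero]
  · field_simp

lemma bb_nonneg (x : ℝ) : 0 ≤ bb x := by
  unfold bb
  by_cases hx : x ≤ 1 / 2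
  · simp [aa_zero hx]
  · exact div_nonneg (aa_nonneg x) (by linarith)

def ell (t : ℝ) : ℝ := ∫ s in (0:ℝ)..t, bb s

lemma ell_deriv (t : ℝ) : HasDerivAt ell (bb t) t := by
  unfold ell
  exact intervalIntegral.integral_hasDerivAt_right
    (bb_smooth.continuous.intervalIntegrable _ _)
    (bb_smooth.continuous.stronglyMeasurableAtFilter _ _) bb_smooth.continuous.continuousAt

lemma deriv_ell : deriv ell = bb := funext fun t => (ell_deriv t).deriv

lemma ell_smooth : ContDiff ℝ (⊤ : ℕ∞) ell := by
  rw [contDiff_infty_iff_deriv]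
  exact ⟨fun t => (ell_deriv t).differentiableAt, by rw [deriv_ell]; exact bb_smooth⟩

lemma ell_nonneg {t : ℝ} (ht : 0 ≤ t) : 0 ≤ ell t :=
  intervalIntegral.integral_nonneg ht fun s _ => bb_nonneg s

lemma ell_large {t : ℝ} (ht : 1 ≤ t) : ell t = ell 1 + Real.log t := by
  unfold ell
  rw [← intervalIntegral.integral_add_adjacent_intervals
    (bb_smooth.continuous.intervalIntegrable 0 1) (bb_smooth.continuous.intervalIntegrable 1 t)]
  congr 1
  rw [← div_one t, ← integral_one_div_of_pos one_pos (by linarith), div_one]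
  apply intervalIntegral.integral_congr
  intro s hs
  rw [uIcc_of_le ht] at hs
  simp [bb, aa_one hs.1]

/-- Smooth version of `log ‖z‖`. -/
def LL (z : ℂ) : ℝ := ell (‖z‖ ^ 2) / 2

def chi (z : ℂ) : ℝ := 2 * deriv aa (‖z‖ ^ 2)

lemma LL_smooth : Sm LL := (Sm_radial ell_smooth).div_const 2

lemma LL_zero : LL 0 = 0 := by simp [LL, ell]

lemma LL_nonneg (z : ℂ) : 0 ≤ LL z := div_nonneg (ell_nonneg (by positivity)) (by norm_num)

def cL : ℝ := ell 1 / 2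

lemma cL_nonneg : 0 ≤ cL := div_nonneg (ell_nonneg (by norm_num)) (by norm_num)

lemma LL_large {z : ℂ} (hz : 1 ≤ ‖z‖) : LL z = cL + Real.log ‖z‖ := by
  unfold LL cL
  rw [ell_large (by nlinarith), Real.log_pow]; push_cast; ring

lemma daa_smooth : ContDiff ℝ (⊤ : ℕ∞) (deriv aa) :=
  ((contDiff_infty_iff_deriv (𝕜 := ℝ) (f := aa)).1 aa_smooth).2

lemma chi_smooth : Sm chi := contDiff_const.mul (Sm_radial daa_smooth)

lemma lap_LL (z : ℂ) : lap LL z = chi z := by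
  have h : LL = fun z : ℂ => (fun t => ell t / 2) (‖z‖ ^ 2) := rfl
  rw [h, lap_radial (ell_smooth.div_const 2)]
  have d1 : deriv (fun t => ell t / 2) = fun t => bb t / 2 := by
    funext t; exact ((ell_deriv t).div_const 2).deriv
  have hb : ∀ t, HasDerivAt bb (deriv bb t) t := fun t =>
    (bb_smooth.differentiable (by simp) t).hasDerivAt
  have d2 : deriv (fun t => bb t / 2) = fun t => deriv bb t / 2 := by
    funext t; exact ((hb t).div_const 2).deriv
  rw [d1, d2]
  unfold chi
  have : deriv aa (‖z‖ ^ 2) = deriv bb (‖z‖ ^ 2) * ‖z‖ ^ 2 + bb (‖z‖ ^ 2) := by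
    have h1 := (hb (‖z‖ ^ 2)).mul (hasDerivAt_id (‖z‖ ^ 2))
    have h2 : bb * id = aa := by funext t; exact bb_mul t
    rw [h2] at h1
    simpa using h1.deriv
  rw [this]; ring

lemma daa_nonneg (t : ℝ) : 0 ≤ deriv aa t := aa_mono.deriv_nonneg

lemma chi_nonneg (z : ℂ) : 0 ≤ chi z := mul_nonneg (by norm_num) (daa_nonneg _)

lemma daa_zero {t : ℝ} (h : t ≤ 1 / 2 ∨ 1 ≤ t) : deriv aa t = 0 := by
  rcases h with h | h
  · have : IsLocalMin aa t := Eventually.of_forall fun y => by rw [aa_zero h]; exact aa_nonneg y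
    exact this.deriv_eq_zero
  · have : IsLocalMax aa t := Eventually.of_forall fun y => by rw [aa_one h]; exact aa_le_one y
    exact this.deriv_eq_zero

lemma chi_eq_zero {z : ℂ} (h : ‖z‖ ≤ 1 / 2 ∨ 1 ≤ ‖z‖) : chi z = 0 := by
  unfold chi
  rw [daa_zero, mul_zero]
  have := norm_nonneg z
  rcases h with h | h
  · left; nlinarith
  · right; nlinarith

lemma chi_cpt : HasCompactSupport chi :=
  HasCompactSupport.intro (isCompact_closedBall (0:ℂ) 1) fun z hz => chi_eq_zero (Or.inr (by
    simp at hz; exact hz.le))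

lemma chi_big : ∃ x0 δ : ℝ, 0 < x0 ∧ 0 < δ ∧ x0 + δ < 1 ∧
    ∀ z : ℂ, ‖z - x0‖ < δ → 1 ≤ chi z := by
  obtain ⟨t, ht, h⟩ := exists_deriv_eq_slope aa (show (1/2:ℝ) < 1 by norm_num)
    aa_smooth.continuous.continuousOn (aa_smooth.differentiable (by simp)).differentiableOn
  rw [aa_one le_rfl, aa_zero le_rfl] at h
  have ht0 : 0 < t := by linarith [ht.1]
  set x0 := Real.sqrt t
  have hx0 : 0 < x0 := Real.sqrt_pos.2 ht0
  have hx1 : x0 < 1 := by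
    rw [Real.sqrt_lt' one_pos]; linarith [ht.2]
  have hc : chi (x0 : ℂ) = 4 := by
    unfold chi
    rw [Complex.norm_real, Real.norm_of_nonneg hx0.le, Real.sq_sqrt ht0.le, h]; norm_num
  have : ∀ᶠ z in 𝓝 (x0 : ℂ), 1 < chi z :=
    chi_smooth.continuous.continuousAt.eventually (lt_mem_nhds (by rw [hc]; norm_num))
  obtain ⟨δ, hδ, H⟩ := Metric.eventually_nhds_iff.1 this
  refine ⟨x0, min δ ((1 - x0) / 2), hx0, lt_min hδ (by linarith), ?_, fun z hz => ?_⟩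
  · have := min_le_right δ ((1 - x0) / 2); linarith
  · exact (H (by rw [dist_eq_norm]; exact hz.trans_le (min_le_left _ _))).le

def c0 : ℝ := ∫ z, chi z

lemma chi_integrable : Integrable chi :=
  chi_smooth.continuous.integrable_of_hasCompactSupport chi_cpt

lemma c0_pos : 0 < c0 := by
  obtain ⟨x0, δ, h1, h2, h3, h4⟩ := chi_big
  unfold c0
  apply chi_smooth.continuous.integral_pos_of_hasCompactSupport_nonneg_nonzero chi_cpt chi_nonneg
    (x := (x0 : ℂ))
  have := h4 x0 (by simpa using h2)
  linarith

lemma chi_bdd : ∃ C, 0 < C ∧ ∀ z, chi z ≤ C := by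
  obtain ⟨C, hC⟩ := chi_smooth.continuous.bounded_above_of_compact_support chi_cpt
  refine ⟨max C 1, by positivity, fun z => ?_⟩
  have := hC z
  rw [Real.norm_eq_abs] at this
  exact (le_abs_self _).trans (this.trans (le_max_left _ _))

lemma lap_add {f g : ℂ → ℝ} (hf : Sm f) (hg : Sm g) (z : ℂ) :
    lap (fun w => f w + g w) z = lap f z + lap g z := by
  rw [lap_eq_pd (hf.add hg), lap_eq_pd hf, lap_eq_pd hg]
  have e : ∀ e : ℂ, (fun w => fderiv ℝ (fun w => f w + g w) w e)
      = fun w => fderiv ℝ f w e + fderiv ℝ g w e := by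
    intro e; funext w; rw [fderiv_fun_add (hf.diff w) (hg.diff w)]; rfl
  rw [e, e, fderiv_fun_add ((hf.pd 1).diff z) ((hg.pd 1).diff z),
    fderiv_fun_add ((hf.pd Complex.I).diff z) ((hg.pd Complex.I).diff z)]
  simp only [add_apply]; ring

lemma lap_const_mul {f : ℂ → ℝ} (hf : Sm f) (c : ℝ) (z : ℂ) :
    lap (fun w => c * f w) z = c * lap f z := by
  rw [lap_eq_pd (contDiff_const.mul hf), lap_eq_pd hf]
  have e : ∀ e : ℂ, (fun w => fderiv ℝ (fun w => c * f w) w e)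
      = fun w => c * fderiv ℝ f w e := by
    intro e; funext w; rw [fderiv_const_mul (hf.diff w)]; rfl
  rw [e, e, fderiv_const_mul ((hf.pd 1).diff z), fderiv_const_mul ((hf.pd Complex.I).diff z)]
  simp only [smul_apply, smul_eq_mul]; ring

lemma lap_const (c : ℝ) (z : ℂ) : lap (fun _ => c) z = 0 := by
  rw [lap_eq_pd contDiff_const]; simp

lemma fderiv_comp_affine {f : ℂ → ℝ} (hf : Sm f) (r : ℝ) (a z e : ℂ) :
    fderiv ℝ (fun w => f (r * w + a)) z e = r * fderiv ℝ f (r * z + a) e := by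
  have h1 : HasFDerivAt (fun w : ℂ => (r:ℂ) * w + a) (r • ContinuousLinearMap.id ℝ ℂ) z := by
    have := ((hasFDerivAt_id (𝕜 := ℝ) z).const_smul r).add_const a
    simpa using this
  have h2 : HasFDerivAt (fun w => f (r * w + a)) _ z :=
    (hf.diff (r * z + a)).hasFDerivAt.comp z h1
  rw [h2.fderiv]
  simp

lemma Sm.comp_affine {F : Type*} [NormedAddCommGroup F] [NormedSpace ℝ F] {f : ℂ → F} (hf : Sm f)
    (r a : ℂ) : Sm (fun w => f (r * w + a)) :=
  hf.comp ((contDiff_const.mul contDiff_id).add contDiff_const)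

lemma lap_comp_affine {f : ℂ → ℝ} (hf : Sm f) (r : ℝ) (a z : ℂ) :
    lap (fun w => f (r * w + a)) z = r ^ 2 * lap f (r * z + a) := by
  rw [lap_eq_pd (hf.comp_affine r a), lap_eq_pd hf]
  have e : ∀ e : ℂ, (fun w => fderiv ℝ (fun w => f (r * w + a)) w e)
      = fun w => r * (fun w => fderiv ℝ f w e) (r * w + a) := by
    intro e; funext w; exact fderiv_comp_affine hf r a w e
  rw [e, e]
  have k : ∀ e : ℂ, fderiv ℝ (fun w => r * (fun w => fderiv ℝ f w e) (r * w + a)) z e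
      = r ^ 2 * fderiv ℝ (fun w => fderiv ℝ f w e) (r * z + a) e := by
    intro e
    rw [fderiv_const_mul (((hf.pd e).comp_affine r a).diff z)]
    simp only [smul_apply, smul_eq_mul]
    rw [fderiv_comp_affine (hf.pd e)]; ring
  rw [k, k]; ring

lemma lap_comp_smul {f : ℂ → ℝ} (hf : Sm f) (r : ℝ) (z : ℂ) :
    lap (fun w => f (r * w)) z = r ^ 2 * lap f (r * z) := by
  simpa using lap_comp_affine hf r 0 z

/-- The rescaled kernel. -/
def chin (n : ℕ) (z : ℂ) : ℝ := 4 ^ n * chi ((2 ^ n : ℝ) * z)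

lemma chin_zero (z : ℂ) : chin 0 z = chi z := by simp [chin]

lemma chin_nonneg (n : ℕ) (z : ℂ) : 0 ≤ chin n z := mul_nonneg (by positivity) (chi_nonneg _)

lemma chin_smooth (n : ℕ) : Sm (chin n) := by
  have := chi_smooth.comp_affine ((2 ^ n : ℝ) : ℂ) 0
  simp only [add_zero] at this
  exact contDiff_const.mul this

lemma chin_eq_zero {n : ℕ} {z : ℂ} (h : 1 ≤ 2 ^ n * ‖z‖) : chin n z = 0 := by
  unfold chin
  rw [chi_eq_zero, mul_zero]
  right; simpa using h

lemma chin_cpt (n : ℕ) : HasCompactSupport (chin n) :=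
  HasCompactSupport.intro (isCompact_closedBall (0:ℂ) 1) fun z hz => chin_eq_zero (by
    simp at hz
    have : (1:ℝ) ≤ 2 ^ n := one_le_pow₀ (by norm_num)
    nlinarith)

lemma chin_integral (n : ℕ) : ∫ z, chin n z = c0 := by
  unfold chin c0
  rw [integral_const_mul]
  have := Measure.integral_comp_smul (volume : Measure ℂ) chi (2 ^ n : ℝ)
  simp only [Complex.real_smul] at this
  rw [this]
  simp only [Complex.finrank_real_complex, smul_eq_mul]
  rw [abs_of_pos (by positivity), ← mul_assoc, ← pow_mul, mul_comm n 2, pow_mul]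
  norm_num

/-- the potential of `χ - χ_n` -/
def vn (n : ℕ) (z : ℂ) : ℝ := LL z - LL ((2 ^ n : ℝ) * z) + n * Real.log 2

lemma vn_smooth (n : ℕ) : Sm (vn n) := by
  have := LL_smooth.comp_affine ((2 ^ n : ℝ) : ℂ) 0
  simp only [add_zero] at this
  exact (LL_smooth.sub this).add contDiff_const

lemma lap_vn (n : ℕ) (z : ℂ) : lap (vn n) z = chi z - chin n z := by
  have h1 := LL_smooth.comp_affine ((2 ^ n : ℝ) : ℂ) 0
  simp only [add_zero] at h1
  have : vn n = fun z => (LL z + (-1) * LL ((2 ^ n : ℝ) * z)) + n * Real.log 2 := by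
    funext z; unfold vn; ring
  rw [this, lap_add (LL_smooth.add (contDiff_const.mul h1)) contDiff_const,
    lap_add LL_smooth (contDiff_const.mul h1), lap_const_mul h1, lap_comp_smul LL_smooth, lap_const,
    lap_LL, lap_LL]
  unfold chin
  rw [← pow_mul, mul_comm n 2, pow_mul]; norm_num; ring

lemma vn_eq_zero {n : ℕ} {z : ℂ} (h : 1 ≤ ‖z‖) : vn n z = 0 := by
  have h2 : (1:ℝ) ≤ 2 ^ n := one_le_pow₀ (by norm_num)
  have e : ‖((2 ^ n : ℝ) : ℂ) * z‖ = 2 ^ n * ‖z‖ := by simp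
  unfold vn
  rw [LL_large h, LL_large (by rw [e]; nlinarith), e, Real.log_mul (by positivity) (by positivity),
    Real.log_pow]
  ring

lemma vn_cpt (n : ℕ) : HasCompactSupport (vn n) :=
  HasCompactSupport.intro (isCompact_closedBall (0:ℂ) 1) fun z hz => vn_eq_zero (by
    simp at hz; exact hz.le)

lemma vn_succ (n : ℕ) (z : ℂ) : vn (n + 1) z = vn n z + vn 1 ((2 ^ n : ℝ) * z) := by
  unfold vn
  push_cast
  rw [show (2:ℂ) ^ 1 * (2 ^ n * z) = 2 ^ (n+1) * z by ring]; ring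

lemma vn_nonneg_one : ∃ C, 0 < C ∧ ∀ z, |vn 1 z| ≤ C := by
  obtain ⟨C, hC⟩ := (vn_smooth 1).continuous.bounded_above_of_compact_support (vn_cpt 1)
  exact ⟨max C 1, by positivity, fun z => (hC z).trans (le_max_left _ _)⟩

/-- `|v_n| ≤ C ∑_{k<n} 1_{B(0,2^{-k})}`. -/
lemma vn_bound : ∃ C, 0 < C ∧ ∀ n z, |vn n z| ≤
    C * ∑ k ∈ Finset.range n, (ball (0:ℂ) ((1/2)^k)).indicator (fun _ => (1:ℝ)) z := by
  obtain ⟨C, hC, H⟩ := vn_nonneg_one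
  refine ⟨C, hC, fun n z => ?_⟩
  induction n with
  | zero => simp [vn]
  | succ n ih =>
    rw [vn_succ, Finset.sum_range_succ, mul_add]
    refine (abs_add_le _ _).trans (add_le_add ih ?_)
    by_cases hz : z ∈ ball (0:ℂ) ((1/2)^n)
    · rw [indicator_of_mem hz, mul_one]; exact H _
    · rw [vn_eq_zero]
      · rw [indicator_of_notMem hz]; simp
      · simp only [mem_ball, dist_zero_right, not_lt] at hz
        rw [norm_mul, Complex.norm_real, Real.norm_of_nonneg (by positivity)]
        calc (1:ℝ) = 2 ^ n * (1/2)^n := by rw [← mul_pow]; norm_num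
          _ ≤ _ := by gcongr


/-! ### Twisted Bochner inequality -/

lemma Sm.expR {η : ℂ → ℝ} (h : Sm η) : Sm (fun z => Real.exp (η z)) := h.exp

lemma bochner_pt {α : ℂ → ℂ} (ha : Sm α) {η τ : ℂ → ℝ} (hη : Sm η) (hτ : Sm τ) (z : ℂ) :
    dz (fun w => (starRingEnd ℂ) (α w) * ((τ w : ℂ) * (dbar α w * (Real.exp (η w) : ℂ)))
      + dbar (fun w => (τ w : ℂ)) w * (α w * ((starRingEnd ℂ) (α w) * (Real.exp (η w) : ℂ)))) z
    - dbar (fun w => (τ w : ℂ) * ((starRingEnd ℂ) (α w) *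
        ((dz α w + dz (fun w => (η w : ℂ)) w * α w) * (Real.exp (η w) : ℂ)))) z
    = (Real.exp (η z) : ℂ) * ((τ z : ℂ) * (dbar α z * (starRingEnd ℂ) (dbar α z))
      + ((starRingEnd ℂ) (α z) * dz (fun w => (τ w : ℂ)) z * dbar α z
        + (starRingEnd ℂ) ((starRingEnd ℂ) (α z) * dz (fun w => (τ w : ℂ)) z * dbar α z))
      + ((lap τ z / 4 : ℝ) : ℂ) * (α z * (starRingEnd ℂ) (α z))
      - (τ z : ℂ) * ((dz α z + dz (fun w => (η w : ℂ)) z * α z)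
          * (starRingEnd ℂ) (dz α z + dz (fun w => (η w : ℂ)) z * α z))
      - (τ z : ℂ) * ((lap η z / 4 : ℝ) : ℂ) * (α z * (starRingEnd ℂ) (α z))) := by
  have hA := ha.diff z
  have hAc := ha.conj.diff z
  have hT := hτ.ofReal.diff z
  have hE := hη.expR.ofReal.diff z
  have hDb := ha.dbar.diff z
  have hDT := hτ.ofReal.dbar.diff z
  have hdA := ha.dz.diff z
  have hdη := hη.ofReal.dz.diff z
  have hβ : DifferentiableAt ℝ (fun w => dz α w + dz (fun w => (η w : ℂ)) w * α w) z :=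
    hdA.add (hdη.mul hA)
  have eE : dz (fun w => (Real.exp (η w) : ℂ)) z
      = dz (fun w => (η w : ℂ)) z * (Real.exp (η z) : ℂ) := dz_exp (hη.diff z)
  have eE2 : dbar (fun w => (Real.exp (η w) : ℂ)) z
      = (starRingEnd ℂ) (dz (fun w => (η w : ℂ)) z) * (Real.exp (η z) : ℂ) := by
    rw [dbar_ofReal (hη.expR.diff z), eE, map_mul, Complex.conj_ofReal]
  rw [dz_add (hAc.fun_mul (hT.fun_mul (hDb.fun_mul hE))) (hDT.fun_mul (hA.fun_mul (hAc.fun_mul hE))),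
    dz_mul hAc (hT.fun_mul (hDb.fun_mul hE)), dz_mul hT (hDb.fun_mul hE), dz_mul hDb hE,
    dz_mul hDT (hA.fun_mul (hAc.fun_mul hE)), dz_mul hA (hAc.fun_mul hE), dz_mul hAc hE,
    dbar_mul hT (hAc.fun_mul (hβ.fun_mul hE)), dbar_mul hAc (hβ.fun_mul hE), dbar_mul hβ hE,
    dz_conj hA, dbar_conj hA, eE, eE2, dz_dbar_ofReal hτ]
  have e3 : dbar (fun w => dz α w + dz (fun w => (η w : ℂ)) w * α w) z
      = dz (dbar α) z + (((lap η z / 4 : ℝ) : ℂ) * α z + dz (fun w => (η w : ℂ)) z * dbar α z) := by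
    have : dbar (fun w => dz α w + dz (fun w => (η w : ℂ)) w * α w) z
        = dbar (dz α) z + dbar (fun w => dz (fun w => (η w : ℂ)) w * α w) z := by
      have hm : DifferentiableAt ℝ (fun w => dz (fun w => (η w : ℂ)) w * α w) z := hdη.mul hA
      unfold dbar
      rw [fderiv_fun_add hdA hm]
      simp only [add_apply, smul_eq_mul]; ring
    rw [this, dbar_mul hdη hA, dz_dbar_comm ha, dz_dbar_comm hη.ofReal, dz_dbar_ofReal hη]
  rw [e3]
  simp only [dbar_ofReal (hτ.diff z), map_add, map_mul, Complex.conj_conj]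
  ring

lemma bochner {α : ℂ → ℂ} (ha : Sm α) (hc : HasCompactSupport α) {η τ : ℂ → ℝ} (hη : Sm η)
    (hτ : Sm τ) (h0 : ∀ z, 0 ≤ τ z) :
    ∫ z, Real.exp (η z) * ((τ z * (lap η z / 4) - lap τ z / 4) * ‖α z‖ ^ 2)
      ≤ ∫ z, Real.exp (η z) * (τ z * ‖dbar α z‖ ^ 2
        + 2 * ‖dz (fun w => (τ w : ℂ)) z‖ * ‖α z‖ * ‖dbar α z‖) := by
  set X : ℂ → ℂ := fun w => (starRingEnd ℂ) (α w) * ((τ w : ℂ) * (dbar α w * (Real.exp (η w) : ℂ)))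
      + dbar (fun w => (τ w : ℂ)) w * (α w * ((starRingEnd ℂ) (α w) * (Real.exp (η w) : ℂ))) with hX
  set Y : ℂ → ℂ := fun w => (τ w : ℂ) * ((starRingEnd ℂ) (α w) *
        ((dz α w + dz (fun w => (η w : ℂ)) w * α w) * (Real.exp (η w) : ℂ))) with hY
  have sE := hη.expR.ofReal
  have sX : Sm X := (ha.conj.mul (hτ.ofReal.mul (ha.dbar.mul sE))).add
    (hτ.ofReal.dbar.mul (ha.mul (ha.conj.mul sE)))
  have sY : Sm Y := hτ.ofReal.mul (ha.conj.mul ((ha.dz.add (hη.ofReal.dz.mul ha)).mul sE))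
  have cX : HasCompactSupport X := hc.mono (by
    intro w hw; contrapose! hw
    simp only [Function.mem_support, not_not] at hw ⊢
    simp [hX, hw])
  have cY : HasCompactSupport Y := hc.mono (by
    intro w hw; contrapose! hw
    simp only [Function.mem_support, not_not] at hw ⊢
    simp [hY, hw])
  have cdz : HasCompactSupport (dz X) := by
    refine (cX.fderiv ℝ).mono ?_
    intro w hw; contrapose! hw
    simp only [Function.mem_support, not_not] at hw ⊢
    simp [dz, hw]
  have iX : Integrable (dz X) := sX.dz.continuous.integrable_of_hasCompactSupport cdz
  have iY : Integrable (dbar Y) :=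
    sY.dbar.continuous.integrable_of_hasCompactSupport (hasCompactSupport_dbar cY)
  have hz : ∫ z, (dz X z - dbar Y z) = 0 := by
    rw [integral_sub iX iY, integral_dz_zero sX cX, integral_dbar_zero sY cY, sub_zero]
  have hre : ∫ z, (dz X z - dbar Y z).re = 0 := by
    have := integral_re (iX.sub iY)
    simp only [RCLike.re_eq_complex_re] at this
    erw [this]
    simp only [Pi.sub_apply, hz]
    simp
  have nα : Continuous fun z => ‖α z‖ := ha.continuous.norm
  have nD : Continuous fun z => ‖dbar α z‖ := ha.dbar.continuous.norm
  have clap : ∀ {v : ℂ → ℝ}, Sm v → Continuous (lap v) := by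
    intro v hv
    have : lap v = fun z => fderiv ℝ (fun w => fderiv ℝ v w 1) z 1
      + fderiv ℝ (fun w => fderiv ℝ v w Complex.I) z Complex.I := funext (lap_eq_pd hv)
    rw [this]
    exact ((hv.pd 1).pd 1).continuous.add ((hv.pd Complex.I).pd Complex.I).continuous
  have i1 : Integrable fun z => Real.exp (η z) * ((τ z * (lap η z / 4) - lap τ z / 4) * ‖α z‖ ^ 2) := by
    apply Continuous.integrable_of_hasCompactSupport
    · have h1 := clap hη
      have h2 := clap hτ
      have h3 := hη.continuous
      have h4 := hτ.continuous
      fun_prop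
    · refine hc.mono ?_
      intro w hw; contrapose! hw
      simp only [Function.mem_support, not_not] at hw ⊢
      simp [hw]
  have i2 : Integrable fun z => Real.exp (η z) * (τ z * ‖dbar α z‖ ^ 2
        + 2 * ‖dz (fun w => (τ w : ℂ)) z‖ * ‖α z‖ * ‖dbar α z‖) := by
    apply Continuous.integrable_of_hasCompactSupport
    · have h1 := hτ.ofReal.dz.continuous
      have h3 := hη.continuous
      have h4 := hτ.continuous
      fun_prop
    · refine (hasCompactSupport_dbar hc).mono ?_
      intro w hw; contrapose! hw
      simp only [Function.mem_support, not_not] at hw ⊢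
      simp [hw]
  have key : ∀ z, (dz X z - dbar Y z).re ≤
      Real.exp (η z) * (τ z * ‖dbar α z‖ ^ 2
        + 2 * ‖dz (fun w => (τ w : ℂ)) z‖ * ‖α z‖ * ‖dbar α z‖)
      - Real.exp (η z) * ((τ z * (lap η z / 4) - lap τ z / 4) * ‖α z‖ ^ 2) := by
    intro z
    rw [hX, hY, bochner_pt ha hη hτ z]
    simp only [Complex.mul_conj, Complex.add_conj, Complex.normSq_eq_norm_sq]
    rw [← Complex.ofReal_mul, ← Complex.ofReal_mul, ← Complex.ofReal_mul, ← Complex.ofReal_mul,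
      ← Complex.ofReal_mul, ← Complex.ofReal_add, ← Complex.ofReal_add, ← Complex.ofReal_sub,
      ← Complex.ofReal_sub, ← Complex.ofReal_mul, Complex.ofReal_re, ← mul_sub]
    apply mul_le_mul_of_nonneg_left _ (Real.exp_pos _).le
    have h1 := Complex.re_le_norm ((starRingEnd ℂ) (α z) * dz (fun w => (τ w : ℂ)) z * dbar α z)
    rw [norm_mul, norm_mul, RCLike.norm_conj] at h1
    have h2 : 0 ≤ τ z * ‖dz α z + dz (fun w => (η w : ℂ)) z * α z‖ ^ 2 :=
      mul_nonneg (h0 z) (by positivity)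
    nlinarith
  have fin := integral_mono (iX.sub iY).re (i2.sub i1) key
  have e2 := integral_sub i2 i1
  simp only [Pi.sub_apply, RCLike.re_eq_complex_re] at fin
  rw [hre, e2] at fin
  linarith


/-! ### The Ohsawa-Takegoshi type estimate -/

lemma logc_smooth {c : ℝ} (hc : 0 < c) : Sm (fun z : ℂ => Real.log (c + ‖z‖ ^ 2)) :=
  (contDiff_const.add (contDiff_norm_sq ℝ)).log fun z => by positivity

lemma logc_hasDeriv {c : ℝ} (hc : 0 < c) (z : ℂ) :
    HasDerivAt (fun t => Real.log (c + t)) ((c + ‖z‖ ^ 2)⁻¹) (‖z‖ ^ 2) := by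
  have h1 : HasDerivAt (fun t : ℝ => c + t) 1 (‖z‖ ^ 2) := (hasDerivAt_id _).const_add c
  have := h1.log (by positivity)
  simpa using this

lemma dz_logc {c : ℝ} (hc : 0 < c) (z : ℂ) :
    dz (fun z : ℂ => (Real.log (c + ‖z‖ ^ 2) : ℂ)) z
      = (((c + ‖z‖ ^ 2)⁻¹ : ℝ) : ℂ) * (starRingEnd ℂ) z := by
  have h := logc_hasDeriv hc z
  rw [← h.deriv]
  exact dz_radial h.differentiableAt

lemma dz_id (z : ℂ) : dz (fun w => w) z = 1 := by
  unfold dz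
  have : fderiv ℝ (fun w : ℂ => w) z = ContinuousLinearMap.id ℝ ℂ := fderiv_id
  rw [this]; simp

lemma dbar_id (z : ℂ) : dbar (fun w => w) z = 0 := by
  unfold dbar
  have : fderiv ℝ (fun w : ℂ => w) z = ContinuousLinearMap.id ℝ ℂ := fderiv_id
  rw [this]; simp

lemma lap_logc {c : ℝ} (hc : 0 < c) (z : ℂ) :
    lap (fun z : ℂ => Real.log (c + ‖z‖ ^ 2)) z = 4 * (c / (c + ‖z‖ ^ 2) ^ 2) := by
  have h1 := dz_dbar_ofReal (logc_smooth hc) z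
  have h2 : dbar (fun z : ℂ => (Real.log (c + ‖z‖ ^ 2) : ℂ))
      = fun w => (((c + ‖w‖ ^ 2)⁻¹ : ℝ) : ℂ) * w := by
    funext w
    rw [dbar_ofReal ((logc_smooth hc).diff w), dz_logc hc]
    simp
  have hi : HasDerivAt (fun t => (c + t)⁻¹) (-((c + ‖z‖ ^ 2) ^ 2)⁻¹) (‖z‖ ^ 2) := by
    have h1 : HasDerivAt (fun t : ℝ => c + t) 1 (‖z‖ ^ 2) := (hasDerivAt_id _).const_add c
    have := h1.fun_inv (by positivity)
    rw [neg_div, one_div] at this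
    exact this
  have h3 : dz (fun w : ℂ => (((c + ‖w‖ ^ 2)⁻¹ : ℝ) : ℂ)) z
      = ((-((c + ‖z‖ ^ 2) ^ 2)⁻¹ : ℝ) : ℂ) * (starRingEnd ℂ) z := by
    rw [← hi.deriv]
    exact dz_radial (h := fun t => (c + t)⁻¹) hi.differentiableAt
  have hs : Sm (fun w : ℂ => (c + ‖w‖ ^ 2)⁻¹) :=
    (contDiff_const.add (contDiff_norm_sq ℝ)).inv fun z => by positivity
  have hid : DifferentiableAt ℝ (fun w : ℂ => w) z := differentiableAt_id
  rw [h2, dz_mul (hs.ofReal.diff z) hid, h3, dz_id] at h1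
  have hn : (starRingEnd ℂ) z * z = ((‖z‖ ^ 2 : ℝ) : ℂ) := by
    rw [mul_comm, Complex.mul_conj, Complex.normSq_eq_norm_sq]
  rw [mul_one, mul_assoc] at h1
  rw [hn, ← Complex.ofReal_mul, ← Complex.ofReal_add] at h1
  have h5 := Complex.ofReal_injective h1
  have hp : 0 < c + ‖z‖ ^ 2 := by positivity
  have h6 : lap (fun z : ℂ => Real.log (c + ‖z‖ ^ 2)) z
      = 4 * (-((c + ‖z‖ ^ 2) ^ 2)⁻¹ * ‖z‖ ^ 2 + (c + ‖z‖ ^ 2)⁻¹) := by linarith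
  rw [h6]; field_simp; ring

lemma OT_eps {α : ℂ → ℂ} (ha : Sm α) (hc : HasCompactSupport α) {η : ℂ → ℝ} (hη : Sm η)
    (hl : ∀ z, 2 / (1 + ‖z‖ ^ 2) ^ 2 ≤ lap η z / 4)
    (hi : Integrable fun z => Real.exp (η z) * ((1 + ‖z‖ ^ 2) / ‖z‖ ^ 2 * ‖dbar α z‖ ^ 2))
    {ε : ℝ} (h0 : 0 < ε) (h1 : ε < 1) :
    ∫ z, Real.exp (η z) * (ε ^ 2 / (ε ^ 2 + ‖z‖ ^ 2) ^ 2 * ‖α z‖ ^ 2)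
      ≤ 2 * ∫ z, Real.exp (η z) * ((1 + ‖z‖ ^ 2) / ‖z‖ ^ 2 * ‖dbar α z‖ ^ 2) := by
  set e := ε ^ 2 with he
  have e0 : 0 < e := by positivity
  have e1 : e < 1 := by nlinarith
  set τ : ℂ → ℝ := fun z => (1 + Real.log (1 + ‖z‖ ^ 2)) + (-1) * Real.log (e + ‖z‖ ^ 2) with hτ
  have s1 := logc_smooth one_pos
  have s2 := logc_smooth e0
  have sτ : Sm τ := (contDiff_const.add s1).add (contDiff_const.mul s2)
  have lτ : ∀ z, lap τ z / 4 = 1 / (1 + ‖z‖ ^ 2) ^ 2 - e / (e + ‖z‖ ^ 2) ^ 2 := by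
    intro z
    rw [hτ, lap_add (contDiff_const.add s1) (contDiff_const.mul s2), lap_add contDiff_const s1,
      lap_const_mul s2, lap_logc one_pos, lap_logc e0, lap_const]
    ring
  have dτ : ∀ z, ‖dz (fun w => (τ w : ℂ)) z‖ ≤ ‖z‖ / ((e + ‖z‖ ^ 2) * (1 + ‖z‖ ^ 2)) := by
    intro z
    have : dz (fun w => (τ w : ℂ)) z
        = (((1 + ‖z‖ ^ 2)⁻¹ - (e + ‖z‖ ^ 2)⁻¹ : ℝ) : ℂ) * (starRingEnd ℂ) z := by
      have a1 := dz_logc one_pos z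
      have a2 := dz_logc e0 z
      unfold dz at a1 a2 ⊢
      have hd1 := s1.diff z
      have hd2 := s2.diff z
      rw [fderiv_ofReal_apply hd1, fderiv_ofReal_apply hd1] at a1
      rw [fderiv_ofReal_apply hd2, fderiv_ofReal_apply hd2] at a2
      rw [fderiv_ofReal_apply (sτ.diff z), fderiv_ofReal_apply (sτ.diff z)]
      have : fderiv ℝ τ z = fderiv ℝ (fun z : ℂ => Real.log (1 + ‖z‖ ^ 2)) z
          + (-1 : ℝ) • fderiv ℝ (fun z : ℂ => Real.log (e + ‖z‖ ^ 2)) z := by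
        rw [hτ, fderiv_fun_add (hd1.const_add 1) (hd2.const_mul _), fderiv_const_add,
          fderiv_const_mul hd2]
      rw [this]
      simp only [add_apply, smul_apply, smul_eq_mul] at a1 a2 ⊢
      push_cast at a1 a2 ⊢
      linear_combination a1 - a2
    rw [this, norm_mul, RCLike.norm_conj, Complex.norm_real, Real.norm_eq_abs]
    have hp : 0 < e + ‖z‖ ^ 2 := by positivity
    have hq : 0 < 1 + ‖z‖ ^ 2 := by positivity
    have : (1 + ‖z‖ ^ 2)⁻¹ - (e + ‖z‖ ^ 2)⁻¹ = -((1 - e) / ((e + ‖z‖ ^ 2) * (1 + ‖z‖ ^ 2))) := by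
      field_simp; ring
    rw [this, abs_neg, abs_of_nonneg (div_nonneg (by linarith) (by positivity)), div_mul_eq_mul_div]
    gcongr
    nlinarith [norm_nonneg z]
  have τ1 : ∀ z, 1 ≤ τ z := by
    intro z
    have : Real.log (e + ‖z‖ ^ 2) ≤ Real.log (1 + ‖z‖ ^ 2) :=
      Real.log_le_log (by positivity) (by linarith)
    simp only [hτ]; linarith
  have τ2 : ∀ z, τ z ≤ (1 + ‖z‖ ^ 2) / (e + ‖z‖ ^ 2) := by
    intro z
    have hp : 0 < e + ‖z‖ ^ 2 := by positivity
    have hq : 0 < 1 + ‖z‖ ^ 2 := by positivity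
    have := Real.log_le_sub_one_of_pos (div_pos hq hp)
    rw [Real.log_div hq.ne' hp.ne'] at this
    simp only [hτ]; linarith
  have B := bochner ha hc hη sτ fun z => by linarith [τ1 z]
  have nα : Continuous fun z => ‖α z‖ := ha.continuous.norm
  have nD : Continuous fun z => ‖dbar α z‖ := ha.dbar.continuous.norm
  have cη := hη.continuous
  have cτ := sτ.continuous
  have csα : ∀ g : ℂ → ℝ, HasCompactSupport fun z => Real.exp (η z) * (g z * ‖α z‖ ^ 2) := by
    intro g
    refine hc.mono ?_
    intro w hw; contrapose! hw
    simp only [Function.mem_support, not_not] at hw ⊢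
    simp [hw]
  have clap : ∀ {v : ℂ → ℝ}, Sm v → Continuous (lap v) := by
    intro v hv
    have : lap v = fun z => fderiv ℝ (fun w => fderiv ℝ v w 1) z 1
      + fderiv ℝ (fun w => fderiv ℝ v w Complex.I) z Complex.I := funext (lap_eq_pd hv)
    rw [this]
    exact ((hv.pd 1).pd 1).continuous.add ((hv.pd Complex.I).pd Complex.I).continuous
  have iL : Integrable fun z => Real.exp (η z) * ((τ z * (lap η z / 4) - lap τ z / 4) * ‖α z‖ ^ 2) := by
    apply Continuous.integrable_of_hasCompactSupport _ (csα _)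
    have h1 := clap hη
    have h2 := clap sτ
    fun_prop
  have i2 : Integrable fun z => Real.exp (η z) * (ε ^ 2 / (ε ^ 2 + ‖z‖ ^ 2) ^ 2 * ‖α z‖ ^ 2) := by
    apply Continuous.integrable_of_hasCompactSupport _ (csα _)
    have : ∀ z : ℂ, (ε ^ 2 + ‖z‖ ^ 2) ^ 2 ≠ 0 := fun z => by positivity
    fun_prop (disch := assumption)
  have i3 : Integrable fun z => Real.exp (η z) * (1 / (1 + ‖z‖ ^ 2) ^ 2 * ‖α z‖ ^ 2) := by
    apply Continuous.integrable_of_hasCompactSupport _ (csα _)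
    have : ∀ z : ℂ, (1 + ‖z‖ ^ 2) ^ 2 ≠ 0 := fun z => by positivity
    fun_prop (disch := assumption)
  have iR : Integrable fun z => Real.exp (η z) * (τ z * ‖dbar α z‖ ^ 2
        + 2 * ‖dz (fun w => (τ w : ℂ)) z‖ * ‖α z‖ * ‖dbar α z‖) := by
    apply Continuous.integrable_of_hasCompactSupport
    · have h1 := sτ.ofReal.dz.continuous
      fun_prop
    · refine (hasCompactSupport_dbar hc).mono ?_
      intro w hw; contrapose! hw
      simp only [Function.mem_support, not_not] at hw ⊢
      simp [hw]
  have low : ∫ z, (Real.exp (η z) * (ε ^ 2 / (ε ^ 2 + ‖z‖ ^ 2) ^ 2 * ‖α z‖ ^ 2)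
      + Real.exp (η z) * (1 / (1 + ‖z‖ ^ 2) ^ 2 * ‖α z‖ ^ 2)) ≤
      ∫ z, Real.exp (η z) * ((τ z * (lap η z / 4) - lap τ z / 4) * ‖α z‖ ^ 2) := by
    apply integral_mono (i2.add i3) iL
    intro z
    simp only [Pi.add_apply]
    rw [← mul_add, ← add_mul]
    apply mul_le_mul_of_nonneg_left _ (Real.exp_pos _).le
    apply mul_le_mul_of_nonneg_right _ (by positivity)
    rw [lτ]
    have hk : 2 / (1 + ‖z‖ ^ 2) ^ 2 ≤ τ z * (lap η z / 4) := by
      have := hl z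
      have h3 : 0 ≤ 2 / (1 + ‖z‖ ^ 2) ^ 2 := by positivity
      nlinarith [τ1 z]
    have : 2 / (1 + ‖z‖ ^ 2) ^ 2 = 1 / (1 + ‖z‖ ^ 2) ^ 2 + 1 / (1 + ‖z‖ ^ 2) ^ 2 := by ring
    rw [← he]; linarith
  have up : ∫ z, Real.exp (η z) * (τ z * ‖dbar α z‖ ^ 2
        + 2 * ‖dz (fun w => (τ w : ℂ)) z‖ * ‖α z‖ * ‖dbar α z‖) ≤
      ∫ z, (Real.exp (η z) * (1 / (1 + ‖z‖ ^ 2) ^ 2 * ‖α z‖ ^ 2)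
        + 2 * (Real.exp (η z) * ((1 + ‖z‖ ^ 2) / ‖z‖ ^ 2 * ‖dbar α z‖ ^ 2))) := by
    apply integral_mono_ae iR (i3.add (hi.const_mul 2))
    have hne : ∀ᵐ z : ℂ, z ≠ 0 := by
      simp [ae_iff]
    filter_upwards [hne] with z hz
    simp only [Pi.add_apply]
    rw [mul_left_comm (2:ℝ) (Real.exp _), ← mul_add]
    apply mul_le_mul_of_nonneg_left _ (Real.exp_pos _).le
    have ht : 0 < ‖z‖ := norm_pos_iff.2 hz
    have hq : 0 < 1 + ‖z‖ ^ 2 := by positivity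
    have hp : 0 < e + ‖z‖ ^ 2 := by positivity
    have b1 : τ z ≤ (1 + ‖z‖ ^ 2) / ‖z‖ ^ 2 := (τ2 z).trans (by gcongr; linarith)
    have b2 : ‖dz (fun w => (τ w : ℂ)) z‖ * (1 + ‖z‖ ^ 2) ≤ 1 / ‖z‖ := by
      calc _ ≤ ‖z‖ / ((e + ‖z‖ ^ 2) * (1 + ‖z‖ ^ 2)) * (1 + ‖z‖ ^ 2) := by gcongr; exact dτ z
        _ = ‖z‖ / (e + ‖z‖ ^ 2) := by field_simp
        _ ≤ ‖z‖ / (‖z‖ ^ 2) := by gcongr; linarith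
        _ = 1 / ‖z‖ := by field_simp
    set D := ‖dz (fun w => (τ w : ℂ)) z‖
    have b3 : (D * (1 + ‖z‖ ^ 2)) ^ 2 ≤ (1 + ‖z‖ ^ 2) / ‖z‖ ^ 2 := by
      calc (D * (1 + ‖z‖ ^ 2)) ^ 2 ≤ (1 / ‖z‖) ^ 2 := by gcongr
        _ = 1 / ‖z‖ ^ 2 := by rw [div_pow, one_pow]
        _ ≤ _ := by gcongr; nlinarith
    have b4 : 2 * D * ‖α z‖ * ‖dbar α z‖ ≤ 1 / (1 + ‖z‖ ^ 2) ^ 2 * ‖α z‖ ^ 2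
        + (D * (1 + ‖z‖ ^ 2)) ^ 2 * ‖dbar α z‖ ^ 2 := by
      have := two_mul_le_add_sq (1 / (1 + ‖z‖ ^ 2) * ‖α z‖) (D * (1 + ‖z‖ ^ 2) * ‖dbar α z‖)
      calc 2 * D * ‖α z‖ * ‖dbar α z‖ = 2 * (1 / (1 + ‖z‖ ^ 2) * ‖α z‖) * (D * (1 + ‖z‖ ^ 2) * ‖dbar α z‖) := by
            field_simp
        _ ≤ _ := this
        _ = _ := by rw [mul_pow, mul_pow (D * (1 + ‖z‖ ^ 2)), div_pow, one_pow]
    have b5 : (D * (1 + ‖z‖ ^ 2)) ^ 2 * ‖dbar α z‖ ^ 2 ≤ (1 + ‖z‖ ^ 2) / ‖z‖ ^ 2 * ‖dbar α z‖ ^ 2 := by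
      gcongr
    have b6 : τ z * ‖dbar α z‖ ^ 2 ≤ (1 + ‖z‖ ^ 2) / ‖z‖ ^ 2 * ‖dbar α z‖ ^ 2 := by gcongr
    linarith
  rw [integral_add i2 i3] at low
  rw [integral_add i3 (hi.const_mul 2), integral_const_mul] at up
  linarith

lemma OT {α : ℂ → ℂ} (ha : Sm α) (hc : HasCompactSupport α) {η : ℂ → ℝ} (hη : Sm η)
    (hl : ∀ z, 2 / (1 + ‖z‖ ^ 2) ^ 2 ≤ lap η z / 4)
    (hi : Integrable fun z => Real.exp (η z) * ((1 + ‖z‖ ^ 2) / ‖z‖ ^ 2 * ‖dbar α z‖ ^ 2)) :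
    π / 4 * (Real.exp (η 0) * ‖α 0‖ ^ 2)
      ≤ 2 * ∫ z, Real.exp (η z) * ((1 + ‖z‖ ^ 2) / ‖z‖ ^ 2 * ‖dbar α z‖ ^ 2) := by
  set I := ∫ z, Real.exp (η z) * ((1 + ‖z‖ ^ 2) / ‖z‖ ^ 2 * ‖dbar α z‖ ^ 2)
  set g : ℂ → ℝ := fun z => Real.exp (η z) * ‖α z‖ ^ 2 with hg
  have cη := hη.continuous
  have cα := ha.continuous
  have cg : Continuous g := by fun_prop
  have main : ∀ c, c < g 0 → π / 4 * c ≤ 2 * I := by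
    intro c hc'
    have : ∀ᶠ z in 𝓝 (0:ℂ), c < g z := cg.continuousAt.eventually (lt_mem_nhds hc')
    obtain ⟨r, hr, H⟩ := Metric.eventually_nhds_iff.1 this
    set ε := min r (1/2) with hε
    have h0 : 0 < ε := lt_min hr (by norm_num)
    have h1 : ε < 1 := (min_le_right _ _).trans_lt (by norm_num)
    have key := OT_eps ha hc hη hl hi h0 h1
    refine le_trans ?_ key
    have i2 : Integrable fun z => Real.exp (η z) * (ε ^ 2 / (ε ^ 2 + ‖z‖ ^ 2) ^ 2 * ‖α z‖ ^ 2) := by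
      apply Continuous.integrable_of_hasCompactSupport
      · have : ∀ z : ℂ, (ε ^ 2 + ‖z‖ ^ 2) ^ 2 ≠ 0 := fun z => by positivity
        fun_prop (disch := assumption)
      · refine hc.mono ?_
        intro w hw; contrapose! hw
        simp only [Function.mem_support, not_not] at hw ⊢
        simp [hw]
    by_cases hc0 : c ≤ 0
    · refine le_trans (mul_nonpos_of_nonneg_of_nonpos (by positivity) hc0) ?_
      apply integral_nonneg
      intro z; simp only [Pi.zero_apply]; positivity
    push Not at hc0
    calc π / 4 * c = ∫ z in ball (0:ℂ) ε, c / (4 * ε ^ 2) := by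
          rw [setIntegral_const, Measure.real, Complex.volume_ball]
          simp only [ENNReal.toReal_mul, ENNReal.toReal_pow, ENNReal.toReal_ofReal h0.le,
            smul_eq_mul, ENNReal.coe_toReal, NNReal.coe_real_pi]
          field_simp
      _ ≤ ∫ z in ball (0:ℂ) ε, Real.exp (η z) * (ε ^ 2 / (ε ^ 2 + ‖z‖ ^ 2) ^ 2 * ‖α z‖ ^ 2) := by
          apply setIntegral_mono_on _ i2.integrableOn measurableSet_ball
          · intro z hz
            have hz' : ‖z‖ < ε := by simpa using hz
            have h3 : c ≤ g z := (H (by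
              rw [dist_zero_right]; exact hz'.trans_le (min_le_left _ _))).le
            have h4 : 1 / (4 * ε ^ 2) ≤ ε ^ 2 / (ε ^ 2 + ‖z‖ ^ 2) ^ 2 := by
              rw [div_le_div_iff₀ (by positivity) (by positivity)]
              have : ‖z‖ ^ 2 ≤ ε ^ 2 := by gcongr
              have : (ε ^ 2 + ‖z‖ ^ 2) ^ 2 ≤ (ε ^ 2 + ε ^ 2) ^ 2 := by gcongr
              nlinarith
            calc c / (4 * ε ^ 2) = c * (1 / (4 * ε ^ 2)) := by ring
              _ ≤ g z * (ε ^ 2 / (ε ^ 2 + ‖z‖ ^ 2) ^ 2) :=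
                mul_le_mul h3 h4 (by positivity) (by positivity)
              _ = _ := by simp only [hg]; ring
          · exact integrableOn_const (by finiteness) (by finiteness)
      _ ≤ _ := setIntegral_le_integral i2 (Eventually.of_forall fun z => by
          simp only [Pi.zero_apply]; positivity)
  have hlim : Tendsto (fun c => π / 4 * c) (𝓝[<] (g 0)) (𝓝 (π / 4 * g 0)) :=
    (tendsto_const_nhds.mul tendsto_id).mono_left nhdsWithin_le_nhds
  exact le_of_tendsto hlim (eventually_mem_nhdsWithin.mono fun c hc => main c hc)


/-! ### Doubling bundle -/

structure DL (φ : ℂ → ℝ) (μ : Measure ℂ) (C : ℝ) : Prop where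
  cont : Continuous φ
  lap_eq : ∀ v : ℂ → ℝ, Sm v → HasCompactSupport v → ∫ z, φ z * lap v z = ∫ z, v z ∂μ
  dbl : ∀ z : ℂ, ∀ r : ℝ, 0 < r → μ.real (ball z (2 * r)) ≤ C * μ.real (ball z r)
  fin : ∀ z : ℂ, ∀ r : ℝ, μ (ball z r) < ∞
  one_le : 1 ≤ C

lemma DL_of {φ : ℂ → ℝ} {μ : Measure ℂ} (h : HasDoublingLaplacian φ μ) {ρ : ℂ → ℝ}
    (hρ : IsRadius μ ρ) : ∃ C : ℝ, DL φ μ C := by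
  obtain ⟨C, hC, hd⟩ := h.doubling
  have hfin : ∀ z : ℂ, ∀ r : ℝ, μ (ball z r) < ∞ := by
    intro z r
    have hk : ∀ k : ℕ, μ (ball z (2 ^ k * ρ z)) < ∞ := by
      intro k
      induction k with
      | zero => simp [(hρ z).2]
      | succ k ih =>
        rw [pow_succ', mul_assoc]
        exact (hd z _ (by have := (hρ z).1; positivity)).trans_lt
          (ENNReal.mul_lt_top (by simp) ih)
    obtain ⟨k, hk'⟩ := pow_unbounded_of_one_lt (r / ρ z) (one_lt_two (α := ℝ))
    refine (measure_mono (ball_subset_ball ?_)).trans_lt (hk k)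
    rw [div_lt_iff₀ (hρ z).1] at hk'
    exact hk'.le
  refine ⟨max C 1, h.continuous, h.lap_eq, fun z r hr => ?_, hfin, le_max_right _ _⟩
  have := hd z r hr
  have h2 : μ.real (ball z (2 * r)) ≤ C * μ.real (ball z r) := by
    unfold Measure.real
    have := ENNReal.toReal_mono (ENNReal.mul_lt_top (by simp) (hfin z r)).ne this
    simpa using this
  exact h2.trans (mul_le_mul_of_nonneg_right (le_max_left _ _) measureReal_nonneg)

lemma DL.real_mono {φ : ℂ → ℝ} {μ : Measure ℂ} {C : ℝ} (h : DL φ μ C) {z w : ℂ} {r s : ℝ}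
    (hs : ball z r ⊆ ball w s) : μ.real (ball z r) ≤ μ.real (ball w s) :=
  measureReal_mono hs (h.fin w s).ne

lemma DL.loc {φ : ℂ → ℝ} {μ : Measure ℂ} {C : ℝ} (h : DL φ μ C) : IsLocallyFiniteMeasure μ :=
  ⟨fun z => ⟨ball z 1, ball_mem_nhds z one_pos, h.fin z 1⟩⟩

lemma DL.dbl_pow {φ : ℂ → ℝ} {μ : Measure ℂ} {C : ℝ} (h : DL φ μ C) (z : ℂ) {r : ℝ} (hr : 0 < r)
    (k : ℕ) : μ.real (ball z (2 ^ k * r)) ≤ C ^ k * μ.real (ball z r) := by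
  induction k with
  | zero => simp
  | succ k ih =>
    rw [pow_succ', mul_assoc, pow_succ', mul_assoc]
    exact (h.dbl z _ (by positivity)).trans
      (mul_le_mul_of_nonneg_left ih (by linarith [h.one_le]))

lemma DL.rev {φ : ℂ → ℝ} {μ : Measure ℂ} {C : ℝ} (h : DL φ μ C) (z : ℂ) {r : ℝ} (hr : 0 < r) :
    C ^ 3 * μ.real (ball z r) ≤ (C ^ 3 - 1) * μ.real (ball z (4 * r)) := by
  have hsub1 : ball z r ∪ ball (z + (2 * r : ℝ)) r ⊆ ball z (4 * r) := by
    intro w hw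
    rcases hw with hw | hw
    · exact ball_subset_ball (by linarith) hw
    · rw [mem_ball, dist_eq_norm] at hw ⊢
      calc ‖w - z‖ = ‖(w - (z + (2 * r : ℝ))) + (2 * r : ℝ)‖ := by congr 1; ring
        _ ≤ ‖w - (z + (2 * r : ℝ))‖ + ‖((2 * r : ℝ) : ℂ)‖ := norm_add_le _ _
        _ < 4 * r := by
          rw [Complex.norm_real, Real.norm_of_nonneg (by linarith)]; linarith
  have hdis : Disjoint (ball z r) (ball (z + (2 * r : ℝ)) r) := by
    apply ball_disjoint_ball
    rw [dist_eq_norm]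
    have : z - (z + (2 * r : ℝ)) = ((-(2 * r) : ℝ) : ℂ) := by push_cast; ring
    rw [this, Complex.norm_real, Real.norm_eq_abs, abs_neg, abs_of_pos (by linarith)]; linarith
  have h1 : μ.real (ball z r) + μ.real (ball (z + (2 * r : ℝ)) r) ≤ μ.real (ball z (4 * r)) := by
    rw [← measureReal_union hdis measurableSet_ball (h.fin _ _).ne (h.fin _ _).ne]
    exact measureReal_mono hsub1 (h.fin _ _).ne
  have h2 : μ.real (ball z (4 * r)) ≤ C ^ 3 * μ.real (ball (z + (2 * r : ℝ)) r) := by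
    refine le_trans (h.real_mono ?_) (h.dbl_pow _ hr 3)
    intro w hw
    rw [mem_ball, dist_eq_norm] at hw ⊢
    calc ‖w - (z + (2 * r : ℝ))‖ = ‖(w - z) - (2 * r : ℝ)‖ := by congr 1; ring
      _ ≤ ‖w - z‖ + ‖((2 * r : ℝ) : ℂ)‖ := norm_sub_le _ _
      _ < 2 ^ 3 * r := by
          rw [Complex.norm_real, Real.norm_of_nonneg (by linarith)]; linarith
  have h3 : 0 < C ^ 3 := by have := h.one_le; positivity
  nlinarith

lemma DL.sum_le {φ : ℂ → ℝ} {μ : Measure ℂ} {C : ℝ} (h : DL φ μ C) (z : ℂ) (n : ℕ) :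
    ∀ {s : ℝ}, 0 < s → ∑ k ∈ Finset.range n, μ.real (ball z ((1/2)^k * s))
      ≤ 2 * C ^ 3 * μ.real (ball z s) := by
  have hC : 1 ≤ C ^ 3 := one_le_pow₀ h.one_le
  induction n using Nat.strong_induction_on with
  | _ n ih =>
    intro s hs
    have hm : 0 ≤ μ.real (ball z s) := measureReal_nonneg
    match n, ih with
    | 0, _ => simp only [Finset.range_zero, Finset.sum_empty]; positivity
    | 1, _ => simp only [Finset.range_one, Finset.sum_singleton, pow_zero, one_mul]; nlinarith
    | n + 2, ih =>
      rw [Finset.sum_range_succ', Finset.sum_range_succ']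
      have e := ih n (by omega) (s := s / 4) (by linarith)
      have e2 : ∀ k : ℕ, ((1:ℝ)/2)^(k+1+1) * s = (1/2)^k * (s/4) := by intro k; ring
      simp only [e2]
      have r := h.rev z (r := s / 4) (by linarith)
      rw [show 4 * (s / 4) = s by ring] at r
      have m1 : μ.real (ball z ((1/2)^(0+1) * s)) ≤ μ.real (ball z s) :=
        h.real_mono (ball_subset_ball (by norm_num; linarith))
      have m2 : μ.real (ball z ((1/2)^0 * s)) ≤ μ.real (ball z s) :=
        h.real_mono (ball_subset_ball (by norm_num))
      nlinarith

lemma ball_preimage_affine {R : ℝ} (hR : 0 < R) (a w : ℂ) (r : ℝ) :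
    (fun z : ℂ => (z - a) / R) ⁻¹' (ball w r) = ball (R * w + a) (R * r) := by
  ext z
  simp only [mem_preimage, mem_ball, dist_eq_norm]
  have hRc : (R : ℂ) ≠ 0 := by exact_mod_cast hR.ne'
  have : (z - a) / R - w = (z - (R * w + a)) / R := by field_simp; ring
  rw [this, norm_div, Complex.norm_real, Real.norm_of_nonneg hR.le, div_lt_iff₀ hR, mul_comm r R]

/-- change of variables -/
lemma integral_affine {E : Type*} [NormedAddCommGroup E] [NormedSpace ℝ E]
    (g : ℂ → E) {R : ℝ} (hR : 0 < R) (a : ℂ) :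
    ∫ w, g (R * w + a) = (R ^ 2)⁻¹ • ∫ z, g z := by
  have h1 := Measure.integral_comp_smul (volume : Measure ℂ) (fun z => g (z + a)) R
  simp only [Complex.real_smul] at h1
  rw [h1, integral_add_right_eq_self (μ := (volume : Measure ℂ)) g a]
  congr 1
  rw [Complex.finrank_real_complex, abs_of_pos (by positivity)]

lemma integrable_affine {E : Type*} [NormedAddCommGroup E] [NormedSpace ℝ E]
    {g : ℂ → E} {R : ℝ} (hR : 0 < R) (a : ℂ) (hg : Integrable g) :
    Integrable (fun w => g (R * w + a)) := by
  have h1 := (hg.comp_add_right a).comp_smul hR.ne'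
  simpa only [Complex.real_smul] using h1

lemma DL.affine {φ : ℂ → ℝ} {μ : Measure ℂ} {C : ℝ} (h : DL φ μ C) {R : ℝ} (hR : 0 < R) (a : ℂ) :
    DL (fun w => φ (R * w + a)) (μ.map (fun z => (z - a) / R)) C := by
  have hRc : (R : ℂ) ≠ 0 := by exact_mod_cast hR.ne'
  have hmeas : Measurable (fun z : ℂ => (z - a) / R) := by fun_prop
  have hb : ∀ w r, (μ.map (fun z => (z - a) / R)) (ball w r) = μ (ball (R * w + a) (R * r)) := by
    intro w r
    rw [Measure.map_apply hmeas measurableSet_ball, ball_preimage_affine hR]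
  refine ⟨h.cont.comp (by fun_prop), ?_, ?_, ?_, h.one_le⟩
  · intro v hv hc
    rw [integral_map hmeas.aemeasurable hv.continuous.aestronglyMeasurable]
    set v' : ℂ → ℝ := fun z => v (((R⁻¹ : ℝ) : ℂ) * z + (-a / R)) with hv'
    have ev : ∀ z, v ((z - a) / R) = v' z := by
      intro z; simp only [hv']; congr 1; push_cast; field_simp; ring
    have hv's : Sm v' := hv.comp_affine _ _
    have hc' : HasCompactSupport v' := by
      have hcl : Topology.IsClosedEmbedding (fun z : ℂ => ((R⁻¹ : ℝ) : ℂ) * z + (-a / R)) := by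
        have : (((R⁻¹ : ℝ) : ℂ)) ≠ 0 := by simp [hR.ne']
        exact ((Homeomorph.mulLeft₀ _ this).trans (Homeomorph.addRight (-a / R))).isClosedEmbedding
      exact hc.comp_isClosedEmbedding hcl
    simp only [ev]
    rw [← h.lap_eq v' hv's hc']
    have e1 := integral_affine (fun z => φ z * lap v' z) hR a
    have e2 : ∀ w : ℂ, lap v' (R * w + a) = (R^2)⁻¹ * lap v w := by
      intro w
      rw [hv', lap_comp_affine hv]
      congr 2
      · rw [inv_pow]
      · push_cast; field_simp; ring
    simp only [e2] at e1
    have e3 : ∀ w : ℂ, φ (R * w + a) * ((R^2)⁻¹ * lap v w) = (R^2)⁻¹ * (φ (R * w + a) * lap v w) := by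
      intro w; ring
    simp only [e3] at e1
    rw [integral_const_mul, smul_eq_mul] at e1
    exact mul_left_cancel₀ (by positivity) e1
  · intro z r hr
    unfold Measure.real
    rw [hb, hb, show R * (2 * r) = 2 * (R * r) by ring]
    exact h.dbl _ _ (by positivity)
  · intro z r; rw [hb]; exact h.fin _ _

lemma map_affine_ball (μ : Measure ℂ) {R : ℝ} (hR : 0 < R) (a : ℂ) (w : ℂ) (r : ℝ) :
    (μ.map (fun z => (z - a) / R)).real (ball w r) = μ.real (ball (R * w + a) (R * r)) := by
  unfold Measure.real
  rw [Measure.map_apply (by fun_prop) measurableSet_ball, ball_preimage_affine hR]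

/-! ### Approximate identity -/

lemma chin_neg (n : ℕ) (z : ℂ) : chin n (-z) = chin n z := by
  unfold chin chi; simp

lemma chin_int_sub {n : ℕ} (z : ℂ) : ∫ w, chin n (z - w) = c0 := by
  rw [← chin_integral n]
  exact integral_sub_left_eq_self (chin n) volume z

lemma chin_cpt_sub (n : ℕ) (z : ℂ) : HasCompactSupport (fun w => chin n (z - w)) :=
  (chin_cpt n).comp_isClosedEmbedding (Homeomorph.subLeft z).isClosedEmbedding

lemma approx_id {E : Type*} [NormedAddCommGroup E] [NormedSpace ℝ E] [CompleteSpace E] {g : ℂ → E}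
    (hg : Continuous g) (n : ℕ) (z : ℂ) {ε : ℝ} (hε : ∀ w, ‖w - z‖ ≤ (1/2)^n → ‖g w - g z‖ ≤ ε) :
    ‖(∫ w, chin n (z - w) • g w) - c0 • g z‖ ≤ c0 * ε := by
  have hcs := (chin_smooth n).continuous
  have hc : Continuous (fun w => chin n (z - w)) := by fun_prop
  have i1 : Integrable (fun w => chin n (z - w)) :=
    hc.integrable_of_hasCompactSupport (chin_cpt_sub n z)
  have i2 : Integrable (fun w => chin n (z - w) • g w) :=
    (hc.smul hg).integrable_of_hasCompactSupport (chin_cpt_sub n z).smul_right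
  have i3 : Integrable (fun w => chin n (z - w) • g z) := i1.smul_const _
  rw [← chin_int_sub (n := n) z, ← integral_smul_const, ← integral_sub i2 i3,
    ← integral_mul_const]
  refine (norm_integral_le_integral_norm _).trans (integral_mono (i2.sub i3).norm
    (i1.mul_const ε) fun w => ?_)
  simp only [← smul_sub, norm_smul, Real.norm_of_nonneg (chin_nonneg _ _)]
  by_cases hw : ‖w - z‖ ≤ (1/2)^n
  · exact mul_le_mul_of_nonneg_left (hε w hw) (chin_nonneg _ _)
  · rw [chin_eq_zero]; · simp
    push Not at hw
    rw [norm_sub_rev] at hw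
    have : (2:ℝ)^n * (1/2)^n = 1 := by rw [← mul_pow]; norm_num
    rw [← this]
    exact mul_le_mul_of_nonneg_left hw.le (by positivity)

lemma approx_tendsto {E : Type*} [NormedAddCommGroup E] [NormedSpace ℝ E] [CompleteSpace E]
    {g : ℂ → E} (hg : Continuous g) (z : ℂ) :
    Tendsto (fun n => ∫ w, chin n (z - w) • g w) atTop (𝓝 (c0 • g z)) := by
  rw [Metric.tendsto_atTop]
  intro ε hε
  have hc0 := c0_pos
  obtain ⟨δ, hδ, H⟩ := Metric.continuous_iff.1 hg z (ε / (2 * c0)) (by positivity)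
  obtain ⟨N, hN⟩ := exists_pow_lt_of_lt_one hδ (show (1/2:ℝ) < 1 by norm_num)
  refine ⟨N, fun n hn => ?_⟩
  rw [dist_eq_norm]
  refine (approx_id hg n z (ε := ε / (2*c0)) fun w hw => ?_).trans_lt ?_
  · rw [← dist_eq_norm]
    refine (H w ?_).le
    rw [dist_eq_norm]
    refine hw.trans_lt (lt_of_le_of_lt ?_ hN)
    exact pow_le_pow_of_le_one (by norm_num) (by norm_num) hn
  · have : c0 * (ε / (2 * c0)) = ε / 2 := by field_simp
    linarith

lemma vn_int_bound : ∃ C1, 0 < C1 ∧ ∀ (φ : ℂ → ℝ) (μ : Measure ℂ) (C : ℝ), DL φ μ C →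
    ∀ n z, Integrable (fun ζ => |vn n (z - ζ)|) μ ∧
    ∫ ζ, |vn n (z - ζ)| ∂μ ≤ C1 * C ^ 3 * μ.real (ball z 1) := by
  obtain ⟨C1, hC1, H⟩ := vn_bound
  refine ⟨C1 * 2, by positivity, fun φ μ C h n z => ?_⟩
  haveI := h.loc
  have hvc := (vn_smooth n).continuous
  have hc : Continuous (fun w => vn n (z - w)) := by fun_prop
  have hcs : HasCompactSupport (fun w => vn n (z - w)) :=
    (vn_cpt n).comp_isClosedEmbedding (Homeomorph.subLeft z).isClosedEmbedding
  have i1 : Integrable (fun ζ => |vn n (z - ζ)|) μ :=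
    (hc.integrable_of_hasCompactSupport hcs).abs
  refine ⟨i1, ?_⟩
  have eind : ∀ k ζ, (ball (0:ℂ) ((1/2)^k)).indicator (fun _ => (1:ℝ)) (z - ζ)
      = (ball z ((1/2)^k * 1)).indicator (fun _ => (1:ℝ)) ζ := by
    intro k ζ
    have : z - ζ ∈ ball (0:ℂ) ((1/2)^k) ↔ ζ ∈ ball z ((1/2)^k * 1) := by
      simp [dist_eq_norm, norm_sub_rev]
    by_cases hh : ζ ∈ ball z ((1/2)^k * 1)
    · rw [indicator_of_mem hh, indicator_of_mem (this.2 hh)]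
    · rw [indicator_of_notMem hh, indicator_of_notMem (fun h' => hh (this.1 h'))]
  have i2 : ∀ k : ℕ, Integrable ((ball z ((1/2)^k * 1)).indicator (fun _ => (1:ℝ))) μ := by
    intro k
    exact (integrable_indicator_iff measurableSet_ball).2
      (integrableOn_const (h.fin _ _).ne)
  have e2 : ∀ k : ℕ, ∫ ζ, (ball z ((1/2)^k * 1)).indicator (fun _ => (1:ℝ)) ζ ∂μ
      = μ.real (ball z ((1/2)^k * 1)) := by
    intro k
    rw [integral_indicator measurableSet_ball]; simp
  calc ∫ ζ, |vn n (z - ζ)| ∂μ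
      ≤ ∫ ζ, C1 * ∑ k ∈ Finset.range n, (ball z ((1/2)^k * 1)).indicator (fun _ => (1:ℝ)) ζ ∂μ := by
        refine integral_mono i1 ((integrable_finsetSum _ fun k _ => i2 k).const_mul _) fun ζ => ?_
        have := H n (z - ζ)
        simp only [eind] at this
        exact this
    _ = C1 * ∑ k ∈ Finset.range n, μ.real (ball z ((1/2)^k * 1)) := by
        rw [integral_const_mul, integral_finsetSum _ fun k _ => i2 k]
        simp only [e2]
    _ ≤ C1 * (2 * C ^ 3 * μ.real (ball z 1)) :=
        mul_le_mul_of_nonneg_left (h.sum_le z n one_pos) hC1.le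
    _ = _ := by ring

/-- Local mean of `φ`. -/
lemma DL.mean_le : ∃ C1, 0 < C1 ∧ ∀ (φ : ℂ → ℝ) (μ : Measure ℂ) (C : ℝ), DL φ μ C →
    ∫ z, φ z * chi z ≤ c0 * φ 0 + C1 * C ^ 3 * μ.real (ball 0 1) := by
  obtain ⟨C1, hC1, H⟩ := vn_int_bound
  refine ⟨C1, hC1, fun φ μ C h => ?_⟩
  have key : ∀ n, ∫ z, φ z * chi z ≤ (∫ w, chin n (0 - w) • φ w)
      + C1 * C ^ 3 * μ.real (ball 0 1) := by
    intro n
    have e := h.lap_eq (vn n) (vn_smooth n) (vn_cpt n)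
    simp only [lap_vn, mul_sub] at e
    have j1 : Integrable (fun z => φ z * chi z) :=
      (h.cont.mul chi_smooth.continuous).integrable_of_hasCompactSupport chi_cpt.mul_left
    have j2 : Integrable (fun z => φ z * chin n z) :=
      (h.cont.mul (chin_smooth n).continuous).integrable_of_hasCompactSupport (chin_cpt n).mul_left
    rw [integral_sub j1 j2] at e
    have e2 : ∫ w, chin n (0 - w) • φ w = ∫ z, φ z * chin n z := by
      congr 1; funext w; rw [zero_sub, chin_neg, smul_eq_mul, mul_comm]
    rw [e2]
    obtain ⟨hi, hb⟩ := H φ μ C h n 0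
    have ev : ∀ ζ, vn n (0 - ζ) = vn n ζ := by
      intro ζ; unfold vn LL; simp
    simp only [ev] at hi hb
    have : ∫ z, vn n z ∂μ ≤ ∫ z, |vn n z| ∂μ := by
      refine (le_abs_self _).trans ?_
      exact abs_integral_le_integral_abs
    linarith
  have lim := (approx_tendsto h.cont 0).add_const (C1 * C ^ 3 * μ.real (ball 0 1))
  have := ge_of_tendsto' lim key
  simpa using this


/-! ### Local mean inequality -/

lemma chi_rot (z w : ℂ) (hw : ‖w‖ = 1) : chi (z * w) = chi z := by
  unfold chi; rw [norm_mul, hw, mul_one]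

lemma integral_rot (G : ℂ → ℝ) (w : ℂ) (hw : ‖w‖ = 1) : ∫ z, G (z * w) = ∫ z, G z := by
  let c : Circle := ⟨w, mem_sphere_zero_iff_norm.2 hw⟩
  have := ((rotation c).measurePreserving).integral_comp
    (rotation c).toHomeomorph.measurableEmbedding G
  rw [← this]
  congr 1; funext z
  rw [rotation_apply, mul_comm]

lemma integral_circleAverage {Z : ℂ → ℝ} (hZ : Continuous Z) :
    ∫ z, Z z * chi z = ∫ z, Real.circleAverage (fun w => Z (z * w)) 0 1 * chi z := by
  have hcc := chi_smooth.continuous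
  have hpi : (0:ℝ) < 2 * π := by positivity
  have e1 : ∀ z, Real.circleAverage (fun w => Z (z * w)) 0 1 * chi z
      = (2 * π)⁻¹ * ∫ θ in (0:ℝ)..(2*π), Z (z * circleMap 0 1 θ) * chi z := by
    intro z
    rw [Real.circleAverage, smul_eq_mul, intervalIntegral.integral_mul_const, mul_assoc]
  simp only [e1]
  rw [integral_const_mul]
  have hint : Integrable (Function.uncurry fun (z : ℂ) (θ : ℝ) => Z (z * circleMap 0 1 θ) * chi z)
      ((volume : Measure ℂ).prod (volume.restrict (uIoc 0 (2*π)))) := by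
    have hcont : Continuous (Function.uncurry fun (z : ℂ) (θ : ℝ) => Z (z * circleMap 0 1 θ) * chi z) := by
      have : Continuous (circleMap 0 1) := continuous_circleMap 0 1
      unfold Function.uncurry
      fun_prop
    have hI : IntegrableOn (Function.uncurry fun (z : ℂ) (θ : ℝ) => Z (z * circleMap 0 1 θ) * chi z)
      (closedBall 0 1 ×ˢ uIcc 0 (2*π)) ((volume : Measure ℂ).prod volume) :=
      hcont.continuousOn.integrableOn_compact ((isCompact_closedBall _ _).prod isCompact_uIcc)
    have hI2 : IntegrableOn (Function.uncurry fun (z : ℂ) (θ : ℝ) => Z (z * circleMap 0 1 θ) * chi z)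
      (univ ×ˢ uIoc 0 (2*π)) ((volume : Measure ℂ).prod volume) := by
      refine (hI.mono_set (s := closedBall 0 1 ×ˢ uIoc 0 (2*π))
        (prod_mono le_rfl uIoc_subset_uIcc)).of_forall_sdiff_eq_zero ?_ ?_
      · exact MeasurableSet.univ.prod measurableSet_uIoc
      · rintro ⟨z, θ⟩ ⟨h1, h2⟩
        have : z ∉ closedBall (0:ℂ) 1 := fun h => h2 ⟨h, h1.2⟩
        simp only [Function.uncurry]
        rw [chi_eq_zero, mul_zero]
        right; simp at this; exact this.le
    rw [IntegrableOn, ← Measure.prod_restrict, Measure.restrict_univ] at hI2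
    exact hI2
  have hsw : ∫ z, ∫ θ in (0:ℝ)..(2*π), Z (z * circleMap 0 1 θ) * chi z
      = ∫ θ in (0:ℝ)..(2*π), ∫ z, Z (z * circleMap 0 1 θ) * chi z := by
    rw [intervalIntegral_integral_swap (f := fun (θ : ℝ) (z : ℂ) => Z (z * circleMap 0 1 θ) * chi z)]
    exact hint.swap
  rw [hsw]
  have e2 : ∀ θ : ℝ, ∫ z, Z (z * circleMap 0 1 θ) * chi z = ∫ z, Z z * chi z := by
    intro θ
    have hw : ‖circleMap 0 1 θ‖ = 1 := by simp
    rw [← integral_rot (fun z => Z z * chi z) _ hw]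
    congr 1; funext z; rw [chi_rot _ _ hw]
  simp only [e2]
  rw [intervalIntegral.integral_const, smul_eq_mul]
  field_simp
  ring

lemma jensen {g : ℂ → ℂ} (hg : Differentiable ℂ g) (h0 : g 0 ≠ 0) :
    Real.log ‖g 0‖ ≤ Real.circleAverage (fun w => Real.log ‖g w‖) 0 1 := by
  have ha : AnalyticOnNhd ℂ g (closedBall 0 |1|) := fun z _ => hg.analyticAt z
  have := AnalyticOnNhd.circleAverage_log_norm one_ne_zero ha h0
  rw [this]
  have : 0 ≤ ∑ᶠ u, (MeromorphicOn.divisor g (closedBall 0 |1|) u : ℝ)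
      * Real.log (1 * ‖(0:ℂ) - u‖⁻¹) := by
    apply finsum_nonneg
    intro u
    by_cases hu : u ∈ closedBall (0:ℂ) |1|
    · apply mul_nonneg
      · exact_mod_cast (MeromorphicOn.AnalyticOnNhd.divisor_nonneg ha u)
      · simp only [zero_sub, norm_neg, one_mul, Real.log_inv]
        have hn : ‖u‖ ≤ 1 := by simpa using hu
        linarith [Real.log_nonpos (norm_nonneg u) hn]
    · rw [Function.locallyFinsuppWithin.apply_eq_zero_of_notMem _ hu]; simp
  linarith

lemma LM_aux {φ : ℂ → ℝ} (hφ : Continuous φ) {p : ℝ} (hp : 0 < p) {f : ℂ → ℂ}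
    (hf : Differentiable ℂ f) {Φ : ℝ} (hΦ : ∫ z, φ z * chi z = c0 * Φ)
    {B : ℝ} (hB : ∀ z, ‖z‖ ≤ 1 → 1 - p * (φ z - Φ) ≤ p * B) (h0 : Real.log ‖f 0‖ = B)
    (hne : f 0 ≠ 0) :
    c0 * (‖f 0‖ ^ p * Real.exp (-(p * Φ))) ≤ ∫ z, ‖f z‖ ^ p * Real.exp (-(p * φ z)) * chi z := by
  have hfc : Continuous (fun z => ‖f z‖ ^ p) :=
    hf.continuous.norm.rpow_const fun _ => Or.inr hp.le
  have hec : Continuous (fun z => Real.exp (-(p * φ z))) := by fun_prop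
  have hcc := chi_smooth.continuous
  set E0 := ‖f 0‖ ^ p * Real.exp (-(p * Φ)) with hE0
  have hE0pos : 0 < E0 := by
    have : 0 < ‖f 0‖ := norm_pos_iff.2 hne
    positivity
  set Z : ℂ → ℝ := fun z => ‖f z‖ ^ p * Real.exp (-(p * φ z)) - E0 * (1 - p * (φ z - Φ)) with hZ
  have hZc : Continuous Z := by fun_prop
  have hpt : ∀ w, ‖w‖ ≤ 1 → E0 * p * (Real.log ‖f w‖ - B) ≤ Z w := by
    intro w hw
    by_cases hfw : f w = 0
    · simp only [hZ, hfw, norm_zero, Real.log_zero, Real.zero_rpow hp.ne', zero_mul]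
      have := hB w hw
      nlinarith
    · have hn : 0 < ‖f w‖ := norm_pos_iff.2 hfw
      have hn0 : 0 < ‖f 0‖ := norm_pos_iff.2 hne
      have e1 : ‖f w‖ ^ p * Real.exp (-(p * φ w))
          = E0 * Real.exp (p * (Real.log ‖f w‖ - B) - p * (φ w - Φ)) := by
        rw [hE0, Real.rpow_def_of_pos hn, Real.rpow_def_of_pos hn0, ← Real.exp_add, ← Real.exp_add,
          ← Real.exp_add, h0]
        congr 1; ring
      simp only [hZ]
      rw [e1]
      have := Real.add_one_le_exp (p * (Real.log ‖f w‖ - B) - p * (φ w - Φ))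
      have := mul_le_mul_of_nonneg_left this hE0pos.le
      linarith
  have havg : ∀ z, 0 ≤ Real.circleAverage (fun w => Z (z * w)) 0 1 * chi z := by
    intro z
    by_cases hz : 1 ≤ ‖z‖
    · rw [chi_eq_zero (Or.inr hz), mul_zero]
    · push Not at hz
      apply mul_nonneg _ (chi_nonneg z)
      have hg : Differentiable ℂ (fun w => f (z * w)) := hf.comp (by fun_prop)
      have hj := jensen hg (by simpa using hne)
      simp only [mul_zero, h0] at hj
      have ci : CircleIntegrable (fun w => Real.log ‖f (z * w)‖) 0 1 :=
        MeromorphicOn.circleIntegrable_log_norm (f := fun w => f (z * w))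
          (fun x _ => (hg.analyticAt x).meromorphicAt)
      have ci2 : CircleIntegrable (fun w => E0 * p * (Real.log ‖f (z * w)‖ - B)) 0 1 := by
        have := (ci.sub (circleIntegrable_const B 0 1)).const_smul (a := E0 * p)
        exact this
      have hle := Real.circleAverage_mono (c := 0) (R := 1) ci2
        (f₂ := fun w => Z (z * w)) (Continuous.continuousOn (by fun_prop)).circleIntegrable'
        (fun w hw => hpt _ (by
          rw [norm_mul]
          have : ‖w‖ = 1 := by simpa using hw
          rw [this]; linarith))
      refine le_trans ?_ hle
      have e : Real.circleAverage (fun w => E0 * p * (Real.log ‖f (z * w)‖ - B)) 0 1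
          = E0 * p * (Real.circleAverage (fun w => Real.log ‖f (z * w)‖) 0 1 - B) := by
        have h1 := Real.circleAverage_fun_smul (a := E0 * p)
          (f := fun w => Real.log ‖f (z * w)‖ - B) (c := 0) (R := 1)
        simp only [smul_eq_mul] at h1
        rw [h1]
        have h2 := Real.circleAverage_fun_sub ci (circleIntegrable_const B 0 1)
        rw [h2, Real.circleAverage_const]
      rw [e]
      have : 0 ≤ Real.circleAverage (fun w => Real.log ‖f (z * w)‖) 0 1 - B := by linarith
      positivity
  have hpos : 0 ≤ ∫ z, Z z * chi z := by
    rw [integral_circleAverage hZc]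
    exact integral_nonneg havg
  have j1 : Integrable (fun z => ‖f z‖ ^ p * Real.exp (-(p * φ z)) * chi z) :=
    ((hfc.mul hec).mul hcc).integrable_of_hasCompactSupport chi_cpt.mul_left
  have j2 : Integrable (fun z => φ z * chi z) :=
    (hφ.mul hcc).integrable_of_hasCompactSupport chi_cpt.mul_left
  have e : ∀ z, Z z * chi z = ‖f z‖ ^ p * Real.exp (-(p * φ z)) * chi z
      - (E0 * (1 + p * Φ) * chi z - E0 * p * (φ z * chi z)) := by
    intro z; simp only [hZ]; ring
  simp only [e] at hpos
  have j3 : Integrable (fun z => E0 * (1 + p * Φ) * chi z - E0 * p * (φ z * chi z)) :=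
    (chi_integrable.const_mul _).sub (j2.const_mul _)
  rw [integral_sub j1 j3,
    integral_sub (chi_integrable.const_mul _) (j2.const_mul _), integral_const_mul,
    integral_const_mul, hΦ, show ∫ z, chi z = c0 from rfl] at hpos
  nlinarith

lemma LM_unit : ∃ C1, 0 < C1 ∧ ∀ (φ : ℂ → ℝ) (μ : Measure ℂ) (C : ℝ), DL φ μ C → ∀ p : ℝ, 0 < p →
    ∀ f : ℂ → ℂ, Differentiable ℂ f →
    ‖f 0‖ ^ p * Real.exp (-(p * φ 0)) ≤ Real.exp (p * (C1 * C ^ 3 * μ.real (ball 0 1))) / c0 *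
      ∫ z, ‖f z‖ ^ p * Real.exp (-(p * φ z)) * chi z := by
  obtain ⟨C1, hC1, H⟩ := DL.mean_le
  have hc0 := c0_pos
  refine ⟨C1 / c0, by positivity, fun φ μ C h p hp f hf => ?_⟩
  have hint0 : 0 ≤ ∫ z, ‖f z‖ ^ p * Real.exp (-(p * φ z)) * chi z :=
    integral_nonneg fun z => mul_nonneg (by positivity) (chi_nonneg z)
  by_cases hne : f 0 = 0
  · rw [hne, norm_zero, Real.zero_rpow hp.ne', zero_mul]
    positivity
  set Φ := (∫ z, φ z * chi z) / c0 with hΦd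
  have hΦ : ∫ z, φ z * chi z = c0 * Φ := by rw [hΦd]; field_simp
  have hφc := h.cont
  obtain ⟨B0, hB0⟩ := (isCompact_closedBall (0:ℂ) 1).exists_bound_of_continuousOn
    (f := fun z => 1 - p * (φ z - Φ)) (by fun_prop)
  have hn0 : 0 < ‖f 0‖ := norm_pos_iff.2 hne
  set T : ℝ := Real.exp (B0 / p) / ‖f 0‖ with hT
  have hTpos : 0 < T := by positivity
  have key := LM_aux h.cont hp (f := fun z => (T : ℂ) * f z) (hf.const_mul _) hΦ (B := B0 / p)
    (by
      intro z hz
      have := (le_abs_self _).trans (hB0 z (by simpa using hz))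
      rw [mul_div_cancel₀ _ hp.ne']; exact this)
    (by
      rw [norm_mul, Complex.norm_real, Real.norm_of_nonneg hTpos.le, hT, div_mul_cancel₀ _ hn0.ne',
        Real.log_exp])
    (mul_ne_zero (by exact_mod_cast hTpos.ne') hne)
  simp only [norm_mul, Complex.norm_real, Real.norm_of_nonneg hTpos.le,
    Real.mul_rpow hTpos.le (norm_nonneg _), mul_assoc] at key
  rw [integral_const_mul] at key
  have hTp : 0 < T ^ p := by positivity
  have key2 : c0 * (‖f 0‖ ^ p * Real.exp (-(p * Φ)))
      ≤ ∫ z, ‖f z‖ ^ p * Real.exp (-(p * φ z)) * chi z := by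
    simp only [mul_assoc]
    have : T ^ p * (c0 * (‖f 0‖ ^ p * Real.exp (-(p * Φ)))) ≤ T ^ p *
      ∫ z, ‖f z‖ ^ p * (Real.exp (-(p * φ z)) * chi z) := by linarith
    exact le_of_mul_le_mul_left this hTp
  have hΦle : Φ ≤ φ 0 + C1 / c0 * C ^ 3 * μ.real (ball 0 1) := by
    have := H φ μ C h
    rw [hΦd, div_le_iff₀ hc0]
    calc _ ≤ _ := this
      _ = _ := by field_simp
  have e1 : Real.exp (-(p * φ 0)) ≤
      Real.exp (p * (C1 / c0 * C ^ 3 * μ.real (ball 0 1))) * Real.exp (-(p * Φ)) := by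
    rw [← Real.exp_add, Real.exp_le_exp]
    nlinarith
  calc ‖f 0‖ ^ p * Real.exp (-(p * φ 0))
      ≤ ‖f 0‖ ^ p * (Real.exp (p * (C1 / c0 * C ^ 3 * μ.real (ball 0 1))) * Real.exp (-(p * Φ))) :=
        mul_le_mul_of_nonneg_left e1 (by positivity)
    _ = Real.exp (p * (C1 / c0 * C ^ 3 * μ.real (ball 0 1))) / c0 *
        (c0 * (‖f 0‖ ^ p * Real.exp (-(p * Φ)))) := by field_simp
    _ ≤ _ := mul_le_mul_of_nonneg_left key2 (by positivity)

def ann (z0 : ℂ) (r : ℝ) : Set ℂ := {z | r / 2 ≤ ‖z - z0‖ ∧ ‖z - z0‖ < r}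

lemma ann_meas (z0 : ℂ) (r : ℝ) : MeasurableSet (ann z0 r) := by
  have h : Measurable (fun z : ℂ => ‖z - z0‖) := by fun_prop
  exact (measurableSet_le measurable_const h).inter (measurableSet_lt h measurable_const)

/-- Local mean inequality at scale `r`, with integrals over the annulus. -/
lemma LM {C A p : ℝ} (hp : 0 < p) (hC : 1 ≤ C) :
    ∃ K, 0 < K ∧ ∀ (φ : ℂ → ℝ) (μ : Measure ℂ), DL φ μ C → ∀ f : ℂ → ℂ, Differentiable ℂ f →
    ∀ z0 r, 0 < r → μ.real (ball z0 r) ≤ A →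
    ENNReal.ofReal (‖f z0‖ ^ p * Real.exp (-(p * φ z0))) ≤ ENNReal.ofReal (K / r ^ 2) *
      ∫⁻ z in ann z0 r, ENNReal.ofReal (‖f z‖ ^ p * Real.exp (-(p * φ z))) := by
  obtain ⟨C1, hC1, H⟩ := LM_unit
  obtain ⟨Cχ, hCχ, hχ⟩ := chi_bdd
  have hc0 := c0_pos
  refine ⟨Real.exp (p * (C1 * C ^ 3 * A)) / c0 * Cχ, by positivity,
    fun φ μ h f hf z0 r hr hA => ?_⟩
  have key := H _ _ C (h.affine hr z0) p hp (fun w => f (r * w + z0)) (hf.comp (by fun_prop))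
  rw [map_affine_ball μ hr] at key
  simp only [mul_zero, zero_add, mul_one] at key
  set G : ℂ → ℝ := fun z => ‖f z‖ ^ p * Real.exp (-(p * φ z)) with hG
  have hGc : Continuous G := by
    have h1 : Continuous (fun z => ‖f z‖ ^ p) := hf.continuous.norm.rpow_const fun _ => Or.inr hp.le
    have := h.cont
    fun_prop
  have hG0 : ∀ z, 0 ≤ G z := fun z => by positivity
  have hrc : (r : ℂ) ≠ 0 := by exact_mod_cast hr.ne'
  have e1 := integral_affine (fun z => G z * chi ((z - z0) / r)) hr z0
  have e2 : ∀ w : ℂ, ((r:ℂ) * w + z0 - z0) / r = w := by intro w; field_simp; ring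
  simp only [e2, smul_eq_mul] at e1
  have e3 : (∫ z, ‖f (r * z + z0)‖ ^ p * Real.exp (-(p * φ (r * z + z0))) * chi z)
      = (r ^ 2)⁻¹ * ∫ z, G z * chi ((z - z0) / r) := e1
  rw [e3] at key
  have hle : ∀ z, G z * chi ((z - z0) / r) ≤ (ann z0 r).indicator (fun z => Cχ * G z) z := by
    intro z
    by_cases hz : z ∈ ann z0 r
    · rw [indicator_of_mem hz, mul_comm]
      exact mul_le_mul_of_nonneg_right (hχ _) (hG0 z)
    · rw [indicator_of_notMem hz, chi_eq_zero, mul_zero]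
      have en : ‖(z - z0) / r‖ = ‖z - z0‖ / r := by
        rw [norm_div, Complex.norm_real, Real.norm_of_nonneg hr.le]
      rw [en, div_le_iff₀ hr, le_div_iff₀ hr]
      unfold ann at hz
      simp only [mem_ofPred_eq, not_and_or, not_le, not_lt] at hz
      rcases hz with hz | hz
      · left; linarith
      · right; linarith
  have hbd : (ann z0 r) ⊆ closedBall z0 r := fun z hz => by
    rw [mem_closedBall, dist_eq_norm]; exact hz.2.le
  have iG : IntegrableOn G (ann z0 r) :=
    (hGc.continuousOn.integrableOn_compact (isCompact_closedBall z0 r)).mono_set hbd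
  have hI : ∫ z, G z * chi ((z - z0) / r) ≤ Cχ * ∫ z in ann z0 r, G z := by
    have := integral_mono_of_nonneg (μ := (volume : Measure ℂ))
      (Eventually.of_forall fun z => mul_nonneg (hG0 z) (chi_nonneg ((z - z0) / r)))
      ((integrable_indicator_iff (ann_meas z0 r)).2 (iG.const_mul Cχ))
      (Eventually.of_forall hle)
    rw [integral_indicator (ann_meas z0 r), integral_const_mul] at this
    exact this
  have hreal : G z0 ≤ Real.exp (p * (C1 * C ^ 3 * A)) / c0 * Cχ / r ^ 2 * ∫ z in ann z0 r, G z := by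
    refine key.trans ?_
    have h4 : 0 ≤ ∫ z, G z * chi ((z - z0) / r) :=
      integral_nonneg fun z => mul_nonneg (hG0 z) (chi_nonneg _)
    have h3 : 0 ≤ ∫ z in ann z0 r, G z := integral_nonneg fun z => hG0 z
    calc _ ≤ Real.exp (p * (C1 * C ^ 3 * A)) / c0 * ((r ^ 2)⁻¹ * (Cχ * ∫ z in ann z0 r, G z)) := by
          gcongr
      _ = _ := by field_simp
  have hl : ∫⁻ z in ann z0 r, ENNReal.ofReal (‖f z‖ ^ p * Real.exp (-(p * φ z)))
      = ENNReal.ofReal (∫ z in ann z0 r, G z) := by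
    rw [ofReal_integral_eq_lintegral_ofReal iG (Eventually.of_forall hG0)]
  rw [hl, ← ENNReal.ofReal_mul (by positivity)]
  exact ENNReal.ofReal_le_ofReal hreal


/-! ### Convolutions -/

section conv
variable {A : Type*} [NormedRing A] [NormedAlgebra ℝ A]

def cv (ν : Measure ℂ) (f g : ℂ → A) (z : ℂ) : A := ∫ t, f t * g (z - t) ∂ν

lemma cv_smooth {ν : Measure ℂ} {f g : ℂ → A} (hf : LocallyIntegrable f ν) (hg : Sm g)
    (hc : HasCompactSupport g) : Sm (cv ν f g) :=
  hc.contDiff_convolution_right (L := ContinuousLinearMap.mul ℝ A) hf hg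

lemma cv_fderiv {ν : Measure ℂ} {f g : ℂ → A} (hf : LocallyIntegrable f ν) (hg : Sm g)
    (hc : HasCompactSupport g) (z e : ℂ) :
    fderiv ℝ (cv ν f g) z e = cv ν f (fun w => fderiv ℝ g w e) z := by
  have hun : (↿(fun _ : ℂ => g) : ℂ × ℂ → A) = fun q => g q.2 := rfl
  have hfd : ∀ x : ℂ, fderiv ℝ (↿(fun _ : ℂ => g) : ℂ × ℂ → A) ((0:ℂ), x)
      = (fderiv ℝ g x).comp (ContinuousLinearMap.snd ℝ ℂ ℂ) := by
    intro x
    rw [hun]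
    exact ((hg.diff x).hasFDerivAt.comp ((0:ℂ), x) (hasFDerivAt_snd)).fderiv
  have h := hasFDerivAt_convolution_right_with_param (μ := ν) (ContinuousLinearMap.mul ℝ A)
    (g := fun _ : ℂ => g) (s := univ) (k := tsupport g)
    isOpen_univ hc (fun p x _ hx => image_eq_zero_of_notMem_tsupport hx) hf
    (by
      rw [hun]
      exact ((hg.of_le (by exact_mod_cast le_top)).comp contDiff_snd).contDiffOn) (0, z) (mem_univ _)
  have h2 : HasFDerivAt (cv ν f g) _ z := h.comp z (hasFDerivAt_prodMk_right (0:ℂ) z)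
  have ex := HasCompactSupport.convolutionExists_right (μ := ν)
    ((ContinuousLinearMap.mul ℝ A).precompR (ℂ × ℂ))
    (g := fun x : ℂ => fderiv ℝ (↿(fun _ : ℂ => g) : ℂ × ℂ → A) ((0:ℂ), x))
    (by
      simp only [hfd]
      exact (hc.fderiv ℝ).comp_left (g := fun T : ℂ →L[ℝ] A => T.comp (ContinuousLinearMap.snd ℝ ℂ ℂ))
        (by simp))
    hf (by
      simp only [hfd]
      exact (hg.continuous_fderiv (by simp)).clm_comp continuous_const) z
  rw [h2.fderiv, ContinuousLinearMap.comp_apply, convolution_def,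
    ContinuousLinearMap.integral_apply ex]
  simp only [hfd]
  unfold cv
  congr 1

end conv

lemma lap_cpt {g : ℂ → ℝ} (hg : Sm g) (hc : HasCompactSupport g) : HasCompactSupport (lap g) := by
  have h1 := (hc.fderiv_apply ℝ (1:ℂ)).fderiv_apply ℝ (1:ℂ)
  have h2 := (hc.fderiv_apply ℝ (Complex.I)).fderiv_apply ℝ (Complex.I)
  have := h1.add h2
  exact this.mono (by intro z hz; rwa [Function.mem_support, lap_eq_pd hg] at hz)

lemma lap_cv {ν : Measure ℂ} {f g : ℂ → ℝ} (hf : LocallyIntegrable f ν) (hg : Sm g)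
    (hc : HasCompactSupport g) (z : ℂ) : lap (cv ν f g) z = cv ν f (lap g) z := by
  have e : ∀ e : ℂ, (fun w => fderiv ℝ (cv ν f g) w e) = cv ν f (fun w => fderiv ℝ g w e) :=
    fun e => funext fun w => cv_fderiv hf hg hc w e
  rw [lap_eq_pd (cv_smooth hf hg hc), e, e, cv_fderiv hf (hg.pd _) (hc.fderiv_apply ℝ _),
    cv_fderiv hf (hg.pd _) (hc.fderiv_apply ℝ _)]
  have hi : ∀ e : ℂ, Integrable (fun t => f t * fderiv ℝ (fun w => fderiv ℝ g w e) (z - t) e) ν := by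
    intro e
    have hcc : HasCompactSupport (fun t => fderiv ℝ (fun w => fderiv ℝ g w e) (z - t) e) :=
      ((hc.fderiv_apply ℝ e).fderiv_apply ℝ e).comp_isClosedEmbedding
        (Homeomorph.subLeft z).isClosedEmbedding
    have hct : Continuous (fun t => fderiv ℝ (fun w => fderiv ℝ g w e) (z - t) e) :=
      (((hg.pd e).pd e).continuous).comp (by fun_prop)
    have := hf.integrable_smul_right_of_hasCompactSupport hct hcc
    simpa [smul_eq_mul] using this
  unfold cv
  rw [← integral_add (hi _) (hi _)]
  congr 1; funext t
  rw [lap_eq_pd hg]; ring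

/-! ### The dual inequality -/

lemma LL_lower (w : ℂ) : Real.log ((1 + ‖w‖ ^ 2) / 2) / 2 ≤ LL w := by
  by_cases hw : 1 ≤ ‖w‖
  · rw [LL_large hw]
    have h1 : Real.log ((1 + ‖w‖ ^ 2) / 2) ≤ Real.log (‖w‖ ^ 2) := by
      apply Real.log_le_log (by positivity); nlinarith
    rw [Real.log_pow] at h1
    push_cast at h1
    linarith [cL_nonneg]
  · push Not at hw
    have h1 : Real.log ((1 + ‖w‖ ^ 2) / 2) ≤ 0 := by
      apply Real.log_nonpos (by positivity); nlinarith [norm_nonneg w]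
    linarith [LL_nonneg w]

lemma exp_LL {s : ℝ} (hs : 0 < s) (hs1 : s ≤ 1) (N : ℕ) (z : ℂ) :
    Real.exp (-(2 * N * LL (((s⁻¹ : ℝ) : ℂ) * z))) ≤ 2 ^ N * ((1 + ‖z‖ ^ 2) ^ N)⁻¹ := by
  set w : ℂ := ((s⁻¹ : ℝ) : ℂ) * z with hw
  have hn : ‖w‖ = s⁻¹ * ‖z‖ := by
    rw [hw, norm_mul, Complex.norm_real, Real.norm_of_nonneg (by positivity)]
  have h1 := LL_lower w
  have hzw : ‖z‖ ≤ ‖w‖ := by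
    rw [hn]; exact le_mul_of_one_le_left (norm_nonneg z) ((one_le_inv₀ hs).2 hs1)
  have e : Real.exp (-(N * Real.log ((1 + ‖w‖ ^ 2) / 2))) = 2 ^ N * ((1 + ‖w‖ ^ 2) ^ N)⁻¹ := by
    rw [Real.exp_neg, mul_comm, Real.exp_mul, Real.exp_log (by positivity), Real.rpow_natCast,
      div_pow, inv_div, div_eq_mul_inv]
  calc _ ≤ Real.exp (-(N * Real.log ((1 + ‖w‖ ^ 2) / 2))) := by
        rw [Real.exp_le_exp]
        have : (0:ℝ) ≤ N := by positivity
        nlinarith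
    _ = 2 ^ N * ((1 + ‖w‖ ^ 2) ^ N)⁻¹ := e
    _ ≤ _ := by gcongr

/-- regularization of `φ` -/
def phn (φ : ℂ → ℝ) (n : ℕ) : ℂ → ℝ := fun z => c0⁻¹ * cv volume φ (chin n) z
/-- correction -/
def Tn (μ : Measure ℂ) (n : ℕ) : ℂ → ℝ :=
  fun z => c0⁻¹ * cv (μ.restrict (ball 0 1)) (fun _ => (1:ℝ)) (vn n) z

section
variable {φ : ℂ → ℝ} {μ : Measure ℂ} {C : ℝ}

lemma phn_smooth (h : DL φ μ C) (n : ℕ) : Sm (phn φ n) :=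
  contDiff_const.mul (cv_smooth h.cont.locallyIntegrable (chin_smooth n) (chin_cpt n))

lemma one_li (h : DL φ μ C) : LocallyIntegrable (fun _ : ℂ => (1:ℝ)) (μ.restrict (ball 0 1)) := by
  have := h.loc
  exact locallyIntegrable_const 1

lemma Tn_smooth (h : DL φ μ C) (n : ℕ) : Sm (Tn μ n) :=
  contDiff_const.mul (cv_smooth (one_li h) (vn_smooth n) (vn_cpt n))

lemma lap_phn (h : DL φ μ C) (n : ℕ) (z : ℂ) :
    lap (phn φ n) z = c0⁻¹ * ∫ ζ, chin n (z - ζ) ∂μ := by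
  unfold phn
  have hli : LocallyIntegrable φ (volume : Measure ℂ) := h.cont.locallyIntegrable
  rw [lap_const_mul (cv_smooth hli (chin_smooth n) (chin_cpt n)),
    lap_cv hli (chin_smooth n) (chin_cpt n)]
  congr 1
  have e : ∀ w : ℂ, (((-1:ℝ) : ℂ) * w + z) = z - w := by intro w; push_cast; ring
  have hs := (chin_smooth n).comp_affine ((-1:ℝ):ℂ) z
  simp only [e] at hs
  have := h.lap_eq _ hs (chin_cpt_sub n z)
  rw [← this]
  unfold cv
  congr 1; funext w
  congr 1
  have := lap_comp_affine (chin_smooth n) (-1) z w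
  simp only [e] at this
  rw [this]; ring

lemma lap_sum (h : DL φ μ C) (n : ℕ) (z : ℂ) :
    c0⁻¹ * ∫ ζ in ball 0 1, chi (z - ζ) ∂μ ≤ lap (fun w => phn φ n w + Tn μ n w) z := by
  have := h.loc
  rw [lap_add (phn_smooth h n) (Tn_smooth h n), lap_phn h]
  unfold Tn
  rw [lap_const_mul (cv_smooth (one_li h) (vn_smooth n) (vn_cpt n)),
    lap_cv (one_li h) (vn_smooth n) (vn_cpt n), ← mul_add]
  have hc0 := c0_pos
  apply mul_le_mul_of_nonneg_left _ (by positivity)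
  have i0 : ∀ m, Integrable (fun ζ => chin m (z - ζ)) μ := by
    intro m
    have hcs := (chin_smooth m).continuous
    exact Continuous.integrable_of_hasCompactSupport (by fun_prop) (chin_cpt_sub m z)
  have i1 := (i0 0).restrict (s := ball 0 1)
  simp only [chin_zero] at i1
  unfold cv
  simp only [one_mul, lap_vn]
  rw [integral_sub i1 (i0 n).restrict]
  have := setIntegral_le_integral (s := ball 0 1) (i0 n)
    (Eventually.of_forall fun ζ => chin_nonneg n (z - ζ))
  linarith

lemma phn_close (h : DL φ μ C) {S : Set ℂ} (hS : IsCompact S) :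
    ∃ n, ∀ z ∈ S, |phn φ n z - φ z| ≤ 1 := by
  have hc0 := c0_pos
  have hcomp : IsCompact (cthickening 1 S) := hS.cthickening
  have huc := hcomp.uniformContinuousOn_of_continuous h.cont.continuousOn
  rw [Metric.uniformContinuousOn_iff] at huc
  obtain ⟨δ, hδ, H⟩ := huc 1 one_pos
  obtain ⟨n, hn⟩ := exists_pow_lt_of_lt_one hδ (show (1/2:ℝ) < 1 by norm_num)
  refine ⟨n, fun z hz => ?_⟩
  have key := approx_id h.cont n z (ε := 1) (by
    intro w hw
    rw [← dist_eq_norm]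
    refine (H w ?_ z ?_ ?_).le
    · apply mem_cthickening_of_dist_le w z 1 S hz
      rw [dist_eq_norm]; exact hw.trans (pow_le_one₀ (by norm_num) (by norm_num))
    · exact self_subset_cthickening S hz
    · rw [dist_eq_norm]; exact hw.trans_lt hn)
  have e : phn φ n z - φ z = c0⁻¹ * ((∫ w, chin n (z - w) • φ w) - c0 • φ z) := by
    unfold phn cv
    rw [mul_sub, smul_eq_mul, inv_mul_cancel_left₀ hc0.ne']
    congr 2; congr 1; funext w; rw [smul_eq_mul, mul_comm]
  rw [e, abs_mul, abs_of_pos (inv_pos.2 hc0)]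
  rw [Real.norm_eq_abs, mul_one] at key
  calc _ ≤ c0⁻¹ * c0 := mul_le_mul_of_nonneg_left key (by positivity)
    _ = 1 := inv_mul_cancel₀ hc0.ne'

end

lemma Tn_bound : ∃ K, 0 < K ∧ ∀ (φ : ℂ → ℝ) (μ : Measure ℂ) (C : ℝ), DL φ μ C → ∀ n z,
    |Tn μ n z| ≤ K * C ^ 5 * μ.real (ball 0 1) := by
  obtain ⟨C1, hC1, H⟩ := vn_int_bound
  have hc0 := c0_pos
  refine ⟨c0⁻¹ * C1, by positivity, fun φ μ C h n z => ?_⟩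
  have hC := h.one_le
  by_cases hz : ‖z‖ < 2
  · obtain ⟨hi, hb⟩ := H φ μ C h n z
    have h1 : μ.real (ball z 1) ≤ C ^ 2 * μ.real (ball 0 1) := by
      refine le_trans (h.real_mono (w := 0) (s := 2 ^ 2 * 1) ?_) (h.dbl_pow 0 one_pos 2)
      intro w hw
      rw [mem_ball, dist_eq_norm] at hw ⊢
      rw [sub_zero]
      calc ‖w‖ = ‖(w - z) + z‖ := by congr 1; ring
        _ ≤ ‖w - z‖ + ‖z‖ := norm_add_le _ _
        _ < _ := by linarith
    unfold Tn cv
    simp only [one_mul]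
    rw [abs_mul, abs_of_pos (inv_pos.2 hc0)]
    have h2 : |∫ t in ball 0 1, vn n (z - t) ∂μ| ≤ ∫ t, |vn n (z - t)| ∂μ := by
      refine abs_integral_le_integral_abs.trans ?_
      exact setIntegral_le_integral hi (Eventually.of_forall fun _ => abs_nonneg _)
    calc _ ≤ c0⁻¹ * (C1 * C ^ 3 * (C ^ 2 * μ.real (ball 0 1))) := by
          apply mul_le_mul_of_nonneg_left _ (by positivity)
          refine h2.trans (hb.trans ?_)
          gcongr
      _ = _ := by ring
  · push Not at hz
    have : Tn μ n z = 0 := by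
      unfold Tn cv
      rw [setIntegral_eq_zero_of_forall_eq_zero, mul_zero]
      intro t ht
      rw [vn_eq_zero, mul_zero]
      have : ‖t‖ < 1 := by simpa using ht
      have := norm_sub_norm_le z t
      linarith
    rw [this, abs_zero]
    have := measureReal_nonneg (μ := μ) (s := ball (0:ℂ) 1)
    positivity

def wtN (φ : ℂ → ℝ) (N : ℕ) (z : ℂ) : ℝ :=
  Real.exp (2 * φ z) * ((‖z‖ ^ 2)⁻¹ * ((1 + ‖z‖ ^ 2) ^ N)⁻¹)

lemma dbar_eq_zero_of_notMem {α : ℂ → ℂ} {z : ℂ} (hz : z ∉ tsupport α) : dbar α z = 0 := by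
  have : fderiv ℝ α z = 0 := by
    by_contra hne
    exact hz (support_fderiv_subset ℝ hne)
  unfold dbar; rw [this]; simp

lemma dual_ineq {C : ℝ} (hC : 1 ≤ C) (N : ℕ) : ∃ m0, 0 < m0 ∧ ∀ A, ∃ K, 0 < K ∧
    ∀ (φ : ℂ → ℝ) (μ : Measure ℂ), DL φ μ C → m0 ≤ μ.real (ball 0 1) → μ.real (ball 0 1) ≤ A →
    ∀ α : ℂ → ℂ, Sm α → HasCompactSupport α → Integrable (fun z => wtN φ N z * ‖dbar α z‖ ^ 2) →
    Real.exp (2 * φ 0) * ‖α 0‖ ^ 2 ≤ K * ∫ z, wtN φ N z * ‖dbar α z‖ ^ 2 := by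
  obtain ⟨x0, δ, hx0, hδ, hxδ, hbig⟩ := chi_big
  obtain ⟨Cχ, hCχ, hχ⟩ := chi_bdd
  obtain ⟨KT, hKT, HT⟩ := Tn_bound
  have hc0 := c0_pos
  set M := N + 3 with hM
  set s := δ / 2 with hs
  have hs0 : 0 < s := by positivity
  have hs1 : s ≤ 1 := by linarith
  obtain ⟨k, hk⟩ := pow_unbounded_of_one_lt (2 / s) (one_lt_two (α := ℝ))
  rw [div_lt_iff₀ hs0] at hk
  set c' := c0⁻¹ * (C ^ k)⁻¹ with hc'
  have hc'0 : 0 < c' := by positivity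
  set m0 := M * (s⁻¹ ^ 2 * Cχ) / c' with hm0
  have hM0 : (0:ℝ) < M := by rw [hM]; positivity
  refine ⟨m0, by positivity, fun A => ?_⟩
  set T := KT * C ^ 5 * A with hT
  refine ⟨8 / π * (Real.exp (4 + 4 * T) * 2 ^ M), by positivity, ?_⟩
  intro φ μ h hm hA α hα hαc hint
  have hloc := h.loc
  have hTb : ∀ n z, |Tn μ n z| ≤ T := fun n z => (HT φ μ C h n z).trans (by rw [hT]; gcongr)
  obtain ⟨n, hn⟩ := phn_close h (S := tsupport α ∪ {0}) (hαc.union isCompact_singleton)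
  set ψ : ℂ → ℝ := fun w => phn φ n w + Tn μ n w with hψ
  have sψ : Sm ψ := (phn_smooth h n).add (Tn_smooth h n)
  set Ls : ℂ → ℝ := fun z => LL (((s⁻¹ : ℝ) : ℂ) * z) with hLs
  have sLs : Sm Ls := by
    have := LL_smooth.comp_affine ((s⁻¹ : ℝ) : ℂ) 0
    simpa only [add_zero] using this
  have slog := logc_smooth one_pos
  set η : ℂ → ℝ := fun z => (2 * ψ z + (-(2 * M : ℝ)) * Ls z) + 2 * Real.log (1 + ‖z‖ ^ 2) with hη
  have sη : Sm η := ((contDiff_const.mul sψ).add (contDiff_const.mul sLs)).add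
    (contDiff_const.mul slog)
  have lapψ : ∀ z, (c' * μ.real (ball 0 1)) * (ball (0:ℂ) s).indicator (fun _ => (1:ℝ)) z
      ≤ lap ψ z := by
    intro z
    refine le_trans ?_ (lap_sum h n z)
    have hnn : 0 ≤ ∫ ζ in ball 0 1, chi (z - ζ) ∂μ := integral_nonneg fun ζ => chi_nonneg _
    by_cases hz : z ∈ ball (0:ℂ) s
    · rw [indicator_of_mem hz, mul_one, hc', mul_assoc]
      apply mul_le_mul_of_nonneg_left _ (by positivity)
      have hz' : ‖z‖ < s := by simpa using hz
      have hsub : ball (-(x0:ℂ)) s ⊆ ball 0 1 := by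
        intro ζ hζ
        rw [mem_ball, dist_eq_norm] at hζ ⊢
        calc ‖ζ - 0‖ = ‖(ζ - -(x0:ℂ)) - x0‖ := by congr 1; ring
          _ ≤ ‖ζ - -(x0:ℂ)‖ + ‖(x0:ℂ)‖ := norm_sub_le _ _
          _ < 1 := by rw [Complex.norm_real, Real.norm_of_nonneg hx0.le]; linarith
      have hchi : ContinuousOn (fun ζ => chi (z - ζ)) (closedBall 0 1) := by
        have := chi_smooth.continuous
        fun_prop
      have hio : IntegrableOn (fun ζ => chi (z - ζ)) (ball 0 1) μ :=
        (hchi.integrableOn_compact (isCompact_closedBall _ _)).mono_set ball_subset_closedBall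
      have h1 : μ.real (ball (-(x0:ℂ)) s) ≤ ∫ ζ in ball 0 1, chi (z - ζ) ∂μ := by
        calc μ.real (ball (-(x0:ℂ)) s) = ∫ ζ in ball (-(x0:ℂ)) s, (1:ℝ) ∂μ := by simp
          _ ≤ ∫ ζ in ball (-(x0:ℂ)) s, chi (z - ζ) ∂μ := by
              refine setIntegral_mono_on (integrableOn_const (h.fin _ _).ne) (hio.mono_set hsub)
                measurableSet_ball fun ζ hζ => hbig _ ?_
              rw [mem_ball, dist_eq_norm] at hζ
              calc ‖z - ζ - x0‖ = ‖z - (ζ - -(x0:ℂ))‖ := by congr 1; ring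
                _ ≤ ‖z‖ + ‖ζ - -(x0:ℂ)‖ := norm_sub_le _ _
                _ < δ := by linarith
          _ ≤ _ := setIntegral_mono_set hio (Eventually.of_forall fun ζ => chi_nonneg _)
                (HasSubset.Subset.eventuallyLE hsub)
      have h2 : μ.real (ball 0 1) ≤ C ^ k * μ.real (ball (-(x0:ℂ)) s) := by
        refine le_trans (h.real_mono ?_) (h.dbl_pow _ hs0 k)
        intro ζ hζ
        rw [mem_ball, dist_eq_norm] at hζ ⊢
        rw [sub_zero] at hζ
        calc ‖ζ - -(x0:ℂ)‖ = ‖ζ + x0‖ := by congr 1; ring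
          _ ≤ ‖ζ‖ + ‖(x0:ℂ)‖ := norm_add_le _ _
          _ < 2 ^ k * s := by rw [Complex.norm_real, Real.norm_of_nonneg hx0.le]; linarith
      rw [inv_mul_le_iff₀ (by positivity)]
      exact h2.trans (mul_le_mul_of_nonneg_left h1 (by positivity))
    · rw [indicator_of_notMem hz, mul_zero]
      positivity
  have lapLs : ∀ z, lap Ls z ≤ s⁻¹ ^ 2 * Cχ * (ball (0:ℂ) s).indicator (fun _ => (1:ℝ)) z := by
    intro z
    rw [hLs, lap_comp_smul LL_smooth, lap_LL, mul_assoc]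
    apply mul_le_mul_of_nonneg_left _ (by positivity)
    by_cases hz : z ∈ ball (0:ℂ) s
    · rw [indicator_of_mem hz, mul_one]; exact hχ _
    · rw [indicator_of_notMem hz, mul_zero, chi_eq_zero]
      right
      rw [norm_mul, Complex.norm_real, Real.norm_of_nonneg (by positivity)]
      have : s ≤ ‖z‖ := by simpa using hz
      rw [inv_mul_eq_div, one_le_div hs0]; exact this
  have hl : ∀ z, 2 / (1 + ‖z‖ ^ 2) ^ 2 ≤ lap η z / 4 := by
    intro z
    rw [hη, lap_add ((contDiff_const.mul sψ).add (contDiff_const.mul sLs))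
      (contDiff_const.mul slog), lap_add (contDiff_const.mul sψ) (contDiff_const.mul sLs),
      lap_const_mul sψ, lap_const_mul sLs, lap_const_mul slog, lap_logc one_pos]
    have a1 := lapψ z
    have a2 := lapLs z
    set ι := (ball (0:ℂ) s).indicator (fun _ => (1:ℝ)) z
    have hι : 0 ≤ ι := indicator_nonneg (fun _ _ => zero_le_one) z
    have a3 : (M:ℝ) * (s⁻¹ ^ 2 * Cχ) ≤ c' * μ.real (ball 0 1) := by
      rw [hm0, div_le_iff₀ hc'0] at hm; linarith
    have a4 : (M:ℝ) * lap Ls z ≤ lap ψ z := by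
      calc (M:ℝ) * lap Ls z ≤ M * (s⁻¹ ^ 2 * Cχ * ι) := mul_le_mul_of_nonneg_left a2 hM0.le
        _ = (M * (s⁻¹ ^ 2 * Cχ)) * ι := by ring
        _ ≤ (c' * μ.real (ball 0 1)) * ι := mul_le_mul_of_nonneg_right a3 hι
        _ ≤ _ := a1
    have e : 2 / (1 + ‖z‖ ^ 2) ^ 2 = 2 * (1 / (1 + ‖z‖ ^ 2) ^ 2) := by ring
    rw [e]
    linarith
  have hexp : ∀ z ∈ tsupport α ∪ {0}, Real.exp (η z) ≤
      Real.exp (2 + 2 * T) * 2 ^ M * (Real.exp (2 * φ z) * ((1 + ‖z‖ ^ 2) ^ (N + 1))⁻¹) := by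
    intro z hz
    have b1 := (abs_le.1 (hn z hz)).2
    have b2 := (abs_le.1 (hTb n z)).2
    have b3 := exp_LL hs0 hs1 M z
    have e1 : Real.exp (η z) = Real.exp (2 * ψ z) * Real.exp (-(2 * M * Ls z)) * (1 + ‖z‖ ^ 2) ^ 2 := by
      have : Real.exp (2 * Real.log (1 + ‖z‖ ^ 2)) = (1 + ‖z‖ ^ 2) ^ 2 := by
        rw [mul_comm, Real.exp_mul, Real.exp_log (by positivity)]; norm_cast
      rw [← this, ← Real.exp_add, ← Real.exp_add]
      congr 1; simp only [hη]; ring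
    have e2 : Real.exp (2 * ψ z) ≤ Real.exp (2 + 2 * T) * Real.exp (2 * φ z) := by
      rw [← Real.exp_add, Real.exp_le_exp]; simp only [hψ]; linarith
    rw [e1]
    calc _ ≤ Real.exp (2 + 2 * T) * Real.exp (2 * φ z) * (2 ^ M * ((1 + ‖z‖ ^ 2) ^ M)⁻¹)
          * (1 + ‖z‖ ^ 2) ^ 2 := by gcongr
      _ = _ := by
        rw [hM, pow_add _ N 3, pow_add _ N 1]
        field_simp
        ring
  have hpt : ∀ z, Real.exp (η z) * ((1 + ‖z‖ ^ 2) / ‖z‖ ^ 2 * ‖dbar α z‖ ^ 2) ≤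
      Real.exp (2 + 2 * T) * 2 ^ M * (wtN φ N z * ‖dbar α z‖ ^ 2) := by
    intro z
    by_cases hz : z ∈ tsupport α
    · have := hexp z (Or.inl hz)
      calc _ ≤ (Real.exp (2 + 2 * T) * 2 ^ M * (Real.exp (2 * φ z) * ((1 + ‖z‖ ^ 2) ^ (N + 1))⁻¹))
            * ((1 + ‖z‖ ^ 2) / ‖z‖ ^ 2 * ‖dbar α z‖ ^ 2) := by gcongr
        _ = _ := by
          unfold wtN
          have : (1 + ‖z‖ ^ 2) ≠ 0 := by positivity
          have e : ((1 + ‖z‖ ^ 2) ^ (N + 1))⁻¹ * (1 + ‖z‖ ^ 2) = ((1 + ‖z‖ ^ 2) ^ N)⁻¹ := by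
            rw [pow_succ]; field_simp
          rw [← e]; ring
    · rw [dbar_eq_zero_of_notMem hz]; simp
  have hmeas : AEStronglyMeasurable
      (fun z => Real.exp (η z) * ((1 + ‖z‖ ^ 2) / ‖z‖ ^ 2 * ‖dbar α z‖ ^ 2)) volume := by
    have m1 : Measurable η := sη.continuous.measurable
    have m2 : Measurable (dbar α) := hα.dbar.continuous.measurable
    exact Measurable.aestronglyMeasurable (by fun_prop)
  have hi : Integrable fun z => Real.exp (η z) * ((1 + ‖z‖ ^ 2) / ‖z‖ ^ 2 * ‖dbar α z‖ ^ 2) := by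
    refine (hint.const_mul (Real.exp (2 + 2 * T) * 2 ^ M)).mono' hmeas
      (Eventually.of_forall fun z => ?_)
    rw [Real.norm_of_nonneg (by positivity)]
    exact hpt z
  have key := OT hα hαc sη hl hi
  have hI := integral_mono hi (hint.const_mul (Real.exp (2 + 2 * T) * 2 ^ M)) hpt
  rw [integral_const_mul] at hI
  have h0 : Real.exp (2 * φ 0) ≤ Real.exp (2 + 2 * T) * Real.exp (η 0) := by
    rw [← Real.exp_add, Real.exp_le_exp]
    have b1 := (abs_le.1 (hn 0 (Or.inr rfl))).1
    have b2 := (abs_le.1 (hTb n 0)).1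
    simp only [hη, hψ, hLs, mul_zero, LL_zero, norm_zero]
    norm_num
    linarith
  set I := ∫ z, wtN φ N z * ‖dbar α z‖ ^ 2
  have hpi := Real.pi_pos
  calc Real.exp (2 * φ 0) * ‖α 0‖ ^ 2 ≤ Real.exp (2 + 2 * T) * Real.exp (η 0) * ‖α 0‖ ^ 2 := by gcongr
    _ = Real.exp (2 + 2 * T) * (4 / π) * (π / 4 * (Real.exp (η 0) * ‖α 0‖ ^ 2)) := by field_simp
    _ ≤ Real.exp (2 + 2 * T) * (4 / π) * (2 * (Real.exp (2 + 2 * T) * 2 ^ M * I)) := by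
        apply mul_le_mul_of_nonneg_left _ (by positivity)
        linarith
    _ = _ := by
        have : Real.exp (4 + 4 * T) = Real.exp (2 + 2 * T) * Real.exp (2 + 2 * T) := by
          rw [← Real.exp_add]; congr 1; ring
        rw [this]; ring


/-! ### Weyl lemma -/

lemma complex_diff_of_dbar {f : ℂ → ℂ} (hf : Sm f) (h : ∀ z, dbar f z = 0) : Differentiable ℂ f := by
  intro z
  rw [differentiableAt_complex_iff_differentiableAt_real]
  refine ⟨hf.diff z, ?_⟩
  have := h z
  unfold dbar at this
  have h1 : fderiv ℝ f z 1 + Complex.I • fderiv ℝ f z Complex.I = 0 := by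
    simpa using this
  have h2 : Complex.I • (fderiv ℝ f z 1 + Complex.I • fderiv ℝ f z Complex.I) = 0 := by rw [h1]; simp
  rw [smul_add, smul_smul, Complex.I_mul_I] at h2
  simp only [neg_smul, one_smul] at h2
  exact (eq_of_sub_eq_zero (by rw [sub_eq_add_neg]; exact h2)).symm

lemma cv_dbar_zero {f g : ℂ → ℂ} (h0 : ∀ β : ℂ → ℂ, Sm β → HasCompactSupport β →
      ∫ z, f z * dbar β z = 0) (hg : Sm g)
    (hc : HasCompactSupport g) (z : ℂ) : cv volume f (dbar g) z = 0 := by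
  have hs : Sm (fun t => g (z - t)) := hg.comp (contDiff_const.sub contDiff_id)
  have := h0 (fun t => g (z - t)) hs
    (hc.comp_isClosedEmbedding (Homeomorph.subLeft z).isClosedEmbedding)
  have e : ∀ t, dbar (fun t => g (z - t)) t = - dbar g (z - t) := by
    intro t
    have hfd : fderiv ℝ (fun t => g (z - t)) t = - fderiv ℝ g (z - t) := by
      have h1 : HasFDerivAt (fun t : ℂ => z - t) (-(ContinuousLinearMap.id ℝ ℂ)) t :=
        (hasFDerivAt_id t).const_sub z
      have := ((hg.diff (z - t)).hasFDerivAt.comp t h1).fderiv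
      change fderiv ℝ (g ∘ fun t => z - t) t = _
      rw [this]; ext; simp
    unfold dbar
    rw [hfd]
    simp only [neg_apply, smul_neg]; ring
  simp only [e, mul_neg, integral_neg, neg_eq_zero] at this
  exact this

lemma cv_int {f g : ℂ → ℂ} (hf : LocallyIntegrable f volume) (hg : Continuous g)
    (hc : HasCompactSupport g) (z : ℂ) : Integrable (fun t => f t * g (z - t)) := by
  have hcc : HasCompactSupport (fun t => g (z - t)) :=
    hc.comp_isClosedEmbedding (Homeomorph.subLeft z).isClosedEmbedding
  have := hf.integrable_smul_right_of_hasCompactSupport (hg.comp (by fun_prop : Continuous fun t => z - t)) hcc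
  simpa [smul_eq_mul] using this

lemma dbar_cv {f g : ℂ → ℂ} (hf : LocallyIntegrable f volume) (hg : Sm g)
    (hc : HasCompactSupport g) (z : ℂ) : dbar (cv volume f g) z = cv volume f (dbar g) z := by
  unfold dbar
  rw [cv_fderiv hf hg hc, cv_fderiv hf hg hc]
  unfold cv
  rw [smul_eq_mul, ← integral_const_mul, ← integral_add, ← integral_div]
  · congr 1; funext t; simp only [smul_eq_mul]; ring
  · exact cv_int hf (hg.pd 1).continuous (hc.fderiv_apply ℝ _) z
  · exact (cv_int hf (hg.pd Complex.I).continuous (hc.fderiv_apply ℝ _) z).const_mul _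

lemma sm_cpt_ofReal {g : ℂ → ℝ} (hc : HasCompactSupport g) :
    HasCompactSupport (fun z => (g z : ℂ)) := hc.comp_left (g := fun x : ℝ => (x : ℂ)) (by simp)

lemma hasCompactSupport_dz {f : ℂ → ℂ} (hc : HasCompactSupport f) :
    HasCompactSupport (dz f) := by
  have h : HasCompactSupport (fun z => fderiv ℝ f z) := hc.fderiv ℝ
  refine h.mono ?_
  intro z hz
  contrapose! hz
  simp only [Function.notMem_support] at hz ⊢
  unfold dz
  rw [hz]; simp

lemma weyl_eq {f : ℂ → ℂ} (hf : LocallyIntegrable f volume)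
    (h0 : ∀ β : ℂ → ℂ, Sm β → HasCompactSupport β → ∫ z, f z * dbar β z = 0) (n : ℕ) (z : ℂ) :
    cv volume f (fun w => (chin n w : ℂ)) z = cv volume f (fun w => (chi w : ℂ)) z := by
  have h := cv_dbar_zero h0 (vn_smooth n).ofReal.dz (hasCompactSupport_dz (sm_cpt_ofReal (vn_cpt n))) z
  have e : ∀ w, dbar (dz fun w => (vn n w : ℂ)) w = (chi w - chin n w : ℂ) / 4 := by
    intro w
    rw [dz_dbar_comm (vn_smooth n).ofReal, dz_dbar_ofReal (vn_smooth n), lap_vn]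
    push_cast; rfl
  unfold cv at h ⊢
  simp only [e] at h
  have h1 := cv_int hf chi_smooth.ofReal.continuous (sm_cpt_ofReal chi_cpt) z
  have h2 := cv_int hf (chin_smooth n).ofReal.continuous (sm_cpt_ofReal (chin_cpt n)) z
  have : ∫ t, f t * ((chi (z - t) - chin n (z - t) : ℂ) / 4) =
      (∫ t, f t * (chi (z - t) : ℂ)) / 4 - (∫ t, f t * (chin n (z - t) : ℂ)) / 4 := by
    rw [← integral_div, ← integral_div, ← integral_sub (h1.div_const _) (h2.div_const _)]
    congr 1; funext t; ring
  rw [this] at h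
  linear_combination (-4) * h

lemma cv_tendsto {f : ℂ → ℂ} (hf : LocallyIntegrable f volume) :
    ∀ᵐ z, Tendsto (fun n => cv volume f (fun w => (chin n w : ℂ)) z) atTop (𝓝 (c0 * f z)) := by
  obtain ⟨C, hC, hb⟩ := chi_bdd
  filter_upwards [(Besicovitch.vitaliFamily (volume : Measure ℂ)).ae_tendsto_average_norm_sub hf]
    with z hz
  have hr : Tendsto (fun n : ℕ => ((1/2 : ℝ)) ^ n) atTop (𝓝[>] 0) := by
    rw [tendsto_nhdsWithin_iff]
    exact ⟨tendsto_pow_atTop_nhds_zero_of_lt_one (by norm_num) (by norm_num),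
      Eventually.of_forall fun n => by simp⟩
  have h1 := hz.comp ((Besicovitch.tendsto_filterAt (volume : Measure ℂ) z).comp hr)
  have h2 : Tendsto (fun n : ℕ => C * π * ⨍ y in closedBall z ((1/2) ^ n), ‖f y - f z‖) atTop (𝓝 0) := by
    have := h1.const_mul (C * π)
    rwa [mul_zero] at this
  rw [tendsto_iff_norm_sub_tendsto_zero]
  refine squeeze_zero (fun n => norm_nonneg _) (fun n => ?_) h2
  have hi := cv_int hf (chin_smooth n).ofReal.continuous (sm_cpt_ofReal (chin_cpt n)) z
  have hi2 : Integrable (fun t => f z * (chin n (z - t) : ℂ)) :=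
    ((((chin_smooth n).continuous.integrable_of_hasCompactSupport (chin_cpt n)).comp_sub_left z).ofReal).const_mul _
  have e1 : (c0 : ℂ) * f z = ∫ t, f z * (chin n (z - t) : ℂ) := by
    rw [integral_const_mul, integral_complex_ofReal, integral_sub_left_eq_self, chin_integral, mul_comm]
  have e2 : cv volume f (fun w => (chin n w : ℂ)) z - c0 * f z
      = ∫ t in closedBall z ((1/2)^n), (f t - f z) * (chin n (z - t) : ℂ) := by
    rw [e1]
    unfold cv
    rw [← integral_sub hi hi2, setIntegral_eq_integral_of_forall_compl_eq_zero]
    · congr 1; funext t; ring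
    · intro t ht
      simp only [mem_closedBall, not_le, dist_eq_norm] at ht
      rw [chin_eq_zero]; · simp
      rw [norm_sub_rev]
      have : (2:ℝ)^n * (1/2)^n = 1 := by rw [← mul_pow]; norm_num
      rw [← this]; gcongr
  rw [e2]
  have hI : IntegrableOn (fun t => ‖f t - f z‖) (closedBall z ((1/2)^n)) :=
    ((hf.sub (locallyIntegrable_const (f z))).integrableOn_isCompact (isCompact_closedBall _ _)).norm
  calc _ ≤ ∫ t in closedBall z ((1/2)^n), (C * 4 ^ n) * ‖f t - f z‖ := by
        apply norm_integral_le_of_norm_le (hI.const_mul _)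
        refine Eventually.of_forall fun t => ?_
        rw [norm_mul, Complex.norm_real, Real.norm_of_nonneg (chin_nonneg _ _), mul_comm]
        gcongr
        unfold chin
        rw [mul_comm]; gcongr; exact hb _
    _ = _ := by
        rw [integral_const_mul, setAverage_eq]
        have hv : volume.real (closedBall z ((1/2:ℝ)^n)) = π * ((1/2)^n)^2 := by
          rw [measureReal_def, Complex.volume_closedBall]
          simp
          ring
        rw [hv]
        have : ((1/2:ℝ)^n)^2 = (4^n)⁻¹ := by
          rw [← pow_mul, mul_comm, pow_mul, ← inv_pow]; norm_num
        rw [this, smul_eq_mul]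
        have := Real.pi_pos
        field_simp

lemma weyl {f : ℂ → ℂ} (hf : LocallyIntegrable f volume)
    (h0 : ∀ β : ℂ → ℂ, Sm β → HasCompactSupport β → ∫ z, f z * dbar β z = 0) :
    ∃ F : ℂ → ℂ, Differentiable ℂ F ∧ f =ᵐ[volume] F ∧ c0 * F 0 = ∫ z, f z * (chi z : ℂ) := by
  have hc := c0_pos
  have hc' : (c0 : ℂ) ≠ 0 := by exact_mod_cast hc.ne'
  have hs := chi_smooth.ofReal
  have hcc := sm_cpt_ofReal chi_cpt
  refine ⟨fun z => (c0 : ℂ)⁻¹ * cv volume f (fun w => (chi w : ℂ)) z, ?_, ?_, ?_⟩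
  · refine (complex_diff_of_dbar (cv_smooth hf hs hcc) fun z => ?_).const_mul _
    rw [dbar_cv hf hs hcc]
    exact cv_dbar_zero h0 hs hcc z
  · filter_upwards [cv_tendsto hf] with z hz
    simp only [weyl_eq hf h0] at hz
    have := tendsto_nhds_unique hz tendsto_const_nhds
    rw [← this]; field_simp
  · rw [← mul_assoc, mul_inv_cancel₀ hc', one_mul]
    unfold cv
    congr 1; funext t
    have : chi (0 - t) = chi t := by unfold chi; simp
    simp only [this]


/-! ### Duality: existence of entire functions -/

lemma riesz_gen {V H : Type*} [AddCommGroup V] [Module ℂ V] [NormedAddCommGroup H]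
    [InnerProductSpace ℂ H] [CompleteSpace H] (T : V →ₗ[ℂ] H) (ev : V →ₗ[ℂ] ℂ) {K : ℝ} (hK : 0 ≤ K)
    (h : ∀ v, ‖ev v‖ ≤ K * ‖T v‖) : ∃ y : H, ‖y‖ ≤ K ∧ ∀ v, inner ℂ y (T v) = ev v := by
  obtain ⟨σ, hσ⟩ := LinearMap.exists_rightInverse_of_surjective T.rangeRestrict T.range_rangeRestrict
  have hσ' : ∀ x : LinearMap.range T, T (σ x) = x := fun x => by
    have := LinearMap.congr_fun hσ x
    exact congrArg Subtype.val this
  let g0 : LinearMap.range T →ₗ[ℂ] ℂ := ev.comp σ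
  let g1 : LinearMap.range T →L[ℂ] ℂ := g0.mkContinuous K (fun x => by
    have := h (σ x)
    rw [hσ'] at this
    exact this)
  obtain ⟨g, hg, hgn⟩ := exists_extension_norm_eq (LinearMap.range T) g1
  refine ⟨(InnerProductSpace.toDual ℂ H).symm g, ?_, fun v => ?_⟩
  · rw [LinearIsometryEquiv.norm_map, hgn]
    exact LinearMap.mkContinuous_norm_le _ hK _
  · rw [InnerProductSpace.toDual_symm_apply]
    have := hg ⟨T v, LinearMap.mem_range_self T v⟩
    rw [this]
    change ev (σ ⟨T v, _⟩) = ev v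
    have h2 := h (σ ⟨T v, LinearMap.mem_range_self T v⟩ - v)
    rw [map_sub, map_sub, hσ'] at h2
    simp only [sub_self, norm_zero, mul_zero] at h2
    exact eq_of_sub_eq_zero (norm_le_zero_iff.1 h2)

def swt (φ : ℂ → ℝ) (N : ℕ) (z : ℂ) : ℝ :=
  Real.exp (φ z) * (‖z‖⁻¹ * (Real.sqrt ((1 + ‖z‖ ^ 2) ^ N))⁻¹)

lemma swt_sq (φ : ℂ → ℝ) (N : ℕ) (z : ℂ) : swt φ N z ^ 2 = wtN φ N z := by
  unfold swt wtN
  rw [mul_pow, mul_pow, inv_pow, inv_pow, Real.sq_sqrt (by positivity), ← Real.exp_nat_mul]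
  norm_num

lemma swt_nonneg (φ : ℂ → ℝ) (N : ℕ) (z : ℂ) : 0 ≤ swt φ N z := by unfold swt; positivity

lemma swt_meas {φ : ℂ → ℝ} (h : Continuous φ) (N : ℕ) : Measurable (swt φ N) := by
  have := h.measurable
  unfold swt; fun_prop

lemma swt_mul (φ : ℂ → ℝ) (N : ℕ) (z : ℂ) :
    swt φ N z * ‖z‖ ≤ Real.exp (φ z) * (Real.sqrt ((1 + ‖z‖ ^ 2) ^ N))⁻¹ := by
  unfold swt
  by_cases h : ‖z‖ = 0
  · rw [h, mul_zero]; positivity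
  · apply le_of_eq; field_simp

lemma swt_test {φ : ℂ → ℝ} (h : Continuous φ) (N : ℕ) {β : ℂ → ℂ} (hβ : Continuous β)
    (hc : HasCompactSupport β) : MemLp (fun z => (swt φ N z : ℂ) * (z * β z)) 2 volume := by
  have hcont : Continuous fun z => Real.exp (φ z) * (Real.sqrt ((1 + ‖z‖ ^ 2) ^ N))⁻¹ := by
    refine (Real.continuous_exp.comp h).mul (Continuous.inv₀ (by fun_prop) fun z => ?_)
    positivity
  have h2 : MemLp (fun z => ((Real.exp (φ z) * (Real.sqrt ((1 + ‖z‖ ^ 2) ^ N))⁻¹ : ℝ) : ℂ) * β z) 2 volume :=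
    Continuous.memLp_of_hasCompactSupport ((Complex.continuous_ofReal.comp hcont).mul hβ) hc.mul_left
  refine h2.mono ?_ (Eventually.of_forall fun z => ?_)
  · have := swt_meas h N
    have := hβ.measurable
    exact Measurable.aestronglyMeasurable (by fun_prop)
  · rw [norm_mul, norm_mul, norm_mul, Complex.norm_real, Complex.norm_real, ← mul_assoc,
      Real.norm_of_nonneg (swt_nonneg _ _ _), Real.norm_of_nonneg (by positivity)]
    exact mul_le_mul_of_nonneg_right (swt_mul φ N z) (norm_nonneg _)

def VV (φ : ℂ → ℝ) (N : ℕ) : Submodule ℂ (ℂ → ℂ) where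
  carrier := {α | Sm α ∧ HasCompactSupport α ∧ MemLp (fun z => (swt φ N z : ℂ) * dbar α z) 2 volume}
  add_mem' := by
    rintro a b ⟨h1, h2, h3⟩ ⟨h4, h5, h6⟩
    refine ⟨h1.add h4, h2.add h5, ?_⟩
    convert h3.add h6 using 1
    funext z
    simp only [Pi.add_apply]
    rw [← mul_add]; congr 1
    unfold dbar
    rw [fderiv_add (h1.diff z) (h4.diff z)]
    simp only [add_apply, smul_eq_mul]; ring
  zero_mem' := by
    refine ⟨contDiff_const, HasCompactSupport.zero, ?_⟩
    have hz : (fun z => (swt φ N z : ℂ) * dbar 0 z) = fun _ => (0:ℂ) := by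
     funext z
     have : (0 : ℂ → ℂ) = fun _ => 0 := rfl
     rw [this]
     unfold dbar
     simp
    rw [hz]
    exact MemLp.zero' 
  smul_mem' := by
    rintro c a ⟨h1, h2, h3⟩
    refine ⟨contDiff_const.mul h1, h2.comp_left (g := fun x => c * x) (by simp), ?_⟩
    convert h3.const_mul c using 1
    funext z
    have : dbar (c • a) z = c * dbar a z := by
      unfold dbar
      rw [fderiv_const_smul (h1.diff z)]
      simp only [smul_apply, smul_eq_mul]; ring
    rw [this]; ring

lemma VV_dbar_add {φ : ℂ → ℝ} {N : ℕ} (a b : VV φ N) (z : ℂ) :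
    dbar ((a + b : VV φ N) : ℂ → ℂ) z = dbar a.1 z + dbar b.1 z := by
  unfold dbar
  rw [Submodule.coe_add, fderiv_add (a.2.1.diff z) (b.2.1.diff z)]
  simp only [add_apply, smul_eq_mul]; ring

lemma VV_dbar_smul {φ : ℂ → ℝ} {N : ℕ} (c : ℂ) (a : VV φ N) (z : ℂ) :
    dbar ((c • a : VV φ N) : ℂ → ℂ) z = c * dbar a.1 z := by
  unfold dbar
  rw [Submodule.coe_smul, fderiv_const_smul (a.2.1.diff z)]
  simp only [smul_apply, smul_eq_mul]; ring

def TT (φ : ℂ → ℝ) (N : ℕ) : VV φ N →ₗ[ℂ] Lp ℂ 2 (volume : Measure ℂ) where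
  toFun a := a.2.2.2.toLp _
  map_add' a b := by
    rw [← MemLp.toLp_add]
    congr 1; funext z
    simp only [Pi.add_apply, VV_dbar_add]; ring
  map_smul' c a := by
    rw [RingHom.id_apply, ← MemLp.toLp_const_smul]
    congr 1; funext z
    simp only [Pi.smul_apply, VV_dbar_smul, smul_eq_mul]; ring

def evV (φ : ℂ → ℝ) (N : ℕ) : VV φ N →ₗ[ℂ] ℂ where
  toFun a := a.1 0
  map_add' a b := rfl
  map_smul' c a := rfl

lemma memLp_two_sq {g : ℂ → ℂ} (h : MemLp g 2 volume) :
    Integrable (fun z => ‖g z‖ ^ 2) ∧ ∫ z, ‖g z‖ ^ 2 = ‖h.toLp g‖ ^ 2 := by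
  have hi : Integrable (fun z => ‖g z‖ ^ 2) := (memLp_two_iff_integrable_sq_norm h.1).1 h
  refine ⟨hi, ?_⟩
  have h1 := inner_self_eq_norm_sq_to_K (𝕜 := ℂ) (h.toLp g)
  rw [L2.inner_def] at h1
  have h2 : ∫ a, inner ℂ ((h.toLp g : ℂ → ℂ) a) ((h.toLp g : ℂ → ℂ) a) = ((∫ z, ‖g z‖ ^ 2 : ℝ) : ℂ) := by
    rw [← integral_complex_ofReal]
    apply integral_congr_ae
    filter_upwards [h.coeFn_toLp] with z hz
    rw [hz, inner_self_eq_norm_sq_to_K]; norm_cast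
  rw [h2] at h1
  apply Complex.ofReal_injective
  rw [h1]; push_cast; rfl

lemma exists_L2 {C : ℝ} (hC : 1 ≤ C) (N : ℕ) : ∃ m0 > 0, ∀ A : ℝ, ∃ K > 0, ∀ (φ : ℂ → ℝ) (μ : Measure ℂ),
    DL φ μ C → m0 ≤ μ.real (ball 0 1) → μ.real (ball 0 1) ≤ A →
    ∃ F : ℂ → ℂ, Differentiable ℂ F ∧ F 0 = 1 ∧
      ∫⁻ z, ENNReal.ofReal (‖F z‖ ^ 2 * Real.exp (-(2 * φ z)) * (1 + ‖z‖ ^ 2) ^ N)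
        ≤ ENNReal.ofReal (K * Real.exp (-(2 * φ 0))) := by
  obtain ⟨m0, hm0, H⟩ := dual_ineq hC N
  refine ⟨m0, hm0, fun A => ?_⟩
  obtain ⟨K, hK, H⟩ := H A
  refine ⟨(c0 / 2) ^ 2 * K, by have := c0_pos; positivity, fun φ μ h hm hA => ?_⟩
  have HH := H φ μ h hm hA
  have hc0 := c0_pos
  have hφ := h.cont
  obtain ⟨y, hyn, hy⟩ := riesz_gen (TT φ N) (evV φ N) (K := Real.sqrt K * Real.exp (-φ 0)) (by positivity) (by
    rintro ⟨α, h1, h2, h3⟩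
    change ‖α 0‖ ≤ _ * ‖h3.toLp _‖
    obtain ⟨hi, he⟩ := memLp_two_sq h3
    have e : ∀ z, ‖(swt φ N z : ℂ) * dbar α z‖ ^ 2 = wtN φ N z * ‖dbar α z‖ ^ 2 := by
      intro z
      rw [norm_mul, mul_pow, Complex.norm_real, Real.norm_of_nonneg (swt_nonneg _ _ _), swt_sq]
    simp only [e] at hi he
    have := HH α h1 h2 hi
    rw [he] at this
    apply abs_le_of_sq_le_sq' _ (by positivity) |>.2
    rw [mul_pow, mul_pow, Real.sq_sqrt hK.le]
    have e2 : Real.exp (2 * φ 0) * (Real.exp (-φ 0)) ^ 2 = 1 := by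
      rw [← Real.exp_nat_mul, ← Real.exp_add]; simp
    calc ‖α 0‖ ^ 2 = Real.exp (2 * φ 0) * ‖α 0‖ ^ 2 * (Real.exp (-φ 0)) ^ 2 := by
          linear_combination (-‖α 0‖ ^ 2) * e2
      _ ≤ (K * ‖h3.toLp _‖ ^ 2) * (Real.exp (-φ 0)) ^ 2 := by gcongr
      _ = _ := by ring)
  have hy' : ∀ α : ℂ → ℂ, Sm α → HasCompactSupport α → MemLp (fun z => (swt φ N z : ℂ) * dbar α z) 2 volume →
      ∫ z, starRingEnd ℂ (y z) * (swt φ N z * dbar α z) = α 0 := by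
    intro α h1 h2 h3
    have := hy ⟨α, h1, h2, h3⟩
    rw [L2.inner_def] at this
    rw [show α 0 = evV φ N ⟨α, h1, h2, h3⟩ from rfl, ← this]
    apply integral_congr_ae
    have e : (TT φ N) ⟨α, h1, h2, h3⟩ = h3.toLp _ := rfl
    rw [e]
    filter_upwards [h3.coeFn_toLp] with z hz
    rw [hz]; simp [mul_comm]
  set f : ℂ → ℂ := fun z => z * (swt φ N z) * starRingEnd ℂ (y z) with hf
  have hcont : Continuous fun z => Real.exp (φ z) * (Real.sqrt ((1 + ‖z‖ ^ 2) ^ N))⁻¹ := by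
    refine (Real.continuous_exp.comp hφ).mul (Continuous.inv₀ (by fun_prop) fun z => ?_)
    positivity
  have hym : MemLp y 2 volume := Lp.memLp y
  have hyl : LocallyIntegrable y volume := hym.locallyIntegrable (by norm_num)
  have hfl : LocallyIntegrable f volume := by
    have h1 : LocallyIntegrable (fun z => ((Real.exp (φ z) * (Real.sqrt ((1 + ‖z‖ ^ 2) ^ N))⁻¹ : ℝ) : ℂ) * y z) volume := by
      rw [← locallyIntegrableOn_univ] at hyl ⊢
      exact hyl.continuousOn_mul (Complex.continuous_ofReal.comp hcont).continuousOn isOpen_univ.isLocallyClosed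
    refine h1.mono ?_ (Eventually.of_forall fun z => ?_)
    · have := swt_meas hφ N
      refine AEStronglyMeasurable.mul (Measurable.aestronglyMeasurable (by fun_prop)) ?_
      exact Complex.continuous_conj.comp_aestronglyMeasurable hym.1
    · rw [hf, norm_mul, norm_mul, norm_mul, Complex.norm_real, Complex.norm_real, RCLike.norm_conj,
        Real.norm_of_nonneg (swt_nonneg _ _ _), Real.norm_of_nonneg (by positivity), mul_comm ‖z‖]
      exact mul_le_mul_of_nonneg_right (swt_mul φ N z) (norm_nonneg _)
  have hf0 : ∀ β : ℂ → ℂ, Sm β → HasCompactSupport β → ∫ z, f z * dbar β z = 0 := by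
    intro β h1 h2
    have hd : ∀ z, dbar (fun w => w * β w) z = z * dbar β z := by
      intro z
      rw [dbar_mul (f := fun w => w) differentiableAt_id (h1.diff z), dbar_id]; simp
    have := hy' (fun z => z * β z) (contDiff_id.mul h1) h2.mul_left (by
      simp only [hd]
      exact swt_test hφ N h1.dbar.continuous (hasCompactSupport_dbar h2))
    rw [zero_mul] at this
    rw [← this]
    congr 1; funext z
    rw [hd]; simp only [hf]; ring
  have hnorm : ∫ z, f z * (chi z : ℂ) = -2 := by
    have s1 : Sm (fun z : ℂ => ((fun t => 1 - aa t) (‖z‖ ^ 2))) :=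
      Sm_radial (h := fun t => 1 - aa t) (contDiff_const.sub aa_smooth)
    have hd : ∀ z : ℂ, dbar (fun z : ℂ => (((fun t => 1 - aa t) (‖z‖ ^ 2) : ℝ) : ℂ)) z = z * (-(chi z : ℂ) / 2) := by
      intro z
      have hdf : DifferentiableAt ℝ aa (‖z‖ ^ 2) := (aa_smooth.differentiable (by simp)) _
      rw [dbar_radial (h := fun t => 1 - aa t) (by fun_prop), deriv_const_sub]
      unfold chi; push_cast; ring
    have := hy' _ s1.ofReal
      (sm_cpt_ofReal (HasCompactSupport.intro (isCompact_closedBall (0:ℂ) 1) fun z hz => by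
        simp at hz
        have : aa (‖z‖ ^ 2) = 1 := aa_one (by nlinarith)
        simp [this])) (by
      simp only [hd]
      refine swt_test hφ N ?_ ?_
      · exact (chi_smooth.ofReal.continuous.neg).div_const 2
      · exact (sm_cpt_ofReal chi_cpt).comp_left (g := fun x => -x/2) (by simp))
    simp only [hd] at this
    have a0 : aa (‖(0:ℂ)‖ ^ 2) = 0 := aa_zero (by norm_num)
    rw [a0] at this
    have e : ∀ z, starRingEnd ℂ (y z) * (swt φ N z * (z * (-(chi z : ℂ) / 2))) = (-1/2) * (f z * (chi z : ℂ)) := by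
      intro z; simp only [hf]; ring
    simp only [e, integral_const_mul] at this
    push_cast at this
    linear_combination (-2) * this
  obtain ⟨F, hF, hfF, hF0⟩ := weyl hfl hf0
  rw [hnorm] at hF0
  have hcc : (c0 : ℂ) ≠ 0 := by exact_mod_cast hc0.ne'
  refine ⟨fun z => (-(c0 : ℂ) / 2) * F z, hF.const_mul _, ?_, ?_⟩
  · linear_combination (-1/2) * hF0
  · have hyI := memLp_two_sq hym
    have : (hym.toLp y) = y := Lp.toLp_coeFn y hym
    rw [this] at hyI
    calc _ ≤ ∫⁻ z, ENNReal.ofReal ((c0/2)^2 * ‖y z‖ ^ 2) := by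
          apply lintegral_mono_ae
          have hz0 : ∀ᵐ z : ℂ, z ≠ 0 := by
            simp [ae_iff, measure_singleton]
          filter_upwards [hfF, hz0] with z hz hz0
          apply ENNReal.ofReal_le_ofReal
          rw [norm_mul, ← hz, norm_div, norm_neg, Complex.norm_real, Real.norm_of_nonneg hc0.le]
          simp only [hf, norm_mul, RCLike.norm_conj, Complex.norm_real, Real.norm_of_nonneg (swt_nonneg _ _ _), mul_pow, swt_sq]
          unfold wtN
          have hzn : 0 < ‖z‖ := norm_pos_iff.2 hz0
          have e2 : Real.exp (2 * φ z) * Real.exp (-(2 * φ z)) = 1 := by rw [← Real.exp_add]; simp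
          apply le_of_eq
          have : ‖(2:ℂ)‖ = 2 := by norm_num
          rw [this]
          calc _ = (c0/2)^2 * ‖y z‖^2 * (Real.exp (2 * φ z) * Real.exp (-(2 * φ z))) * ((‖z‖^2) * (‖z‖^2)⁻¹) * (((1 + ‖z‖ ^ 2) ^ N) * ((1 + ‖z‖ ^ 2) ^ N)⁻¹) := by ring
            _ = _ := by
              rw [e2, mul_inv_cancel₀ (by positivity), mul_inv_cancel₀ (by positivity)]; ring
      _ = ENNReal.ofReal ((c0/2)^2 * ‖y‖ ^ 2) := by
          rw [← ofReal_integral_eq_lintegral_ofReal (hyI.1.const_mul _) (Eventually.of_forall fun z => by positivity),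
            integral_const_mul, hyI.2]
      _ ≤ _ := by
          apply ENNReal.ofReal_le_ofReal
          rw [mul_assoc]
          gcongr
          calc ‖y‖ ^ 2 ≤ (Real.sqrt K * Real.exp (-φ 0)) ^ 2 := by gcongr
            _ = _ := by
              rw [mul_pow, Real.sq_sqrt hK.le, ← Real.exp_nat_mul]
              congr 2; push_cast; ring


/-! ### Growth of the measure, pointwise peak functions -/

lemma DL.grow {φ : ℂ → ℝ} {μ : Measure ℂ} {C : ℝ} (h : DL φ μ C) (z : ℂ) {r : ℝ} (hr : 0 < r) :
    (1 + 1 / C ^ 3) * μ.real (ball z r) ≤ μ.real (ball z (4 * r)) := by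
  have h1 := h.rev z hr
  have hC : 1 ≤ C ^ 3 := one_le_pow₀ h.one_le
  have hm : 0 ≤ μ.real (ball z r) := measureReal_nonneg
  have hM : μ.real (ball z r) ≤ μ.real (ball z (4 * r)) := h.real_mono (ball_subset_ball (by linarith))
  set a := C ^ 3
  set m := μ.real (ball z r)
  set M := μ.real (ball z (4 * r))
  have : (a + 1) * m ≤ a * M := by
    nlinarith
  have ha : 0 < a := by linarith
  have e : (1 + 1 / a) * m = ((a + 1) * m) / a := by field_simp
  rw [e, div_le_iff₀ ha]; linarith

lemma DL.grow_pow {φ : ℂ → ℝ} {μ : Measure ℂ} {C : ℝ} (h : DL φ μ C) (z : ℂ) {r : ℝ} (hr : 0 < r) (k : ℕ) :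
    (1 + 1 / C ^ 3) ^ k * μ.real (ball z r) ≤ μ.real (ball z (4 ^ k * r)) := by
  have hC : 1 ≤ C ^ 3 := one_le_pow₀ h.one_le
  induction k with
  | zero => simp
  | succ k ih =>
    have := h.grow z (r := 4 ^ k * r) (by positivity)
    calc _ = (1 + 1 / C ^ 3) * ((1 + 1 / C ^ 3) ^ k * μ.real (ball z r)) := by ring
      _ ≤ (1 + 1 / C ^ 3) * μ.real (ball z (4 ^ k * r)) := by gcongr
      _ ≤ _ := by rw [pow_succ (4:ℝ) k, mul_comm ((4:ℝ)^k) 4, mul_assoc]; exact this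

lemma small_ball {C : ℝ} (hC : 1 ≤ C) : ∃ J : ℕ, ∀ (φ : ℂ → ℝ) (μ : Measure ℂ), DL φ μ C →
    ∀ (z0 z : ℂ) (R : ℝ), 0 < R → ∀ i : ℕ, ‖z - z0‖ + R ≤ 2 ^ i * R →
    μ.real (ball z (R / 4 ^ (i * J))) ≤ μ.real (ball z0 R) := by
  have hC3 : 1 ≤ C ^ 3 := one_le_pow₀ hC
  have hq : 1 < 1 + 1 / C ^ 3 := by
    have : 0 < 1 / C ^ 3 := by positivity
    linarith
  obtain ⟨J, hJ⟩ := pow_unbounded_of_one_lt C hq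
  refine ⟨J, fun φ μ h z0 z R hR i hi => ?_⟩
  have h1 := h.grow_pow z (r := R / 4 ^ (i * J)) (by positivity) (i * J)
  rw [mul_div_cancel₀ _ (by positivity)] at h1
  have h2 : μ.real (ball z R) ≤ μ.real (ball z0 (2 ^ i * R)) := by
    apply h.real_mono
    apply ball_subset_ball'
    rw [dist_eq_norm]; linarith
  have h3 := h.dbl_pow z0 hR i
  have h4 : C ^ i ≤ (1 + 1 / C ^ 3) ^ (i * J) := by
    rw [mul_comm, pow_mul]; gcongr
  have hm : 0 ≤ μ.real (ball z (R / 4 ^ (i * J))) := measureReal_nonneg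
  have hCi : 0 < C ^ i := by positivity
  have h5 : C ^ i * μ.real (ball z (R / 4 ^ (i * J))) ≤ C ^ i * μ.real (ball z0 R) :=
    (mul_le_mul_of_nonneg_right h4 hm).trans (h1.trans (h2.trans h3))
  exact le_of_mul_le_mul_left h5 hCi

lemma near_pow {x : ℝ} (hx : 1 ≤ x) : ∃ i : ℕ, x ≤ 2 ^ i ∧ (2:ℝ) ^ i ≤ 2 * x := by
  obtain ⟨n, h1, h2⟩ := exists_nat_pow_near hx (by norm_num : (1:ℝ) < 2)
  exact ⟨n + 1, h2.le, by rw [pow_succ]; linarith⟩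

lemma peak_unit {C : ℝ} (hC : 1 ≤ C) (N : ℕ) : ∃ m0 > 0, ∀ A : ℝ, ∃ K > 0, ∀ (φ : ℂ → ℝ) (μ : Measure ℂ),
    DL φ μ C → m0 ≤ μ.real (ball 0 1) → μ.real (ball 0 1) ≤ A →
    ∃ F : ℂ → ℂ, Differentiable ℂ F ∧ F 0 = 1 ∧
      ∀ w, ‖F w‖ * Real.exp (-φ w) ≤ K * Real.exp (-φ 0) * ((1 + ‖w‖) ^ N)⁻¹ := by
  obtain ⟨J, hJ⟩ := small_ball hC
  obtain ⟨m0, hm0, H⟩ := exists_L2 hC (N + 2 * J)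
  refine ⟨m0, hm0, fun A => ?_⟩
  obtain ⟨K, hK, H⟩ := H A
  obtain ⟨KL, hKL, HL⟩ := LM (A := A) (p := 2) (by norm_num) hC
  set N' := N + 2 * J with hN'
  set K1 := KL * 2 ^ (4 * J) * 6 ^ N' * K with hK1
  refine ⟨Real.sqrt K1, by positivity, fun φ μ h hm hA => ?_⟩
  obtain ⟨F, hF, hF0, hFI⟩ := H φ μ h hm hA
  refine ⟨F, hF, hF0, fun w => ?_⟩
  obtain ⟨i, hi1, hi2⟩ := near_pow (x := 1 + ‖w‖) (by linarith [norm_nonneg w])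
  have hsb := hJ φ μ h 0 w 1 one_pos i (by simpa [add_comm] using hi1)
  set r : ℝ := 1 / 4 ^ (i * J) with hr
  have hr0 : 0 < r := by positivity
  have hr1 : r ≤ 1 := by
    rw [hr, div_le_one (by positivity)]
    exact one_le_pow₀ (by norm_num)
  have h1 := HL φ μ h F hF w r hr0 (hsb.trans hA)
  have h2 : ∫⁻ z in ann w r, ENNReal.ofReal (‖F z‖ ^ (2:ℝ) * Real.exp (-(2 * φ z))) ≤
      ENNReal.ofReal (3 ^ N' * ((1 + ‖w‖ ^ 2) ^ N')⁻¹) * ENNReal.ofReal (K * Real.exp (-(2 * φ 0))) := by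
    calc _ ≤ ∫⁻ z in ann w r, ENNReal.ofReal (3 ^ N' * ((1 + ‖w‖ ^ 2) ^ N')⁻¹) *
          ENNReal.ofReal (‖F z‖ ^ 2 * Real.exp (-(2 * φ z)) * (1 + ‖z‖ ^ 2) ^ N') := by
          apply setLIntegral_mono_ae' (ann_meas w r)
          refine Eventually.of_forall fun z hz => ?_
          rw [← ENNReal.ofReal_mul (by positivity)]
          apply ENNReal.ofReal_le_ofReal
          rw [Real.rpow_two]
          have hz1 : ‖w‖ ≤ ‖z‖ + 1 := by
            have := norm_sub_norm_le w z
            rw [norm_sub_rev] at this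
            have := hz.2
            linarith
          have hle : (1 + ‖w‖ ^ 2) ≤ 3 * (1 + ‖z‖ ^ 2) := by
            have : ‖w‖ ^ 2 ≤ (‖z‖ + 1) ^ 2 := by gcongr
            nlinarith [sq_nonneg (‖z‖ - 1)]
          have hle2 : (1 + ‖w‖ ^ 2) ^ N' ≤ 3 ^ N' * (1 + ‖z‖ ^ 2) ^ N' := by
            rw [← mul_pow]; gcongr
          have hp : 0 < (1 + ‖w‖ ^ 2) ^ N' := by positivity
          have : 1 ≤ 3 ^ N' * ((1 + ‖w‖ ^ 2) ^ N')⁻¹ * (1 + ‖z‖ ^ 2) ^ N' := by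
            rw [mul_right_comm, ← div_eq_mul_inv, le_div_iff₀ hp, one_mul]; exact hle2
          calc _ = ‖F z‖ ^ 2 * Real.exp (-(2 * φ z)) * 1 := by ring
            _ ≤ ‖F z‖ ^ 2 * Real.exp (-(2 * φ z)) * (3 ^ N' * ((1 + ‖w‖ ^ 2) ^ N')⁻¹ * (1 + ‖z‖ ^ 2) ^ N') := by gcongr
            _ = _ := by ring
      _ = ENNReal.ofReal (3 ^ N' * ((1 + ‖w‖ ^ 2) ^ N')⁻¹) * ∫⁻ z in ann w r,
          ENNReal.ofReal (‖F z‖ ^ 2 * Real.exp (-(2 * φ z)) * (1 + ‖z‖ ^ 2) ^ N') :=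
          lintegral_const_mul' _ _ ENNReal.ofReal_ne_top
      _ ≤ _ := by
          gcongr
          exact (setLIntegral_le_lintegral _ _).trans hFI
  have h3 := h1.trans (mul_le_mul_right h2 _)
  rw [← ENNReal.ofReal_mul (by positivity), ← ENNReal.ofReal_mul (by positivity),
    ENNReal.ofReal_le_ofReal_iff (by positivity), Real.rpow_two] at h3
  have hw : 0 < 1 + ‖w‖ := by positivity
  have h4 : KL / r ^ 2 ≤ KL * (2 ^ (4 * J) * (1 + ‖w‖) ^ (4 * J)) := by
    have e : 1 / r ^ 2 = ((2:ℝ) ^ i) ^ (4 * J) := by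
      have : (4:ℝ) ^ (i * J) = (2 ^ i) ^ (2 * J) := by
        rw [show (4:ℝ) = 2 ^ 2 by norm_num, ← pow_mul, ← pow_mul]; congr 1; ring
      rw [hr, this, one_div, one_div, inv_pow, inv_inv]
      set x : ℝ := 2 ^ i
      rw [← pow_mul]; congr 1; ring
    rw [div_eq_mul_one_div, e, ← mul_pow]
    gcongr
  have h5 : ((1 + ‖w‖ ^ 2) ^ N')⁻¹ ≤ 2 ^ N' * ((1 + ‖w‖) ^ (2 * N'))⁻¹ := by
    have : (1 + ‖w‖) ^ (2 * N') ≤ 2 ^ N' * (1 + ‖w‖ ^ 2) ^ N' := by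
      rw [pow_mul, ← mul_pow]
      gcongr
      nlinarith [sq_nonneg (‖w‖ - 1)]
    rw [← div_eq_mul_inv, le_div_iff₀ (by positivity), inv_mul_le_iff₀ (by positivity)]
    linarith
  have h6 : ‖F w‖ ^ 2 * Real.exp (-(2 * φ w)) ≤ K1 * Real.exp (-(2 * φ 0)) * ((1 + ‖w‖) ^ (2 * N))⁻¹ := by
    calc _ ≤ _ := h3
      _ ≤ KL * (2 ^ (4 * J) * (1 + ‖w‖) ^ (4 * J)) * (3 ^ N' * (2 ^ N' * ((1 + ‖w‖) ^ (2 * N'))⁻¹) * (K * Real.exp (-(2 * φ 0)))) := by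
        gcongr
      _ = _ := by
        have e : (1 + ‖w‖) ^ (2 * N') = (1 + ‖w‖) ^ (2 * N) * (1 + ‖w‖) ^ (4 * J) := by
          rw [← pow_add]; congr 1; rw [hN']; ring
        have e6 : (6:ℝ) ^ N' = 3 ^ N' * 2 ^ N' := by rw [← mul_pow]; norm_num
        rw [e, hK1, e6]
        field_simp
  apply abs_le_of_sq_le_sq' _ (by positivity) |>.2
  rw [mul_pow, mul_pow, mul_pow, Real.sq_sqrt (by positivity), ← Real.exp_nat_mul, ← Real.exp_nat_mul, inv_pow, ← pow_mul]
  have ee : ∀ x : ℝ, ((2:ℕ):ℝ) * -x = -(2 * x) := fun x => by push_cast; ring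
  rw [ee, ee, mul_comm N 2]
  exact h6

lemma peak {φ : ℂ → ℝ} {μ : Measure ℂ} {C : ℝ} (h : DL φ μ C) {ρ : ℂ → ℝ} (hρ : IsRadius μ ρ) (N : ℕ) :
    ∃ K > 0, ∀ z0, ∃ F : ℂ → ℂ, Differentiable ℂ F ∧ F z0 = 1 ∧
      ∀ z, ‖F z‖ * Real.exp (-φ z) ≤ K * Real.exp (-φ z0) * ((1 + ‖z - z0‖ / ρ z0) ^ N)⁻¹ := by
  obtain ⟨m0, hm0, H⟩ := peak_unit h.one_le N
  have hC := h.one_le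
  have hq : 1 < 1 + 1 / C ^ 3 := by
    have : 0 < 1 / C ^ 3 := by positivity
    linarith
  obtain ⟨k, hk⟩ := pow_unbounded_of_one_lt m0 hq
  obtain ⟨K, hK, H⟩ := H (C ^ (2 * k))
  refine ⟨K * (4 ^ k) ^ N, by positivity, fun z0 => ?_⟩
  have hρ0 := (hρ z0).1
  have hm1 : μ.real (ball z0 (ρ z0)) = 1 := by rw [measureReal_def, (hρ z0).2]; rfl
  set R := 4 ^ k * ρ z0 with hR
  have hR0 : 0 < R := by positivity
  have hRc : (R : ℂ) ≠ 0 := by exact_mod_cast hR0.ne'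
  have hb : (μ.map (fun z => (z - z0) / R)).real (ball 0 1) = μ.real (ball z0 R) := by
    rw [map_affine_ball μ hR0]; simp
  obtain ⟨F, hF, hF0, hFb⟩ := H _ _ (h.affine hR0 z0) (by
      rw [hb]
      have := h.grow_pow z0 hρ0 k
      rw [hm1, mul_one] at this
      linarith) (by
      rw [hb, hR]
      have := h.dbl_pow z0 hρ0 (2 * k)
      rw [hm1, mul_one, pow_mul 2 2 k] at this
      norm_num at this
      exact this)
  refine ⟨fun z => F ((z - z0) / R), hF.comp (by fun_prop), by simpa using hF0, fun z => ?_⟩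
  have := hFb ((z - z0) / R)
  simp only [mul_zero, zero_add] at this
  rw [mul_div_cancel₀ _ hRc, sub_add_cancel] at this
  refine this.trans ?_
  have e : ‖(z - z0) / (R : ℂ)‖ = ‖z - z0‖ / R := by
    rw [norm_div, Complex.norm_real, Real.norm_of_nonneg hR0.le]
  rw [e]
  have h4 : (1:ℝ) ≤ 4 ^ k := one_le_pow₀ (by norm_num)
  have e2 : (1 + ‖z - z0‖ / ρ z0) ≤ 4 ^ k * (1 + ‖z - z0‖ / R) := by
    have : 4 ^ k * (‖z - z0‖ / R) = ‖z - z0‖ / ρ z0 := by rw [hR]; field_simp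
    rw [mul_add, this]; linarith
  have e3 : ((1 + ‖z - z0‖ / R) ^ N)⁻¹ ≤ (4 ^ k) ^ N * ((1 + ‖z - z0‖ / ρ z0) ^ N)⁻¹ := by
    rw [← div_eq_mul_inv, le_div_iff₀ (by positivity), inv_mul_le_iff₀ (by positivity), mul_comm, ← mul_pow]
    gcongr
  calc _ ≤ K * Real.exp (-φ z0) * ((4 ^ k) ^ N * ((1 + ‖z - z0‖ / ρ z0) ^ N)⁻¹) := by gcongr
    _ = _ := by ring


/-! ### Geometry of the radius function and of flat weights -/

section geom
variable {φ : ℂ → ℝ} {μ : Measure ℂ} {C : ℝ} {ρ : ℂ → ℝ}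

lemma rad_one (hρ : IsRadius μ ρ) (z : ℂ) : μ.real (ball z (ρ z)) = 1 := by
  rw [measureReal_def, (hρ z).2]; rfl

lemma mass_pos (h : DL φ μ C) (hρ : IsRadius μ ρ) (z : ℂ) {r : ℝ} (hr : 0 < r) :
    0 < μ.real (ball z r) := by
  obtain ⟨k, hk⟩ := pow_unbounded_of_one_lt (ρ z / r) (by norm_num : (1:ℝ) < 2)
  rw [div_lt_iff₀ hr] at hk
  have h1 := h.dbl_pow z hr k
  have h2 : μ.real (ball z (ρ z)) ≤ μ.real (ball z (2 ^ k * r)) := h.real_mono (ball_subset_ball hk.le)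
  rw [rad_one hρ] at h2
  have h3 : 0 < C ^ k := pow_pos (by linarith [h.one_le]) k
  by_contra hc
  have : μ.real (ball z r) ≤ 0 := not_lt.1 hc
  nlinarith

lemma mass_strict (h : DL φ μ C) (hρ : IsRadius μ ρ) (z : ℂ) {r s : ℝ} (hr : 0 < r) (hs : r < s) :
    μ.real (ball z r) < μ.real (ball z s) := by
  set c : ℂ := z + (((r + s) / 2 : ℝ) : ℂ)
  have hcz : ‖c - z‖ = (r + s) / 2 := by
    simp only [c, add_sub_cancel_left, Complex.norm_real]
    exact Real.norm_of_nonneg (by linarith)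
  have hdis : Disjoint (ball z r) (ball c ((s - r) / 2)) := by
    apply ball_disjoint_ball
    rw [dist_comm, dist_eq_norm, hcz]; linarith
  have hsub : ball z r ∪ ball c ((s - r) / 2) ⊆ ball z s := by
    apply union_subset (ball_subset_ball hs.le)
    apply ball_subset_ball'
    rw [dist_eq_norm, hcz]; linarith
  have h1 := measureReal_mono hsub (h.fin z s).ne
  rw [measureReal_union hdis measurableSet_ball (h.fin _ _).ne (h.fin _ _).ne] at h1
  have := mass_pos h hρ c (r := (s - r) / 2) (by linarith)
  linarith

lemma rad_le (h : DL φ μ C) (hρ : IsRadius μ ρ) {z : ℂ} {r : ℝ} (hr : 0 < r)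
    (hm : 1 ≤ μ.real (ball z r)) : ρ z ≤ r := by
  by_contra hc
  have := mass_strict h hρ z hr (not_le.1 hc)
  rw [rad_one hρ] at this; linarith

lemma le_rad (h : DL φ μ C) (hρ : IsRadius μ ρ) {z : ℂ} {r : ℝ}
    (hm : μ.real (ball z r) ≤ 1) : r ≤ ρ z := by
  by_contra hc
  have := mass_strict h hρ z (hρ z).1 (not_le.1 hc)
  rw [rad_one hρ] at this; linarith

lemma rad_lip (h : DL φ μ C) (hρ : IsRadius μ ρ) (z w : ℂ) : ρ z ≤ ρ w + ‖z - w‖ := by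
  have hw := (hρ w).1
  apply rad_le h hρ (by positivity)
  rw [← rad_one hρ w]
  apply h.real_mono
  apply ball_subset_ball'
  rw [dist_comm, dist_eq_norm]

lemma rad_cont (h : DL φ μ C) (hρ : IsRadius μ ρ) : Continuous ρ := by
  have : LipschitzWith 1 ρ := by
    apply LipschitzWith.of_le_add
    intro x y
    rw [dist_eq_norm]; exact rad_lip h hρ x y
  exact this.continuous

lemma rad_lower (h : DL φ μ C) (hρ : IsRadius μ ρ) :
    ∃ M : ℕ, ∀ z0 z, ρ z0 ≤ ρ z * (2 * (1 + ‖z - z0‖ / ρ z0)) ^ M := by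
  obtain ⟨J, hJ⟩ := small_ball h.one_le
  refine ⟨2 * J, fun z0 z => ?_⟩
  have h0 := (hρ z0).1
  obtain ⟨i, hi1, hi2⟩ := near_pow (x := 1 + ‖z - z0‖ / ρ z0) (by linarith [div_nonneg (norm_nonneg (z - z0)) h0.le])
  have := hJ φ μ h z0 z (ρ z0) h0 i (by
    have : (1 + ‖z - z0‖ / ρ z0) * ρ z0 ≤ 2 ^ i * ρ z0 := by gcongr
    have e : (1 + ‖z - z0‖ / ρ z0) * ρ z0 = ‖z - z0‖ + ρ z0 := by field_simp; ring
    linarith)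
  rw [rad_one hρ] at this
  have h1 := le_rad h hρ this
  rw [div_le_iff₀ (by positivity)] at h1
  have e : (4:ℝ) ^ (i * J) = (2 ^ i) ^ (2 * J) := by
    rw [show (4:ℝ) = 2 ^ 2 by norm_num, ← pow_mul, ← pow_mul]; congr 1; ring
  rw [e] at h1
  have hz := (hρ z).1
  refine h1.trans ?_
  gcongr

lemma rad_upper (h : DL φ μ C) (hρ : IsRadius μ ρ) (z0 z : ℂ) :
    ρ z ≤ ρ z0 * (1 + ‖z - z0‖ / ρ z0) := by
  have h0 := (hρ z0).1
  have := rad_lip h hρ z z0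
  have e : ρ z0 * (1 + ‖z - z0‖ / ρ z0) = ρ z0 + ‖z - z0‖ := by field_simp
  linarith

lemma rad_small (h : DL φ μ C) (hρ : IsRadius μ ρ) {ε : ℝ} (hε : 0 < ε) :
    ∃ R > 0, ∀ z, ‖z‖ ≤ 20 * R → ρ z ≤ ε * R := by
  have hC := h.one_le
  have hq : 1 < 1 + 1 / C ^ 3 := by
    have : 0 < 1 / C ^ 3 := by positivity
    linarith
  obtain ⟨k, hk⟩ := pow_unbounded_of_one_lt (21 / ε) (by norm_num : (1:ℝ) < 2)
  rw [div_lt_iff₀ hε] at hk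
  obtain ⟨j, hj⟩ := pow_unbounded_of_one_lt (C ^ k) hq
  have h0 := (hρ 0).1
  refine ⟨4 ^ j * ρ 0, by positivity, fun z hz => ?_⟩
  set R := 4 ^ j * ρ 0 with hR
  have hR0 : 0 < R := by positivity
  have h1 := h.grow_pow 0 h0 j
  rw [rad_one hρ, mul_one] at h1
  have h2 : μ.real (ball 0 R) ≤ μ.real (ball z (2 ^ k * (ε * R))) := by
    apply h.real_mono
    apply ball_subset_ball'
    rw [dist_comm, dist_eq_norm, sub_zero]
    nlinarith
  have h3 := h.dbl_pow z (r := ε * R) (by positivity) k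
  apply rad_le h hρ (by positivity)
  have hCk : 0 < C ^ k := by positivity
  by_contra hc
  have hc := not_le.1 hc
  nlinarith

lemma path_le (h : DL φ μ C) (hρ : IsRadius μ ρ) :
    ∃ M : ℕ, ∀ z0 z, pathDist ρ z0 z ≤ (2 * (1 + ‖z - z0‖ / ρ z0)) ^ M := by
  obtain ⟨M, hM⟩ := rad_lower h hρ
  refine ⟨M + 1, fun z0 z => ?_⟩
  have h0 := (hρ z0).1
  set D := ‖z - z0‖ / ρ z0 with hD
  have hD0 : 0 ≤ D := by positivity
  have hbdd : BddBelow { L : ℝ | ∃ γ : ℝ → ℂ, γ 0 = z0 ∧ γ 1 = z ∧ ContDiff ℝ 1 γ ∧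
    L = ∫ t in (0:ℝ)..1, ‖deriv γ t‖ / ρ (γ t) } := by
    refine ⟨0, ?_⟩
    rintro L ⟨γ, -, -, -, rfl⟩
    apply intervalIntegral.integral_nonneg zero_le_one
    intro t _
    exact div_nonneg (norm_nonneg _) (hρ _).1.le
  have hmem : (∫ t in (0:ℝ)..1, ‖deriv (fun t : ℝ => z0 + t * (z - z0)) t‖ / ρ (z0 + t * (z - z0)))
      ∈ { L : ℝ | ∃ γ : ℝ → ℂ, γ 0 = z0 ∧ γ 1 = z ∧ ContDiff ℝ 1 γ ∧
    L = ∫ t in (0:ℝ)..1, ‖deriv γ t‖ / ρ (γ t) } := by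
    refine ⟨fun t : ℝ => z0 + t * (z - z0), by simp, by simp, ?_, rfl⟩
    exact contDiff_const.add (Complex.ofRealCLM.contDiff.mul contDiff_const)
  refine (csInf_le hbdd hmem).trans ?_
  have hder : ∀ t : ℝ, deriv (fun t : ℝ => z0 + t * (z - z0)) t = z - z0 := by
    intro t
    have : HasDerivAt (fun t : ℝ => z0 + t * (z - z0)) (1 * (z - z0)) t :=
      ((Complex.ofRealCLM.hasDerivAt (x := t)).mul_const (z - z0)).const_add z0
    rw [this.deriv, one_mul]
  have hb := intervalIntegral.norm_integral_le_of_norm_le_const (a := (0:ℝ)) (b := 1)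
    (f := fun t : ℝ => ‖deriv (fun t : ℝ => z0 + t * (z - z0)) t‖ / ρ (z0 + t * (z - z0)))
    (C := D * (2 * (1 + D)) ^ M) (by
      intro t ht
      rw [uIoc_of_le zero_le_one] at ht
      have hp := (hρ (z0 + t * (z - z0))).1
      rw [hder, Real.norm_of_nonneg (by positivity), div_le_iff₀ hp]
      have := hM z0 (z0 + t * (z - z0))
      have e : ‖z0 + t * (z - z0) - z0‖ ≤ ‖z - z0‖ := by
        rw [add_sub_cancel_left, norm_mul, Complex.norm_real, Real.norm_of_nonneg ht.1.le]
        exact mul_le_of_le_one_left (norm_nonneg _) ht.2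
      have e2 : ρ z0 ≤ ρ (z0 + t * (z - z0)) * (2 * (1 + D)) ^ M := by
        refine this.trans ?_
        rw [hD]; gcongr
      have e3 : ‖z - z0‖ = D * ρ z0 := by rw [hD]; field_simp
      rw [e3, mul_assoc, mul_comm ((2 * (1 + D)) ^ M)]
      gcongr)
  simp only [sub_zero, abs_one, mul_one] at hb
  refine (le_abs_self _).trans (hb.trans ?_)
  rw [pow_succ, mul_comm]
  gcongr
  linarith

lemma flat_bound (h : DL φ μ C) (hρ : IsRadius μ ρ) {ω : ℂ → ℝ} (hω : IsFlatWeight ρ ω) :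
    ∃ B > 0, ∃ m : ℕ, ∀ z0 z, ω z ≤ ω z0 * (B * (1 + ‖z - z0‖ / ρ z0) ^ m) ∧
      ω z0 ≤ ω z * (B * (1 + ‖z - z0‖ / ρ z0) ^ m) := by
  obtain ⟨hp, -, Cω, hCω, hflat⟩ := hω
  obtain ⟨M, hM⟩ := path_le h hρ
  obtain ⟨m, hm⟩ := exists_nat_ge (Cω * M)
  refine ⟨Real.exp Cω * 2 ^ m, by positivity, m, fun z0 z => ?_⟩
  have h0 := (hρ z0).1
  have hf := hflat z0 z
  have hP := hM z0 z
  set D := ‖z - z0‖ / ρ z0 with hD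
  have hD0 : 0 ≤ D := by positivity
  have hl0 : 0 ≤ Real.log (2 * (1 + D)) := Real.log_nonneg (by linarith)
  have hl : max (Real.log (pathDist ρ z0 z)) 0 ≤ M * Real.log (2 * (1 + D)) := by
    apply max_le _ (by positivity)
    rw [← Real.log_pow]
    have hnn : 0 ≤ pathDist ρ z0 z := by
      apply Real.sInf_nonneg
      rintro L ⟨γ, -, -, -, rfl⟩
      apply intervalIntegral.integral_nonneg zero_le_one
      intro t _
      exact div_nonneg (norm_nonneg _) (hρ _).1.le
    rcases hnn.eq_or_lt with h | h
    · rw [← h, Real.log_zero, Real.log_pow]; positivity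
    · exact Real.log_le_log h hP
  have h1 : |Real.log (ω z0) - Real.log (ω z)| ≤ Cω + m * Real.log (2 * (1 + D)) := by
    calc _ ≤ _ := hf
      _ ≤ Cω * (1 + M * Real.log (2 * (1 + D))) := by gcongr
      _ = Cω + (Cω * M) * Real.log (2 * (1 + D)) := by ring
      _ ≤ _ := by gcongr
  have e : Real.exp (Cω + m * Real.log (2 * (1 + D))) = Real.exp Cω * 2 ^ m * (1 + D) ^ m := by
    rw [Real.exp_add, Real.exp_nat_mul, Real.exp_log (by positivity), mul_pow]; ring
  have key : ∀ a b : ℝ, 0 < a → 0 < b → Real.log a - Real.log b ≤ Cω + m * Real.log (2 * (1 + D)) →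
      a ≤ b * (Real.exp Cω * 2 ^ m * (1 + D) ^ m) := by
    intro a b ha hb hab
    rw [← e]
    calc a = Real.exp (Real.log a) := (Real.exp_log ha).symm
      _ ≤ Real.exp (Real.log b + (Cω + m * Real.log (2 * (1 + D)))) := by
        apply Real.exp_le_exp.2; linarith
      _ = _ := by rw [Real.exp_add, Real.exp_log hb]
  have h2 := abs_le.1 h1
  exact ⟨key _ _ (hp z) (hp z0) (by linarith [h2.1]), key _ _ (hp z0) (hp z) h2.2⟩

end geom


/-! ### Norm estimates -/

lemma term_eq {a b x q : ℝ} (ha : 0 ≤ a) (hb : 0 ≤ b) :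
    a ^ q * b ^ q * Real.exp (-(q * x)) = (a * b * Real.exp (-x)) ^ q := by
  rw [Real.mul_rpow (by positivity) (by positivity), Real.mul_rpow ha hb, ← Real.exp_mul]
  congr 2; ring

lemma toReal_ge {p : ℝ≥0∞} (hp : 1 ≤ p) (hpt : p ≠ ∞) : 1 ≤ p.toReal := by
  rw [← ENNReal.toReal_one]
  exact ENNReal.toReal_mono hpt hp

section norms
variable {φ : ℂ → ℝ} {μ : Measure ℂ} {C : ℝ} {ρ ω : ℂ → ℝ}

lemma lnorm_single (hω : ∀ z, 0 < ω z) {p : ℝ≥0∞} (hp : 1 ≤ p) {Λ : Set ℂ} (v : ℂ → ℂ) {l : ℂ} (hl : l ∈ Λ) :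
    ENNReal.ofReal (ω l * ‖v l‖ * Real.exp (-φ l)) ≤ lnorm p φ ω Λ v := by
  unfold lnorm
  split_ifs with h
  · exact le_iSup (fun l : Λ => ENNReal.ofReal (ω l.1 * ‖v l.1‖ * Real.exp (-φ l.1))) ⟨l, hl⟩
  · have hq := toReal_ge hp h
    have hq0 : 0 < p.toReal := by linarith
    rw [one_div, ENNReal.le_rpow_inv_iff hq0, ENNReal.ofReal_rpow_of_nonneg (by have := (hω l).le; positivity) hq0.le,
      ← term_eq (hω l).le (norm_nonneg _)]
    exact ENNReal.le_tsum (f := fun l : Λ => ENNReal.ofReal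
      (ω l.1 ^ p.toReal * ‖v l.1‖ ^ p.toReal * Real.exp (-(p.toReal * φ l.1)))) ⟨l, hl⟩

lemma lnorm_mono (hω : ∀ z, 0 < ω z) {p : ℝ≥0∞} (hp : 1 ≤ p) {Λ : Set ℂ} {v w : ℂ → ℂ} {c : ℝ} (hc : 0 ≤ c)
    (h : ∀ l ∈ Λ, ‖v l‖ ≤ c * ‖w l‖) :
    lnorm p φ ω Λ v ≤ ENNReal.ofReal c * lnorm p φ ω Λ w := by
  have hkey : ∀ l : Λ, ω l.1 * ‖v l.1‖ * Real.exp (-φ l.1) ≤ c * (ω l.1 * ‖w l.1‖ * Real.exp (-φ l.1)) := by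
    intro l
    have := hω l.1
    calc _ ≤ ω l.1 * (c * ‖w l.1‖) * Real.exp (-φ l.1) := by gcongr; exact h _ l.2
      _ = _ := by ring
  unfold lnorm
  split_ifs with hpt
  · refine iSup_le fun l => ?_
    refine (ENNReal.ofReal_le_ofReal (hkey l)).trans ?_
    rw [ENNReal.ofReal_mul hc]
    gcongr
    exact le_iSup (fun l : Λ => ENNReal.ofReal (ω l.1 * ‖w l.1‖ * Real.exp (-φ l.1))) l
  · have hq := toReal_ge hp hpt
    set q := p.toReal
    have hq0 : 0 < q := by linarith
    have e : ENNReal.ofReal c = (ENNReal.ofReal c ^ q) ^ (1 / q) := by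
      rw [← ENNReal.rpow_mul, mul_one_div_cancel hq0.ne', ENNReal.rpow_one]
    rw [e, ← ENNReal.mul_rpow_of_nonneg _ _ (by positivity), ← ENNReal.tsum_mul_left]
    gcongr with l
    rw [term_eq (hω _).le (norm_nonneg _), term_eq (hω _).le (norm_nonneg _),
      ENNReal.ofReal_rpow_of_nonneg hc hq0.le, ← ENNReal.ofReal_mul (by positivity),
      ← Real.mul_rpow hc (by have := (hω l.1).le; positivity)]
    apply ENNReal.ofReal_le_ofReal
    apply Real.rpow_le_rpow (by have := (hω l.1).le; positivity) (hkey l) hq0.le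

lemma lnorm_fin {p : ℝ≥0∞} (hp : 1 ≤ p) {Λ : Set ℂ} {v : ℂ → ℂ} (T : Finset ℂ)
    (h : ∀ l ∈ Λ, l ∉ T → v l = 0) : lnorm p φ ω Λ v < ∞ := by
  unfold lnorm
  split_ifs with hpt
  · refine lt_of_le_of_lt (b := ∑ l ∈ T, ENNReal.ofReal (ω l * ‖v l‖ * Real.exp (-φ l))) (iSup_le fun l => ?_) ?_
    · by_cases hl : l.1 ∈ T
      · exact Finset.single_le_sum (f := fun l => ENNReal.ofReal (ω l * ‖v l‖ * Real.exp (-φ l)))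
          (fun _ _ => zero_le) hl
      · rw [h _ l.2 hl]; simp
    · exact ENNReal.sum_lt_top.2 fun _ _ => ENNReal.ofReal_lt_top
  · have hq := toReal_ge hp hpt
    have hq0 : 0 < p.toReal := by linarith
    refine ENNReal.rpow_lt_top_of_nonneg (by positivity) ?_
    rw [tsum_eq_sum (s := T.subtype (· ∈ Λ))]
    · exact (ENNReal.sum_lt_top.2 fun _ _ => ENNReal.ofReal_lt_top).ne
    · intro l hl
      rw [h _ l.2 (by simpa using hl)]
      simp [Real.zero_rpow hq0.ne']

lemma ann_sub (z : ℂ) (r : ℝ) : ann z r ⊆ ball z r := fun w hw => by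
  rw [mem_ball, dist_eq_norm]; exact hw.2

lemma local_est (h : DL φ μ C) (hρ : IsRadius μ ρ) (hω : IsFlatWeight ρ ω) {q : ℝ} (hq : 0 < q) :
    ∃ K > 0, ∀ (l : ℂ) (f G : ℂ → ℂ), Differentiable ℂ f → (∀ z ∈ ann l (ρ l), ‖f z‖ ≤ ‖G z‖) →
      ENNReal.ofReal (ω l ^ q * ‖f l‖ ^ q * Real.exp (-(q * φ l))) ≤ ENNReal.ofReal K *
        ∫⁻ z in ann l (ρ l), ENNReal.ofReal (‖G z‖ ^ q * Real.exp (-(q * φ z)) * ω z ^ q / ρ z ^ 2) := by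
  obtain ⟨B, hB, m, hBm⟩ := flat_bound h hρ hω
  obtain ⟨K, hK, HL⟩ := LM (A := 1) hq h.one_le
  have hωp := hω.1
  refine ⟨K * (B * 2 ^ m) ^ q * 4, by positivity, fun l f G hf hG => ?_⟩
  have hl := (hρ l).1
  have h1 := HL φ μ h f hf l (ρ l) hl (rad_one hρ l).le
  have hωl := hωp l
  rw [mul_assoc, ENNReal.ofReal_mul (by positivity)]
  refine (mul_le_mul_right h1 _).trans ?_
  rw [← mul_assoc, ← ENNReal.ofReal_mul (by positivity), ← lintegral_const_mul' _ _ ENNReal.ofReal_ne_top,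
    ← lintegral_const_mul' _ _ ENNReal.ofReal_ne_top]
  apply setLIntegral_mono_ae' (ann_meas _ _)
  refine Eventually.of_forall fun z hz => ?_
  rw [← ENNReal.ofReal_mul (by positivity), ← ENNReal.ofReal_mul (by positivity)]
  apply ENNReal.ofReal_le_ofReal
  have hz1 := hG z hz
  have hzl : ‖z - l‖ / ρ l ≤ 1 := by rw [div_le_one hl]; exact hz.2.le
  have hωz := hωp z
  have hρz := (hρ z).1
  have e1 : ω l ≤ (B * 2 ^ m) * ω z := by
    calc ω l ≤ ω z * (B * (1 + ‖z - l‖ / ρ l) ^ m) := (hBm l z).2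
      _ ≤ ω z * (B * (1 + 1) ^ m) := by gcongr
      _ = _ := by norm_num; ring
  have e2 : ρ z ≤ 2 * ρ l := by
    have := rad_lip h hρ z l
    have := hz.2
    linarith
  have e3 : 1 / ρ l ^ 2 ≤ 4 / ρ z ^ 2 := by
    rw [div_le_div_iff₀ (by positivity) (by positivity)]
    nlinarith
  have e4 : ω l ^ q ≤ (B * 2 ^ m) ^ q * ω z ^ q := by
    rw [← Real.mul_rpow (by positivity) hωz.le]
    exact Real.rpow_le_rpow hωl.le e1 hq.le
  have e5 : ‖f z‖ ^ q ≤ ‖G z‖ ^ q := Real.rpow_le_rpow (norm_nonneg _) hz1 hq.le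
  calc _ = ω l ^ q * K * (1 / ρ l ^ 2) * (‖f z‖ ^ q * Real.exp (-(q * φ z))) := by ring
    _ ≤ ((B * 2 ^ m) ^ q * ω z ^ q) * K * (4 / ρ z ^ 2) * (‖G z‖ ^ q * Real.exp (-(q * φ z))) := by gcongr
    _ = _ := by ring

lemma lem_E (h : DL φ μ C) (hρ : IsRadius μ ρ) (hω : IsFlatWeight ρ ω) {p : ℝ≥0∞} (hp : 1 ≤ p) :
    ∃ K > 0, ∀ (Λ : Set ℂ) (T : Finset ℂ),
      (∀ a ∈ T, ∀ b ∈ T, a ≠ b → Disjoint (ball a (ρ a)) (ball b (ρ b))) →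
      ∀ (G : ℂ → ℂ) (f : ℂ → ℂ → ℂ) (v : ℂ → ℂ), (∀ l ∈ T, Differentiable ℂ (f l)) →
      (∀ l ∈ T, ∀ z ∈ ann l (ρ l), ‖f l z‖ ≤ ‖G z‖) → (∀ l ∈ Λ, l ∉ T → v l = 0) →
      (∀ l ∈ T, ‖v l‖ ≤ ‖f l l‖) →
      lnorm p φ ω Λ v ≤ ENNReal.ofReal K * Fnorm p φ ω ρ G := by
  have hωp := hω.1
  by_cases hpt : p = ∞
  · obtain ⟨K, hK, H⟩ := local_est h hρ hω (q := 1) one_pos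
    obtain ⟨M, hM⟩ := rad_lower h hρ
    refine ⟨K * ((4 ^ M) ^ 2 * π), by positivity, fun Λ T hd G f v hf hfG hv hvT => ?_⟩
    unfold lnorm Fnorm
    rw [if_pos hpt, if_pos hpt]
    set N := ⨆ z : ℂ, ENNReal.ofReal (ω z * ‖G z‖ * Real.exp (-φ z)) with hN
    refine iSup_le fun l => ?_
    by_cases hl : l.1 ∈ T
    · have h1 := H l.1 (f l.1) G (hf _ hl) (hfG _ hl)
      have hρl := (hρ l.1).1
      simp only [Real.rpow_one, one_mul] at h1
      have hωl := hωp l.1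
      refine le_trans (ENNReal.ofReal_le_ofReal (by gcongr; exact hvT _ hl)) (h1.trans ?_)
      rw [ENNReal.ofReal_mul hK.le, mul_assoc]
      gcongr
      calc _ ≤ ∫⁻ z in ann l.1 (ρ l.1), ENNReal.ofReal ((4 ^ M) ^ 2 / ρ l.1 ^ 2) * N := by
            apply setLIntegral_mono_ae' (ann_meas _ _)
            refine Eventually.of_forall fun z hz => ?_
            have hρz := (hρ z).1
            have hωz := hωp z
            have e1 : ρ l.1 ≤ ρ z * 4 ^ M := by
              refine (hM l.1 z).trans ?_
              have : ‖z - l.1‖ / ρ l.1 ≤ 1 := by rw [div_le_one hρl]; exact hz.2.le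
              gcongr
              linarith
            have e2 : 1 / ρ z ^ 2 ≤ (4 ^ M) ^ 2 / ρ l.1 ^ 2 := by
              rw [div_le_div_iff₀ (by positivity) (by positivity), one_mul, ← mul_pow]
              gcongr
              linarith
            calc _ = ENNReal.ofReal (1 / ρ z ^ 2) * ENNReal.ofReal (ω z * ‖G z‖ * Real.exp (-φ z)) := by
                  rw [← ENNReal.ofReal_mul (by positivity)]; congr 1; ring
              _ ≤ _ := by
                  gcongr
                  exact le_iSup (fun z : ℂ => ENNReal.ofReal (ω z * ‖G z‖ * Real.exp (-φ z))) z
        _ = ENNReal.ofReal ((4 ^ M) ^ 2 / ρ l.1 ^ 2) * N * volume (ann l.1 (ρ l.1)) := by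
            rw [setLIntegral_const]
        _ ≤ ENNReal.ofReal ((4 ^ M) ^ 2 / ρ l.1 ^ 2) * N * ENNReal.ofReal (π * ρ l.1 ^ 2) := by
            gcongr
            refine (measure_mono (ann_sub _ _)).trans (le_of_eq ?_)
            rw [Complex.volume_ball, mul_comm, ENNReal.ofReal_mul Real.pi_pos.le, ENNReal.ofReal_pow hρl.le]
            congr 1
            exact (ENNReal.ofReal_eq_coe_nnreal Real.pi_pos.le).symm
        _ = _ := by
            rw [mul_right_comm, ← ENNReal.ofReal_mul (by positivity)]
            congr 2
            field_simp
    · rw [hv _ l.2 hl]; simp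
  · have hq := toReal_ge hp hpt
    set q := p.toReal with hqd
    have hq0 : 0 < q := by linarith
    obtain ⟨K, hK, H⟩ := local_est h hρ hω (q := q) hq0
    refine ⟨K ^ (1 / q), by positivity, fun Λ T hd G f v hf hfG hv hvT => ?_⟩
    unfold lnorm Fnorm
    rw [if_neg hpt, if_neg hpt, ← hqd, ← ENNReal.ofReal_rpow_of_pos hK, ← ENNReal.mul_rpow_of_nonneg _ _ (by positivity)]
    gcongr
    rw [tsum_eq_sum (s := T.subtype (· ∈ Λ))]
    · rw [Finset.sum_subtype_eq_sum_filter (f := fun l => ENNReal.ofReal (ω l ^ q * ‖v l‖ ^ q * Real.exp (-(q * φ l))))]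
      calc _ ≤ ∑ l ∈ T, ENNReal.ofReal (ω l ^ q * ‖v l‖ ^ q * Real.exp (-(q * φ l))) :=
            Finset.sum_le_sum_of_subset (Finset.filter_subset _ _)
        _ ≤ ∑ l ∈ T, ENNReal.ofReal K * ∫⁻ z in ann l (ρ l), ENNReal.ofReal (‖G z‖ ^ q * Real.exp (-(q * φ z)) * ω z ^ q / ρ z ^ 2) := by
            refine Finset.sum_le_sum fun l hl => ?_
            refine le_trans (ENNReal.ofReal_le_ofReal ?_) (H l (f l) G (hf l hl) (hfG l hl))
            have := hωp l
            have := Real.rpow_le_rpow (norm_nonneg _) (hvT l hl) hq0.le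
            gcongr
        _ ≤ _ := by
            rw [← Finset.mul_sum, ← lintegral_biUnion_finset]
            · gcongr
              exact Measure.restrict_le_self
            · intro a ha b hb hab
              exact (hd a ha b hb hab).mono (ann_sub _ _) (ann_sub _ _)
            · intro l _; exact ann_meas _ _
    · intro l hl
      rw [hv _ l.2 (by simpa using hl)]
      simp [Real.zero_rpow hq0.ne']

end norms


section norms2
variable {φ : ℂ → ℝ} {μ : Measure ℂ} {C : ℝ} {ρ ω : ℂ → ℝ}

lemma dens_eq {a b x q r : ℝ} (ha : 0 ≤ a) (hb : 0 ≤ b) :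
    b ^ q * Real.exp (-(q * x)) * a ^ q / r = (a * b * Real.exp (-x)) ^ q / r := by
  rw [← term_eq ha hb]; ring

lemma Fnorm_decay (h : DL φ μ C) (hρ : IsRadius μ ρ) (hω : IsFlatWeight ρ ω) {p : ℝ≥0∞} (hp : 1 ≤ p) :
    ∃ N1 : ℕ, ∃ K > 0, ∀ (z0 : ℂ) (f : ℂ → ℂ) (A : ℝ), 0 ≤ A →
      (∀ z, ω z * ‖f z‖ * Real.exp (-φ z) ≤ A * ((1 + ‖z - z0‖ / ρ z0) ^ N1)⁻¹) →
      Fnorm p φ ω ρ f ≤ ENNReal.ofReal (K * A) := by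
  have hωp := hω.1
  by_cases hpt : p = ∞
  · refine ⟨0, 1, one_pos, fun z0 f A hA hf => ?_⟩
    unfold Fnorm
    rw [if_pos hpt]
    refine iSup_le fun z => ENNReal.ofReal_le_ofReal ?_
    simpa using hf z
  · have hq := toReal_ge hp hpt
    set q := p.toReal with hqd
    have hq0 : 0 < q := by linarith
    obtain ⟨M, hM⟩ := rad_lower h hρ
    have hI : Integrable (fun w : ℂ => ((1 + ‖w‖) ^ 3)⁻¹) := by
      have := integrable_one_add_norm (E := ℂ) (μ := volume) (r := 3) (by simp; norm_num)
      refine this.congr (Eventually.of_forall fun w => ?_)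
      simp only
      rw [Real.rpow_neg (by positivity)]
      norm_cast
    set J := ∫ w : ℂ, ((1 + ‖w‖) ^ 3)⁻¹ with hJ
    have hJ0 : 0 ≤ J := integral_nonneg fun w => by positivity
    refine ⟨2 * M + 3, ((4 : ℝ) ^ M * (J + 1)) ^ (1 / q), by positivity, fun z0 f A hA hf => ?_⟩
    have hρ0 := (hρ z0).1
    unfold Fnorm
    rw [if_neg hpt, ← hqd]
    have key : ∀ z, ‖f z‖ ^ q * Real.exp (-(q * φ z)) * ω z ^ q / ρ z ^ 2
        ≤ A ^ q * 4 ^ M * ((ρ z0 ^ 2)⁻¹ * ((1 + ‖z - z0‖ / ρ z0) ^ 3)⁻¹) := by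
      intro z
      have hρz := (hρ z).1
      have hωz := hωp z
      rw [dens_eq hωz.le (norm_nonneg _)]
      set D := 1 + ‖z - z0‖ / ρ z0 with hD
      have hD1 : 1 ≤ D := by rw [hD]; have : 0 ≤ ‖z - z0‖ / ρ z0 := by positivity
                             linarith
      have hD0 : 0 < D := by linarith
      have e1 : (ω z * ‖f z‖ * Real.exp (-φ z)) ^ q ≤ A ^ q * (D ^ (2 * M + 3))⁻¹ := by
        calc _ ≤ (A * (D ^ (2 * M + 3))⁻¹) ^ q := Real.rpow_le_rpow (by positivity) (hf z) hq0.le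
          _ = A ^ q * ((D ^ (2 * M + 3))⁻¹) ^ q := Real.mul_rpow hA (by positivity)
          _ ≤ _ := by
            gcongr
            calc _ ≤ ((D ^ (2 * M + 3))⁻¹) ^ (1 : ℝ) := by
                  apply Real.rpow_le_rpow_of_exponent_ge (by positivity) _ hq
                  exact inv_le_one_of_one_le₀ (one_le_pow₀ hD1)
              _ = _ := Real.rpow_one _
      have e2 : (ρ z ^ 2)⁻¹ ≤ ((2 * D) ^ M) ^ 2 * (ρ z0 ^ 2)⁻¹ := by
        rw [← div_eq_mul_inv, inv_eq_one_div, div_le_div_iff₀ (by positivity) (by positivity), one_mul, ← mul_pow]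
        gcongr
        linarith [hM z0 z]
      rw [div_eq_mul_inv]
      calc _ ≤ (A ^ q * (D ^ (2 * M + 3))⁻¹) * (((2 * D) ^ M) ^ 2 * (ρ z0 ^ 2)⁻¹) := by gcongr
        _ = _ := by
          rw [mul_pow 2 D, mul_pow (2 ^ M), ← pow_mul, ← pow_mul, pow_add, mul_comm M 2, pow_mul (2:ℝ) 2]
          field_simp
          norm_num
    have hint : ∫⁻ z, ENNReal.ofReal (‖f z‖ ^ q * Real.exp (-(q * φ z)) * ω z ^ q / ρ z ^ 2)
        ≤ ENNReal.ofReal (A ^ q * (4 ^ M * (J + 1))) := by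
      calc _ ≤ ∫⁻ z, ENNReal.ofReal (A ^ q * 4 ^ M * ((ρ z0 ^ 2)⁻¹ * ((1 + ‖z - z0‖ / ρ z0) ^ 3)⁻¹)) :=
            lintegral_mono fun z => ENNReal.ofReal_le_ofReal (key z)
        _ = ENNReal.ofReal (∫ z, A ^ q * 4 ^ M * ((ρ z0 ^ 2)⁻¹ * ((1 + ‖z - z0‖ / ρ z0) ^ 3)⁻¹)) := by
            rw [ofReal_integral_eq_lintegral_ofReal]
            · refine Integrable.const_mul (Integrable.const_mul ?_ _) _
              have := integrable_affine (inv_pos.2 hρ0) (-z0 / (ρ z0 : ℂ)) hI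
              refine this.congr (Eventually.of_forall fun z => ?_)
              simp only
              congr 3
              rw [show (((ρ z0)⁻¹ : ℝ) : ℂ) * z + -z0 / ρ z0 = (z - z0) / ρ z0 by push_cast; ring, norm_div,
                Complex.norm_real, Real.norm_of_nonneg hρ0.le]
            · exact Eventually.of_forall fun z => by positivity
        _ = ENNReal.ofReal (A ^ q * 4 ^ M * J) := by
            rw [integral_const_mul, integral_const_mul]
            have := integral_affine (fun z : ℂ => ((1 + ‖z - z0‖ / ρ z0) ^ 3)⁻¹) hρ0 z0
            rw [smul_eq_mul] at this
            rw [← this, hJ]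
            congr 3
            ext w
            rw [add_sub_cancel_right, norm_mul, Complex.norm_real, Real.norm_of_nonneg hρ0.le]
            congr 3
            field_simp
        _ ≤ _ := by
            apply ENNReal.ofReal_le_ofReal
            rw [mul_assoc]
            gcongr
            linarith
    calc _ ≤ (ENNReal.ofReal (A ^ q * (4 ^ M * (J + 1)))) ^ (1 / q) := by gcongr
      _ = _ := by
        rw [ENNReal.ofReal_rpow_of_nonneg (by positivity) (by positivity), Real.mul_rpow (by positivity) (by positivity),
          ← Real.rpow_mul hA, mul_one_div_cancel hq0.ne', Real.rpow_one, mul_comm]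

lemma memF_transfer (h : DL φ μ C) (hρ : IsRadius μ ρ) (hω : IsFlatWeight ρ ω) {p : ℝ≥0∞} (hp : 1 ≤ p)
    {f f0 : ℂ → ℂ} (hf : Differentiable ℂ f) (hf0 : MemF p φ ω ρ f0) {R c : ℝ} (hc : 0 ≤ c)
    (hle : ∀ z, R ≤ ‖z‖ → ‖f z‖ ≤ c * ‖f0 z‖) : MemF p φ ω ρ f := by
  have hωp := hω.1
  refine ⟨hf, ?_⟩
  have hcont := h.cont
  have hbd : ∃ A, 0 ≤ A ∧ ∀ z, ‖z‖ ≤ R → ω z * ‖f z‖ * Real.exp (-φ z) ≤ A := by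
    obtain ⟨B, hB, m, H⟩ := flat_bound h hρ hω
    have hc1 : Continuous fun z => (ω 0 * (B * (1 + ‖z - 0‖ / ρ 0) ^ m)) * ‖f z‖ * Real.exp (-φ z) := by
      have := hf.continuous
      fun_prop
    obtain ⟨A, hA⟩ := (isCompact_closedBall (0 : ℂ) R).exists_bound_of_continuousOn hc1.continuousOn
    refine ⟨max A 0, le_max_right _ _, fun z hz => ?_⟩
    have h1 := hA z (by simpa using hz)
    refine le_trans ?_ ((le_abs_self _).trans (h1.trans (le_max_left _ _)))
    gcongr
    exact (H 0 z).1
  obtain ⟨A, hA0, hA⟩ := hbd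
  have hf0' := hf0.2
  unfold Fnorm at hf0' ⊢
  split_ifs with hpt
  · rw [if_pos hpt] at hf0'
    set N := ⨆ z : ℂ, ENNReal.ofReal (ω z * ‖f0 z‖ * Real.exp (-φ z)) with hN
    refine lt_of_le_of_lt (b := max (ENNReal.ofReal A) (ENNReal.ofReal c * N)) (iSup_le fun z => ?_) 
      (max_lt ENNReal.ofReal_lt_top (ENNReal.mul_lt_top ENNReal.ofReal_lt_top hf0'))
    rcases le_total ‖z‖ R with hz | hz
    · exact (ENNReal.ofReal_le_ofReal (hA z hz)).trans (le_max_left _ _)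
    · refine le_trans ?_ (le_max_right _ _)
      refine le_trans (b := ENNReal.ofReal c * ENNReal.ofReal (ω z * ‖f0 z‖ * Real.exp (-φ z))) ?_ ?_
      · rw [← ENNReal.ofReal_mul hc]
        apply ENNReal.ofReal_le_ofReal
        have := hωp z
        calc _ ≤ ω z * (c * ‖f0 z‖) * Real.exp (-φ z) := by gcongr; exact hle z hz
          _ = _ := by ring
      · gcongr
        exact le_iSup (fun z : ℂ => ENNReal.ofReal (ω z * ‖f0 z‖ * Real.exp (-φ z))) z
  · rw [if_neg hpt] at hf0'
    have hq := toReal_ge hp hpt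
    set q := p.toReal with hqd
    have hq0 : 0 < q := by linarith
    have hfin := (ENNReal.rpow_lt_top_iff_of_pos (by positivity)).1 hf0'
    apply ENNReal.rpow_lt_top_of_nonneg (by positivity)
    apply ne_of_lt
    have hc2 : Continuous fun z => (ρ z ^ 2)⁻¹ := by
      have := rad_cont h hρ
      exact Continuous.inv₀ (by fun_prop) fun z => by have := (hρ z).1; positivity
    obtain ⟨E, hE⟩ := (isCompact_closedBall (0 : ℂ) R).exists_bound_of_continuousOn hc2.continuousOn
    calc _ ≤ ∫⁻ z, ((closedBall (0:ℂ) R).indicator (fun _ => ENNReal.ofReal (A ^ q * E)) z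
          + ENNReal.ofReal (c ^ q) * ENNReal.ofReal (‖f0 z‖ ^ q * Real.exp (-(q * φ z)) * ω z ^ q / ρ z ^ 2)) := by
          refine lintegral_mono fun z => ?_
          have hρz := (hρ z).1
          have hωz := hωp z
          simp only
          rw [dens_eq hωz.le (norm_nonneg _), dens_eq hωz.le (norm_nonneg _)]
          rcases le_total ‖z‖ R with hz | hz
          · have hmem : z ∈ closedBall (0:ℂ) R := by simpa using hz
            rw [indicator_of_mem hmem]
            refine le_trans (ENNReal.ofReal_le_ofReal ?_) le_self_add
            have e1 := (le_abs_self _).trans (hE z hmem)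
            have e2 := Real.rpow_le_rpow (by positivity) (hA z hz) hq0.le
            rw [div_eq_mul_inv]
            gcongr
          · refine le_trans ?_ le_add_self
            rw [← ENNReal.ofReal_mul (by positivity), ← mul_div_assoc, ← Real.mul_rpow hc (by positivity)]
            apply ENNReal.ofReal_le_ofReal
            have e3 : ω z * ‖f z‖ * Real.exp (-φ z) ≤ c * (ω z * ‖f0 z‖ * Real.exp (-φ z)) := by
              calc _ ≤ ω z * (c * ‖f0 z‖) * Real.exp (-φ z) := by gcongr; exact hle z hz
                _ = _ := by ring
            have e4 := Real.rpow_le_rpow (by positivity) e3 hq0.le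
            gcongr
      _ = ENNReal.ofReal (A ^ q * E) * volume (closedBall (0:ℂ) R) + ENNReal.ofReal (c ^ q) *
          ∫⁻ z, ENNReal.ofReal (‖f0 z‖ ^ q * Real.exp (-(q * φ z)) * ω z ^ q / ρ z ^ 2) := by
          rw [lintegral_add_left (by measurability), lintegral_const_mul' _ _ ENNReal.ofReal_ne_top,
            lintegral_indicator measurableSet_closedBall, setLIntegral_const]
      _ < ∞ := by
          refine ENNReal.add_lt_top.2 ⟨ENNReal.mul_lt_top ENNReal.ofReal_lt_top measure_closedBall_lt_top, 
            ENNReal.mul_lt_top ENNReal.ofReal_lt_top hfin⟩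

lemma sampling_unif {p : ℝ≥0∞} {Λ : Set ℂ} (hs : IsSampling p φ ω ρ Λ) :
    ∃ Cs : ℝ, 0 < Cs ∧ ∀ f, MemF p φ ω ρ f → lnorm p φ ω Λ f ≤ ENNReal.ofReal Cs * Fnorm p φ ω ρ f ∧
      Fnorm p φ ω ρ f ≤ ENNReal.ofReal Cs * lnorm p φ ω Λ f := by
  unfold IsSampling at hs
  split_ifs at hs with hpt
  · obtain ⟨C, hC, H⟩ := hs
    subst hpt
    refine ⟨max C 1, by positivity, fun f hf => ⟨?_, ?_⟩⟩
    · refine le_trans (b := Fnorm ∞ φ ω ρ f) ?_ ?_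
      · unfold lnorm Fnorm
        rw [if_pos rfl, if_pos rfl]
        exact iSup_le fun l => le_iSup (fun z : ℂ => ENNReal.ofReal (ω z * ‖f z‖ * Real.exp (-φ z))) l.1
      · refine le_mul_of_one_le_left zero_le ?_
        rw [← ENNReal.ofReal_one]
        exact ENNReal.ofReal_le_ofReal (le_max_right _ _)
    · refine (H f hf).trans ?_
      gcongr
      rw [← ENNReal.ofReal_coe_nnreal]
      exact ENNReal.ofReal_le_ofReal (le_max_left _ _)
  · obtain ⟨C, hC, H⟩ := hs
    refine ⟨C, by positivity, fun f hf => ⟨?_, ?_⟩⟩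
    · have := (H f hf).1
      rw [ENNReal.ofReal_coe_nnreal]
      rwa [mul_comm, ← div_eq_mul_inv, ENNReal.div_le_iff' (by positivity) ENNReal.coe_ne_top] at this
    · rw [ENNReal.ofReal_coe_nnreal]
      exact (H f hf).2

lemma point_eval (h : DL φ μ C) (hρ : IsRadius μ ρ) (hω : IsFlatWeight ρ ω) {p : ℝ≥0∞} (hp : 1 ≤ p) :
    ∃ K > 0, ∀ (z0 : ℂ) (f : ℂ → ℂ), Differentiable ℂ f →
      ENNReal.ofReal (ω z0 * ‖f z0‖ * Real.exp (-φ z0)) ≤ ENNReal.ofReal K * Fnorm p φ ω ρ f := by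
  obtain ⟨K, hK, H⟩ := lem_E h hρ hω hp
  refine ⟨K, hK, fun z0 f hf => ?_⟩
  refine le_trans (lnorm_single hω.1 hp (Λ := {z0}) f rfl) ?_
  refine H {z0} {z0} ?_ f (fun _ => f) f (fun _ _ => hf) (fun _ _ _ _ => le_rfl) ?_ (fun _ _ => le_rfl)
  · intro a ha b hb hab
    simp at ha hb
    exact absurd (ha.trans hb.symm) hab
  · intro l hl hl'
    simp at hl hl'
    exact absurd hl hl'

lemma zero_of_vanish (h : DL φ μ C) (hρ : IsRadius μ ρ) (hω : IsFlatWeight ρ ω) {p : ℝ≥0∞} (hp : 1 ≤ p)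
    {Λ : Set ℂ} (hs : IsSampling p φ ω ρ Λ) {f : ℂ → ℂ} (hf : MemF p φ ω ρ f) (hv : ∀ l ∈ Λ, f l = 0) (z : ℂ) :
    f z = 0 := by
  obtain ⟨Cs, hCs, H⟩ := sampling_unif hs
  obtain ⟨K, hK, HK⟩ := point_eval h hρ hω hp
  have h1 : lnorm p φ ω Λ f ≤ ENNReal.ofReal 0 * lnorm p φ ω Λ f :=
    lnorm_mono hω.1 hp le_rfl fun l hl => by rw [hv l hl]; simp
  have h2 := (H f hf).2
  have h3 := HK z f hf.1
  have h4 : lnorm p φ ω Λ f = 0 := by simpa using h1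
  rw [h4, mul_zero] at h2
  have h5 : Fnorm p φ ω ρ f = 0 := le_antisymm h2 zero_le
  rw [h5, mul_zero] at h3
  have h6 : ω z * ‖f z‖ * Real.exp (-φ z) ≤ 0 := by
    simpa using h3
  by_contra hne
  have := hω.1 z
  have : 0 < ‖f z‖ := norm_pos_iff.2 hne
  have : 0 < ω z * ‖f z‖ * Real.exp (-φ z) := by positivity
  linarith

lemma rel_dense (h : DL φ μ C) (hρ : IsRadius μ ρ) (hω : IsFlatWeight ρ ω) {p : ℝ≥0∞} (hp : 1 ≤ p)
    {Λ : Set ℂ} (hs : IsSampling p φ ω ρ Λ) : ∃ K0 > 0, ∀ z0, ∃ l ∈ Λ, ‖l - z0‖ ≤ K0 * ρ z0 := by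
  obtain ⟨Cs, hCs, HS⟩ := sampling_unif hs
  obtain ⟨KE, hKE, HE⟩ := point_eval h hρ hω hp
  obtain ⟨N1, KF, hKF, HF⟩ := Fnorm_decay h hρ hω hp
  obtain ⟨B, hB, m, HB⟩ := flat_bound h hρ hω
  obtain ⟨Kp, hKp, HP⟩ := peak h hρ (m + 1 + N1)
  set Q := KE * Cs * Cs * KF * (Kp * B) with hQ
  have hQ0 : 0 < Q := by positivity
  refine ⟨2 * Q, by positivity, fun z0 => ?_⟩
  by_contra! hcon
  obtain ⟨f, hf, hf1, hfd⟩ := HP z0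
  have hρ0 := (hρ z0).1
  have hω0 := hω.1 z0
  set A := Kp * B * (ω z0 * Real.exp (-φ z0)) with hA
  have hA0 : 0 < A := by positivity
  have hD1 : ∀ z : ℂ, 1 ≤ 1 + ‖z - z0‖ / ρ z0 := fun z => by
    have : 0 ≤ ‖z - z0‖ / ρ z0 := by positivity
    linarith
  have hmain : ∀ z, ω z * ‖f z‖ * Real.exp (-φ z) ≤ A * ((1 + ‖z - z0‖ / ρ z0) ^ (1 + N1))⁻¹ := by
    intro z
    have hωz := hω.1 z
    have hD := hD1 z
    set D := 1 + ‖z - z0‖ / ρ z0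
    have hD0 : 0 < D := by linarith
    calc _ = ω z * (‖f z‖ * Real.exp (-φ z)) := by ring
      _ ≤ (ω z0 * (B * D ^ m)) * (Kp * Real.exp (-φ z0) * (D ^ (m + 1 + N1))⁻¹) := by
        exact mul_le_mul (HB z0 z).1 (hfd z) (by positivity) (by positivity)
      _ = _ := by
        rw [add_assoc, pow_add D m]
        field_simp
        rw [hA]; ring
  have hf1' : Fnorm p φ ω ρ f ≤ ENNReal.ofReal (KF * A) := by
    refine HF z0 f A hA0.le fun z => (hmain z).trans ?_
    have hD := hD1 z
    gcongr
    omega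
  set g : ℂ → ℂ := fun z => (z - z0) / ρ z0 * f z with hg
  have hgd : Differentiable ℂ g := by
    intro z
    exact DifferentiableAt.fun_mul (by fun_prop) (hf z)
  have hgn : ∀ z, ‖g z‖ = ‖z - z0‖ / ρ z0 * ‖f z‖ := fun z => by
    rw [hg]; simp only
    rw [norm_mul, norm_div, Complex.norm_real, Real.norm_of_nonneg hρ0.le]
  have hg1 : Fnorm p φ ω ρ g ≤ ENNReal.ofReal (KF * A) := by
    refine HF z0 g A hA0.le fun z => ?_
    have hD := hD1 z
    have hωz := hω.1 z
    rw [hgn]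
    have hm := hmain z
    have hle : ‖z - z0‖ / ρ z0 ≤ 1 + ‖z - z0‖ / ρ z0 := by linarith
    set D := 1 + ‖z - z0‖ / ρ z0
    have hD0 : 0 < D := by linarith
    calc _ = ‖z - z0‖ / ρ z0 * (ω z * ‖f z‖ * Real.exp (-φ z)) := by ring
      _ ≤ D * (A * (D ^ (1 + N1))⁻¹) := by gcongr
      _ = _ := by rw [pow_add D, pow_one]; field_simp
  have hfm : MemF p φ ω ρ f := ⟨hf, hf1'.trans_lt ENNReal.ofReal_lt_top⟩
  have hgm : MemF p φ ω ρ g := ⟨hgd, hg1.trans_lt ENNReal.ofReal_lt_top⟩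
  have hl : lnorm p φ ω Λ f ≤ ENNReal.ofReal (2 * Q)⁻¹ * lnorm p φ ω Λ g := by
    refine lnorm_mono hω.1 hp (by positivity) fun l hl => ?_
    rw [hgn]
    have h1 : 1 ≤ (2 * Q)⁻¹ * (‖l - z0‖ / ρ z0) := by
      rw [inv_mul_eq_div, le_div_iff₀ (by positivity), one_mul, le_div_iff₀ hρ0]
      exact (hcon l hl).le
    calc _ = 1 * ‖f l‖ := (one_mul _).symm
      _ ≤ _ := by rw [← mul_assoc]; gcongr
  have hfinal : ENNReal.ofReal (ω z0 * ‖f z0‖ * Real.exp (-φ z0)) ≤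
      ENNReal.ofReal (KE * (Cs * ((2 * Q)⁻¹ * (Cs * (KF * A))))) := by
    rw [ENNReal.ofReal_mul hKE.le, ENNReal.ofReal_mul hCs.le, ENNReal.ofReal_mul (p := (2 * Q)⁻¹) (by positivity),
      ENNReal.ofReal_mul hCs.le]
    refine (HE z0 f hf).trans ?_
    gcongr
    refine (HS f hfm).2.trans ?_
    gcongr
    refine hl.trans ?_
    gcongr
    refine (HS g hgm).1.trans ?_
    gcongr
  rw [hf1, norm_one, mul_one] at hfinal
  have hW : 0 < ω z0 * Real.exp (-φ z0) := by positivity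
  have h2 := (ENNReal.ofReal_le_ofReal_iff (by positivity)).1 hfinal
  have h3 : KE * (Cs * ((2 * Q)⁻¹ * (Cs * (KF * A)))) = (1 / 2) * (ω z0 * Real.exp (-φ z0)) := by
    have : KE * (Cs * ((2 * Q)⁻¹ * (Cs * (KF * A)))) = (2 * Q)⁻¹ * (Q * (ω z0 * Real.exp (-φ z0))) := by
      rw [hA, hQ]; ring
    rw [this]
    field_simp
  rw [h3] at h2
  linarith

end norms2


section geometry
variable {φ : ℂ → ℝ} {μ : Measure ℂ} {C : ℝ} {ρ ω : ℂ → ℝ}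

lemma vol_real_closedBall (a : ℂ) {r : ℝ} (hr : 0 ≤ r) : volume.real (closedBall a r) = r ^ 2 * π := by
  rw [measureReal_def, Complex.volume_closedBall, ENNReal.toReal_mul, ENNReal.toReal_pow, ENNReal.toReal_ofReal hr]
  rfl

lemma geom (h : DL φ μ C) (hρ : IsRadius μ ρ) {Λ : Set ℂ} {K0 : ℝ} (hK0 : 0 < K0)
    (hd : ∀ z0, ∃ l ∈ Λ, ‖l - z0‖ ≤ K0 * ρ z0) :
    ∃ c > 0, ∃ ε0 > 0, ∀ (R ε : ℝ) (a : ℂ), 0 < R → 0 < ε → ε ≤ ε0 → ‖a‖ ≤ 10 * R →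
      (∀ z, ‖z‖ ≤ 20 * R → ρ z ≤ ε * R) → ∃ T : Finset ℂ, (∀ l ∈ T, l ∈ Λ) ∧
        (∀ l ∈ T, ‖l - a‖ + ρ l ≤ 2 * R) ∧
        (∀ a ∈ T, ∀ b ∈ T, a ≠ b → Disjoint (ball a (ρ a)) (ball b (ρ b))) ∧
        c * R / ε ≤ ∑ l ∈ T, ρ l := by
  obtain ⟨M, hM⟩ := rad_lower h hρ
  set K2 := 2 * K0 + 2 with hK2
  have hK2p : 0 < K2 := by positivity
  choose lam hlam hlamd using hd
  refine ⟨(25 * K2 ^ 2 * (2 * (1 + K0)) ^ M)⁻¹, by positivity, K2⁻¹, by positivity, ?_⟩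
  intro R ε a hR hε hεs ha hsm
  have hKε : K2 * ε ≤ 1 := by
    calc _ ≤ K2 * K2⁻¹ := by gcongr
      _ = 1 := mul_inv_cancel₀ hK2p.ne'
  obtain ⟨t, ht, htc⟩ := (isCompact_closedBall a R).elim_nhds_subcover (fun z => closedBall z (K2 * ρ z))
    (fun z _ => closedBall_mem_nhds z (by have := (hρ z).1; positivity))
  have hsmall : ∀ b ∈ t, ρ b ≤ ε * R := fun b hb => by
    refine hsm b ?_
    have h1 := ht b hb
    rw [mem_closedBall, dist_eq_norm] at h1
    have h2 : ‖b‖ ≤ ‖b - a‖ + ‖a‖ := by simpa using norm_add_le (b - a) a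
    linarith
  obtain ⟨u, hut, hdis, hcov⟩ := Vitali.exists_disjoint_subfamily_covering_enlargement_closedBall
    (t : Set ℂ) id (fun z => K2 * ρ z) (K2 * (ε * R)) (fun b hb => by
      have := hsmall b hb
      gcongr) 5 (by norm_num)
  have hufin : u.Finite := t.finite_toSet.subset hut
  set s := hufin.toFinset with hs
  have hst : ∀ b ∈ s, b ∈ t := fun b hb => hut (by simpa [hs] using hb)
  have hrl : ∀ b, ρ (lam b) ≤ (1 + K0) * ρ b := fun b => by
    have := rad_lip h hρ (lam b) b
    have := hlamd b
    linarith
  have hsub : ∀ b, ball (lam b) (ρ (lam b)) ⊆ closedBall b (K2 * ρ b) := fun b z hz => by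
    rw [mem_ball, dist_eq_norm] at hz
    rw [mem_closedBall, dist_eq_norm]
    have h2 : ‖z - b‖ ≤ ‖z - lam b‖ + ‖lam b - b‖ := by simpa using norm_add_le (z - lam b) (lam b - b)
    have := hlamd b
    have := hrl b
    have := (hρ b).1
    rw [hK2]
    linarith
  have hdis' : ∀ b ∈ s, ∀ b' ∈ s, b ≠ b' → Disjoint (ball (lam b) (ρ (lam b))) (ball (lam b') (ρ (lam b'))) := by
    intro b hb b' hb' hne
    have := hdis (by simpa [hs] using hb) (by simpa [hs] using hb') hne
    exact Disjoint.mono (hsub b) (hsub b') this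
  have hinj : ∀ b ∈ s, ∀ b' ∈ s, lam b = lam b' → b = b' := by
    intro b hb b' hb' he
    by_contra hne
    have h1 := hdis' b hb b' hb' hne
    rw [← he] at h1
    have h2 : lam b ∈ ball (lam b) (ρ (lam b)) := mem_ball_self (hρ _).1
    exact (Set.disjoint_left.1 h1) h2 h2
  refine ⟨s.image lam, ?_, ?_, ?_, ?_⟩
  · intro l hl
    obtain ⟨b, hb, rfl⟩ := Finset.mem_image.1 hl
    exact hlam b
  · intro l hl
    obtain ⟨b, hb, rfl⟩ := Finset.mem_image.1 hl
    have h1 := ht b (hst b hb)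
    rw [mem_closedBall, dist_eq_norm] at h1
    have h2 : ‖lam b - a‖ ≤ ‖lam b - b‖ + ‖b - a‖ := by simpa using norm_add_le (lam b - b) (b - a)
    have h3 := hlamd b
    have h4 := hrl b
    have h5 := hsmall b (hst b hb)
    have h6 : K2 * ρ b ≤ R := by
      calc _ ≤ K2 * (ε * R) := by gcongr
        _ = (K2 * ε) * R := by ring
        _ ≤ 1 * R := by gcongr
        _ = R := one_mul R
    have := (hρ b).1
    rw [hK2] at h6
    linarith
  · intro l hl l' hl' hne
    obtain ⟨b, hb, rfl⟩ := Finset.mem_image.1 hl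
    obtain ⟨b', hb', rfl⟩ := Finset.mem_image.1 hl'
    exact hdis' b hb b' hb' fun he => hne (by rw [he])
  · rw [Finset.sum_image (fun b hb b' hb' he => hinj b hb b' hb' he)]
    have hvol : R ^ 2 * π ≤ ∑ b ∈ s, (5 * (K2 * ρ b)) ^ 2 * π := by
      rw [← vol_real_closedBall a hR.le]
      calc _ ≤ volume.real (⋃ b ∈ s, closedBall b (5 * (K2 * ρ b))) := by
            refine measureReal_mono ?_ ?_
            · refine htc.trans ?_
              intro z hz
              simp only [mem_iUnion, exists_prop] at hz ⊢
              obtain ⟨b, hb, hzb⟩ := hz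
              obtain ⟨b', hb', hsb⟩ := hcov b hb
              exact ⟨b', by simpa [hs] using hb', hsb hzb⟩
            · exact ((measure_biUnion_lt_top s.finite_toSet fun b _ => measure_closedBall_lt_top)).ne
        _ ≤ ∑ b ∈ s, volume.real (closedBall b (5 * (K2 * ρ b))) := measureReal_biUnion_finset_le _ _
        _ = _ := Finset.sum_congr rfl fun b _ => vol_real_closedBall b (by have := (hρ b).1; positivity)
    have h1 : R ^ 2 ≤ 25 * K2 ^ 2 * (ε * R) * ∑ b ∈ s, ρ b := by
      rw [← Finset.sum_mul] at hvol
      refine (le_of_mul_le_mul_right hvol Real.pi_pos).trans ?_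
      rw [Finset.mul_sum]
      refine Finset.sum_le_sum fun b hb => ?_
      have := hsmall b (hst b hb)
      have := (hρ b).1
      calc _ = 25 * K2 ^ 2 * ρ b * ρ b := by ring
        _ ≤ _ := by gcongr
    have h2 : ∑ b ∈ s, ρ b ≤ (2 * (1 + K0)) ^ M * ∑ b ∈ s, ρ (lam b) := by
      rw [Finset.mul_sum]
      refine Finset.sum_le_sum fun b hb => ?_
      have hb0 := (hρ b).1
      have hl0 := (hρ (lam b)).1
      have h3 : ‖lam b - b‖ / ρ b ≤ K0 := by rw [div_le_iff₀ hb0]; exact hlamd b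
      calc _ ≤ _ := hM b (lam b)
        _ ≤ ρ (lam b) * (2 * (1 + K0)) ^ M := by gcongr
        _ = _ := mul_comm _ _
    rw [div_le_iff₀ hε, inv_mul_le_iff₀ (by positivity)]
    have h4 : R * R ≤ R * (25 * K2 ^ 2 * (2 * (1 + K0)) ^ M * ((∑ b ∈ s, ρ (lam b)) * ε)) := by
      calc R * R = R ^ 2 := by ring
        _ ≤ 25 * K2 ^ 2 * (ε * R) * ((2 * (1 + K0)) ^ M * ∑ b ∈ s, ρ (lam b)) := h1.trans (by gcongr)
        _ = _ := by ring
    exact le_of_mul_le_mul_left h4 hR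

end geometry

section final
variable {φ : ℂ → ℝ} {μ : Measure ℂ} {C : ℝ} {ρ ω : ℂ → ℝ}

lemma dslope_entire {g : ℂ → ℂ} (hg : Differentiable ℂ g) (l : ℂ) : Differentiable ℂ (dslope g l) := by
  have := (Complex.differentiableOn_dslope (f := g) (c := l) (s := univ) univ_mem).2 hg.differentiableOn
  exact differentiableOn_univ.1 this

lemma dslope_zero {g : ℂ → ℂ} {l z : ℂ} (hl : g l = 0) (hz : z ≠ l) : dslope g l z = g z / (z - l) := by
  rw [dslope_of_ne _ hz, slope_def_field, hl, sub_zero]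

lemma interp_core (h : DL φ μ C) (hρ : IsRadius μ ρ) (hω : IsFlatWeight ρ ω) {p : ℝ≥0∞} (hp : 1 ≤ p)
    {Λ : Set ℂ} (hs : IsSampling p φ ω ρ Λ) (hi : IsInterpolating p φ ω ρ Λ) (hne : Λ.Nonempty) :
    ∃ g f0 : ℂ → ℂ, Differentiable ℂ g ∧ MemF p φ ω ρ f0 ∧ (∀ l ∈ Λ, g l = 0) ∧ (∀ l ∈ Λ, deriv g l ≠ 0) ∧
      ∀ l ∈ Λ, ∃ R, 0 ≤ R ∧ ∀ z, R ≤ ‖z‖ → ‖dslope g l z‖ ≤ 4 * ‖f0 z‖ := by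
  obtain ⟨l0, hl0⟩ := hne
  obtain ⟨f0, hf0, hv⟩ := hi (fun l => if l = l0 then 1 else 0)
    (lnorm_fin hp {l0} fun l _ hl' => by rw [if_neg (by simpa using hl')])
  set g : ℂ → ℂ := fun z => (z - l0) * f0 z with hg
  have hgd : Differentiable ℂ g := fun z => DifferentiableAt.fun_mul (by fun_prop) (hf0.1 z)
  have hg0 : ∀ l ∈ Λ, g l = 0 := fun l hl => by
    simp only [hg]
    rw [hv l hl]
    split_ifs with he
    · rw [he]; simp
    · simp
  have hbd : ∀ l ∈ Λ, ∃ R, 0 ≤ R ∧ ∀ z, R ≤ ‖z‖ → ‖dslope g l z‖ ≤ 4 * ‖f0 z‖ := by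
    intro l hl
    refine ⟨2 * (‖l‖ + ‖l0‖) + 1, by positivity, fun z hz => ?_⟩
    have n1 := norm_nonneg l
    have n2 := norm_nonneg l0
    have e1 : ‖z‖ ≤ ‖z - l‖ + ‖l‖ := by simpa using norm_add_le (z - l) l
    have e2 := norm_sub_le z l0
    have hz0 : 0 < ‖z - l‖ := by linarith
    have hzl : z ≠ l := fun he => by rw [he, sub_self, norm_zero] at hz0; exact lt_irrefl _ hz0
    rw [dslope_zero (hg0 l hl) hzl, norm_div, div_le_iff₀ hz0]
    simp only [hg]
    rw [norm_mul]
    have e3 : ‖z - l0‖ ≤ 4 * ‖z - l‖ := by linarith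
    calc _ ≤ (4 * ‖z - l‖) * ‖f0 z‖ := by gcongr
      _ = _ := by ring
  refine ⟨g, f0, hgd, hf0, hg0, fun l hl hder => ?_, hbd⟩
  obtain ⟨R, -, hR⟩ := hbd l hl
  have hm : MemF p φ ω ρ (dslope g l) := memF_transfer h hρ hω hp (dslope_entire hgd l) hf0 (by norm_num) hR
  have hz := zero_of_vanish h hρ hω hp hs hm (fun l' hl' => by
    by_cases he : l' = l
    · rw [he, dslope_same, hder]
    · rw [dslope_zero (hg0 l hl) he, hg0 l' hl', zero_div])
  have hgz : ∀ z, g z = 0 := fun z => by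
    by_cases he : z = l
    · rw [he]; exact hg0 l hl
    · have := hz z
      rw [dslope_zero (hg0 l hl) he, div_eq_zero_iff] at this
      exact this.resolve_right (sub_ne_zero.2 he)
  have hf0z : ∀ z, z ≠ l0 → f0 z = 0 := fun z hz => by
    have := hgz z
    simp only [hg] at this
    exact (mul_eq_zero.1 this).resolve_left (sub_ne_zero.2 hz)
  have h1 : f0 l0 = 1 := by rw [hv l0 hl0, if_pos rfl]
  have h2 : f0 = fun _ => 0 := by
    refine Continuous.ext_on (dense_compl_singleton l0) hf0.1.continuous continuous_const ?_
    intro z hz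
    exact hf0z z hz
  rw [h2] at h1
  exact zero_ne_one h1

lemma compare {p : ℝ≥0∞} (hω : IsFlatWeight ρ ω) (hρ : IsRadius μ ρ) (hp : 1 ≤ p) {Λ : Set ℂ} {K Cs : ℝ} (hK : 0 < K) 
    (hCs : 0 < Cs) {g : ℂ → ℂ} (hgd : Differentiable ℂ g) (hg0 : ∀ l ∈ Λ, g l = 0)
    {T1 T2 : Finset ℂ} (hT1 : ∀ l ∈ T1, l ∈ Λ) (hT2 : ∀ l ∈ T2, l ∈ Λ)
    (hE : ∀ (G : ℂ → ℂ) (f : ℂ → ℂ → ℂ) (v : ℂ → ℂ), (∀ l ∈ T2, Differentiable ℂ (f l)) →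
      (∀ l ∈ T2, ∀ z ∈ ann l (ρ l), ‖f l z‖ ≤ ‖G z‖) → (∀ l ∈ Λ, l ∉ T2 → v l = 0) →
      (∀ l ∈ T2, ‖v l‖ ≤ ‖f l l‖) →
      lnorm p φ ω Λ v ≤ ENNReal.ofReal K * Fnorm p φ ω ρ G)
    (hS : Fnorm p φ ω ρ (fun z => ∑ l ∈ T1, (ρ l : ℂ) * dslope g l z) ≤ 
      ENNReal.ofReal Cs * lnorm p φ ω Λ (fun z => ∑ l ∈ T1, (ρ l : ℂ) * dslope g l z))
    {κ s : ℝ} (hs : |s| = 1) (hκ : 0 < κ)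
    (hre : ∀ l' ∈ T2, ∀ z ∈ ann l' (ρ l'), (∀ l ∈ T1, z ≠ l) ∧ κ ≤ s * (∑ l ∈ T1, (ρ l : ℂ) / (z - l)).re) :
    lnorm p φ ω Λ (fun z => ∑ l ∈ T2, (ρ l : ℂ) * dslope g l z) ≤ ENNReal.ofReal (2 / κ * K * Cs) *
      lnorm p φ ω Λ (fun z => ∑ l ∈ T1, (ρ l : ℂ) * dslope g l z) := by
  have hval : ∀ l ∈ Λ, (∑ l' ∈ T2, (ρ l' : ℂ) * dslope g l' l) = if l ∈ T2 then (ρ l : ℂ) * dslope g l l else 0 := by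
    intro l hl
    rw [← Finset.sum_ite_eq T2 l (fun l' => (ρ l' : ℂ) * dslope g l' l)]
    refine Finset.sum_congr rfl fun l' hl' => ?_
    split_ifs with he
    · rfl
    · rw [dslope_zero (hg0 l' (hT2 l' hl')) he, hg0 l hl, zero_div, mul_zero]
  have h1 := hE (fun z => ∑ l ∈ T1, (ρ l : ℂ) * dslope g l z)
    (fun l z => ((κ / 2 : ℝ) : ℂ) * ((ρ l : ℂ) * dslope g l z))
    (fun z => ((κ / 2 : ℝ) : ℂ) * ∑ l ∈ T2, (ρ l : ℂ) * dslope g l z) ?_ ?_ ?_ ?_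
  · have h2 : lnorm p φ ω Λ (fun z => ∑ l ∈ T2, (ρ l : ℂ) * dslope g l z) ≤ ENNReal.ofReal (2 / κ) *
        lnorm p φ ω Λ (fun z => ((κ / 2 : ℝ) : ℂ) * ∑ l ∈ T2, (ρ l : ℂ) * dslope g l z) := by
      refine lnorm_mono hω.1 hp (by positivity) fun l _ => le_of_eq ?_
      rw [norm_mul, Complex.norm_real, Real.norm_of_nonneg (by positivity)]
      field_simp
    refine h2.trans ?_
    rw [ENNReal.ofReal_mul (by positivity), ENNReal.ofReal_mul (by positivity), mul_assoc, mul_assoc]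
    gcongr
    refine h1.trans ?_
    gcongr
  · intro l _ z
    exact DifferentiableAt.fun_mul (by fun_prop) (DifferentiableAt.fun_mul (by fun_prop) (dslope_entire hgd l z))
  · intro l' hl' z hz
    obtain ⟨hne, hk⟩ := hre l' hl' z hz
    have hρl := (hρ l').1
    have hzl : 0 < ‖z - l'‖ := by have := hz.1; linarith
    have hzne : z ≠ l' := fun he => by rw [he, sub_self, norm_zero] at hzl; exact lt_irrefl _ hzl
    have e1 : ∑ l ∈ T1, (ρ l : ℂ) * dslope g l z = g z * ∑ l ∈ T1, (ρ l : ℂ) / (z - l) := by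
      rw [Finset.mul_sum]
      refine Finset.sum_congr rfl fun l hl => ?_
      rw [dslope_zero (hg0 l (hT1 l hl)) (hne l hl)]
      ring
    rw [e1, norm_mul, norm_mul, norm_mul, Complex.norm_real, Complex.norm_real, Real.norm_of_nonneg (by positivity),
      Real.norm_of_nonneg hρl.le, dslope_zero (hg0 l' (hT2 l' hl')) hzne, norm_div]
    have e2 : κ ≤ ‖∑ l ∈ T1, (ρ l : ℂ) / (z - l)‖ := by
      refine hk.trans ((le_abs_self _).trans ?_)
      rw [abs_mul, hs, one_mul]
      exact Complex.abs_re_le_norm _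
    have e3 : ρ l' / ‖z - l'‖ ≤ 2 := by
      rw [div_le_iff₀ hzl]
      have := hz.1
      linarith
    calc _ = κ / 2 * ‖g z‖ * (ρ l' / ‖z - l'‖) := by ring
      _ ≤ κ / 2 * ‖g z‖ * 2 := by gcongr
      _ = ‖g z‖ * κ := by ring
      _ ≤ _ := by gcongr
  · intro l hl hl'
    rw [hval l hl, if_neg hl', mul_zero]
  · intro l hl
    rw [hval l (hT2 l hl), if_pos hl]

lemma main_contra (h : DL φ μ C) (hρ : IsRadius μ ρ) (hω : IsFlatWeight ρ ω) {p : ℝ≥0∞} (hp : 1 ≤ p)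
    {Λ : Set ℂ} (hs : IsSampling p φ ω ρ Λ) (hi : IsInterpolating p φ ω ρ Λ) : False := by
  obtain ⟨K0, hK0, hd⟩ := rel_dense h hρ hω hp hs
  obtain ⟨c, hc, ε0, hε0, hgeo⟩ := geom h hρ hK0 hd
  obtain ⟨Cs, hCs, HS⟩ := sampling_unif hs
  obtain ⟨K, hK, HE⟩ := lem_E h hρ hω hp
  obtain ⟨l0, hl0, -⟩ := hd 0
  obtain ⟨g, f0, hgd, hf0, hg0, hder, hbd⟩ := interp_core h hρ hω hp hs hi ⟨l0, hl0⟩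
  set ε := min ε0 (c / (160 * K * Cs)) with hε
  have hεp : 0 < ε := by positivity
  have hεK : 160 * K * Cs * ε ≤ c := by
    calc _ ≤ 160 * K * Cs * (c / (160 * K * Cs)) := by gcongr; exact min_le_right _ _
      _ = c := by field_simp
  obtain ⟨R, hR, hsm⟩ := rad_small h hρ hεp
  obtain ⟨T1, hT1, hT1a, hT1d, hT1s⟩ := hgeo R ε 0 hR hεp (min_le_left _ _) (by simpa using by positivity) hsm
  obtain ⟨T2, hT2, hT2a, hT2d, hT2s⟩ := hgeo R ε (10 * R : ℝ) hR hεp (min_le_left _ _)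
    (by rw [Complex.norm_real, Real.norm_of_nonneg (by positivity)]) hsm
  set F : Finset ℂ → ℂ → ℂ := fun T z => ∑ l ∈ T, (ρ l : ℂ) * dslope g l z with hF
  have hmem : ∀ T : Finset ℂ, (∀ l ∈ T, l ∈ Λ) → MemF p φ ω ρ (F T) := by
    intro T hT
    choose! r hr0 hr using hbd
    refine memF_transfer h hρ hω hp ?_ hf0 (R := ∑ l ∈ T, r l) (c := ∑ l ∈ T, ρ l * 4)
      (Finset.sum_nonneg fun l _ => by have := (hρ l).1; positivity) ?_
    · intro z
      exact DifferentiableAt.fun_sum fun l _ => DifferentiableAt.fun_mul (by fun_prop) (dslope_entire hgd l z)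
    · intro z hz
      simp only [hF]
      rw [Finset.sum_mul]
      refine (norm_sum_le _ _).trans (Finset.sum_le_sum fun l hl => ?_)
      have hρl := (hρ l).1
      rw [norm_mul, Complex.norm_real, Real.norm_of_nonneg hρl.le, mul_assoc]
      gcongr
      refine hr l (hT l hl) z (le_trans ?_ hz)
      exact Finset.single_le_sum (f := r) (fun l hl => hr0 l (hT l hl)) hl
  have hRe : ∀ (s : ℝ) (l z : ℂ), |s| = 1 → 6 * R ≤ s * (z - l).re → ‖z - l‖ ≤ 14 * R →
      (40 * R)⁻¹ * ρ l ≤ s * ((ρ l : ℂ) / (z - l)).re := by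
    intro s l z hs1 h1 h2
    have hρl := (hρ l).1
    have hn : 0 < ‖z - l‖ := by
      rw [norm_pos_iff]
      intro h0
      rw [h0] at h1
      simp at h1
      linarith
    have e1 : ((ρ l : ℂ) / (z - l)).re = ρ l * (z - l).re / ‖z - l‖ ^ 2 := by
      rw [Complex.div_re, Complex.ofReal_re, Complex.ofReal_im, Complex.normSq_eq_norm_sq]
      simp
    rw [e1]
    have e2 : s * (ρ l * (z - l).re / ‖z - l‖ ^ 2) = ρ l * (s * (z - l).re / ‖z - l‖ ^ 2) := by ring
    rw [e2, mul_comm]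
    gcongr
    rw [le_div_iff₀ (by positivity), inv_mul_le_iff₀ (by positivity)]
    calc _ ≤ (14 * R) ^ 2 := by gcongr
      _ ≤ 40 * R * (6 * R) := by nlinarith [sq_nonneg R]
      _ ≤ _ := by gcongr
  have hcmp : ∀ (s : ℝ) (Ta Tb : Finset ℂ), |s| = 1 → (∀ l ∈ Ta, l ∈ Λ) → (∀ l ∈ Tb, l ∈ Λ) → 
      (∀ a ∈ Tb, ∀ b ∈ Tb, a ≠ b → Disjoint (ball a (ρ a)) (ball b (ρ b))) → c * R / ε ≤ ∑ l ∈ Ta, ρ l →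
      (∀ l' ∈ Tb, ∀ z ∈ ann l' (ρ l'), ∀ l ∈ Ta, 6 * R ≤ s * (z - l).re ∧ ‖z - l‖ ≤ 14 * R) →
      lnorm p φ ω Λ (F Tb) ≤ ENNReal.ofReal (1 / 2) * lnorm p φ ω Λ (F Ta) := by
    intro s Ta Tb hs1 hTa hTb hdis hsum hpos
    have hSp : 0 < c * R / ε := by positivity
    have hκ : 0 < (40 * R)⁻¹ * ∑ l ∈ Ta, ρ l := mul_pos (by positivity) (by linarith)
    refine (compare hω hρ hp hK hCs hgd hg0 hTa hTb (HE Λ Tb hdis) (HS _ (hmem Ta hTa)).2 hs1 hκ ?_).trans ?_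
    · intro l' hl' z hz
      refine ⟨fun l hl he => ?_, ?_⟩
      · have := (hpos l' hl' z hz l hl).1
        rw [he] at this
        simp at this
        linarith
      · rw [Complex.re_sum, Finset.mul_sum, Finset.mul_sum]
        exact Finset.sum_le_sum fun l hl => hRe s l z hs1 (hpos l' hl' z hz l hl).1 (hpos l' hl' z hz l hl).2
    · gcongr
      rw [div_mul_eq_mul_div, div_mul_eq_mul_div, div_le_iff₀ hκ]
      have e1 : (40 * R)⁻¹ * (c * R / ε) ≤ (40 * R)⁻¹ * ∑ l ∈ Ta, ρ l := by gcongr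
      have e2 : (40 * R)⁻¹ * (c * R / ε) = c / (40 * ε) := by field_simp
      have e3 : 4 * K * Cs ≤ c / (40 * ε) := by
        rw [le_div_iff₀ (by positivity)]
        linarith
      linarith
  have hab : ∀ a : ℂ, ∀ l' z : ℂ, ‖l' - a‖ + ρ l' ≤ 2 * R → z ∈ ann l' (ρ l') → ‖z - a‖ ≤ 2 * R := by
    intro a l' z h1 hz
    have := hz.2
    have h2 : ‖z - a‖ ≤ ‖z - l'‖ + ‖l' - a‖ := by simpa using norm_add_le (z - l') (l' - a)
    linarith
  have hre0 : ∀ w : ℂ, ‖w‖ ≤ 2 * R → |w.re| ≤ 2 * R := fun w hw => (Complex.abs_re_le_norm w).trans hw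
  have hla : ∀ a l : ℂ, ‖l - a‖ + ρ l ≤ 2 * R → ‖l - a‖ ≤ 2 * R := fun a l hl => by
    have := (hρ l).1; linarith
  have h10 : ‖((10 * R : ℝ) : ℂ)‖ = 10 * R := by rw [Complex.norm_real, Real.norm_of_nonneg (by positivity)]
  have c12 := hcmp 1 T1 T2 (by simp) hT1 hT2 hT2d hT1s (by
    intro l' hl' z hz l hl
    have h1 := hab _ l' z (hT2a l' hl') hz
    have h2 := hla _ l (hT1a l hl)
    have h3 := abs_le.1 (hre0 _ h1)
    have h4 := abs_le.1 (hre0 _ h2)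
    simp only [Complex.sub_re, Complex.ofReal_re, Complex.zero_re] at h3 h4 ⊢
    refine ⟨by linarith [h3.1, h4.2], ?_⟩
    have h5 : z - l = (z - ((10 * R : ℝ) : ℂ)) + ((10 * R : ℝ) : ℂ) - (l - 0) := by ring
    rw [h5]
    refine (norm_sub_le _ _).trans ?_
    have := norm_add_le (z - ((10 * R : ℝ) : ℂ)) ((10 * R : ℝ) : ℂ)
    linarith)
  have c21 := hcmp (-1) T2 T1 (by simp) hT2 hT1 hT1d hT2s (by
    intro l' hl' z hz l hl
    have h1 := hab _ l' z (hT1a l' hl') hz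
    have h2 := hla _ l (hT2a l hl)
    have h3 := abs_le.1 (hre0 _ h1)
    have h4 := abs_le.1 (hre0 _ h2)
    simp only [Complex.sub_re, Complex.ofReal_re, Complex.zero_re] at h3 h4 ⊢
    refine ⟨by linarith [h3.2, h4.1], ?_⟩
    have h5 : z - l = (z - 0) - ((l - ((10 * R : ℝ) : ℂ)) + ((10 * R : ℝ) : ℂ)) := by ring
    rw [h5]
    refine (norm_sub_le _ _).trans ?_
    have := norm_add_le (l - ((10 * R : ℝ) : ℂ)) ((10 * R : ℝ) : ℂ)
    linarith)
  -- the norm is finite and positive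
  have hval : ∀ l ∈ Λ, F T1 l = if l ∈ T1 then (ρ l : ℂ) * dslope g l l else 0 := by
    intro l hl
    simp only [hF]
    rw [← Finset.sum_ite_eq T1 l (fun l' => (ρ l' : ℂ) * dslope g l' l)]
    refine Finset.sum_congr rfl fun l' hl' => ?_
    split_ifs with he
    · rfl
    · rw [dslope_zero (hg0 l' (hT1 l' hl')) he, hg0 l hl, zero_div, mul_zero]
  have hfin : lnorm p φ ω Λ (F T1) < ∞ := lnorm_fin hp T1 fun l hl hl' => by rw [hval l hl, if_neg hl']
  have hT1ne : T1.Nonempty := by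
    rw [Finset.nonempty_iff_ne_empty]
    intro h0
    rw [h0, Finset.sum_empty] at hT1s
    have : 0 < c * R / ε := by positivity
    linarith
  obtain ⟨l, hl⟩ := hT1ne
  have hpos : 0 < lnorm p φ ω Λ (F T1) := by
    refine lt_of_lt_of_le ?_ (lnorm_single hω.1 hp (F T1) (hT1 l hl))
    rw [ENNReal.ofReal_pos, hval l (hT1 l hl), if_pos hl, dslope_same]
    have h1 := hω.1 l
    have h2 := (hρ l).1
    have h3 : 0 < ‖(ρ l : ℂ) * deriv g l‖ := by
      rw [norm_pos_iff]
      exact mul_ne_zero (by exact_mod_cast h2.ne') (hder l (hT1 l hl))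
    positivity
  have hlast : lnorm p φ ω Λ (F T1) ≤ ENNReal.ofReal (1 / 4) * lnorm p φ ω Λ (F T1) := by
    calc _ ≤ _ := c21
      _ ≤ ENNReal.ofReal (1 / 2) * (ENNReal.ofReal (1 / 2) * lnorm p φ ω Λ (F T1)) := by gcongr
      _ = _ := by
        rw [← mul_assoc, ← ENNReal.ofReal_mul (by positivity)]
        norm_num
  set x := lnorm p φ ω Λ (F T1) with hx
  have hy : x = ENNReal.ofReal x.toReal := (ENNReal.ofReal_toReal hfin.ne).symm
  rw [hy, ← ENNReal.ofReal_mul (by positivity)] at hlast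
  have hxp : 0 < x.toReal := ENNReal.toReal_pos hpos.ne' hfin.ne
  have := (ENNReal.ofReal_le_ofReal_iff (by positivity)).1 hlast
  linarith

end final

/-- There is no sequence which is simultaneously sampling and interpolating for
`F^p_{φ,ω}`, for any `1 ≤ p ≤ ∞`. -/
theorem no_sampling_and_interpolating
    (φ : ℂ → ℝ) (μ : Measure ℂ) (hφ : HasDoublingLaplacian φ μ)
    (ρ : ℂ → ℝ) (hρ : IsRadius μ ρ)
    (ω : ℂ → ℝ) (hω : IsFlatWeight ρ ω) :
    ∀ p : ℝ≥0∞, 1 ≤ p → ∀ Λ : Set ℂ,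
      ¬ (IsSampling p φ ω ρ Λ ∧ IsInterpolating p φ ω ρ Λ) := by
  obtain ⟨C, h⟩ := DL_of hφ hρ
  rintro p hp Λ ⟨hs, hi⟩
  exact main_contra h hρ hω hp hs hi

end
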